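/- Let Δ be a simplicial complex on [n] with dim Δ ≥ 2. The following conditions are equivalent: (i) I_Δ^m is generalized Cohen–Macaulay for every m ≥ 1; (ii) I_Δ^m is generalized Cohen–Macaulay for some m ≥ 3; (iii) Δ is a union of disjoint complete intersections of the same dimension. -/

import Mathlib

open CategoryTheory Opposite

/-! ### Abstract simplicial complexes -/

/-- An abstract simplicial complex on the vertex set `Fin n`: a collection of finite
subsets (faces) closed under taking subsets. -/
structure SimComplex (n : ℕ) where
  faces : Set (Finset (Fin n))
  down_closed : ∀ ⦃F G : Finset (Fin n)⦄, F ∈ faces → G ⊆ F → G ∈ faces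

namespace SimComplex

variable {n : ℕ}

/-- The vertex set of a simplicial complex. -/
def vertexSet (Δ : SimComplex n) : Set (Fin n) := {v | ({v} : Finset (Fin n)) ∈ Δ.faces}

/-- The dimension of a simplicial complex: the maximal cardinality of a face, minus one. -/
noncomputable def dim (Δ : SimComplex n) : ℤ :=
  (Int.ofNat (sSup (Finset.card '' Δ.faces))) - 1

/-- A facet is a maximal face. -/
def IsFacet (Δ : SimComplex n) (F : Finset (Fin n)) : Prop :=
  F ∈ Δ.faces ∧ ∀ G ∈ Δ.faces, F ⊆ G → F = G

/-- A complex is pure if all facets have the same cardinality. -/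
def Pure (Δ : SimComplex n) : Prop :=
  ∀ F G, Δ.IsFacet F → Δ.IsFacet G → F.card = G.card

/-- A matroid: for any two faces `F`, `G` with `|F| > |G|` there is `i ∈ F ∖ G`
with `G ∪ {i}` a face. -/
def IsMatroid (Δ : SimComplex n) : Prop :=
  ∀ F G, F ∈ Δ.faces → G ∈ Δ.faces → G.card < F.card →
    ∃ i ∈ F, i ∉ G ∧ insert i G ∈ Δ.faces

/-- The link of a face `G`: `{F ∖ G : G ⊆ F ∈ Δ}`. -/
def link (Δ : SimComplex n) (G : Finset (Fin n)) : SimComplex n where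
  faces := {F | Disjoint F G ∧ F ∪ G ∈ Δ.faces}
  down_closed := by
    intro F F' hF hsub
    exact ⟨hF.1.mono_left hsub, Δ.down_closed hF.2 (Finset.union_subset_union hsub subset_rfl)⟩

/-- The star of a face `G`: `{F ∈ Δ : F ∪ G ∈ Δ}`. -/
def star (Δ : SimComplex n) (G : Finset (Fin n)) : SimComplex n where
  faces := {F | F ∈ Δ.faces ∧ F ∪ G ∈ Δ.faces}
  down_closed := by
    intro F F' hF hsub
    exact ⟨Δ.down_closed hF.1 hsub, Δ.down_closed hF.2 (Finset.union_subset_union hsub subset_rfl)⟩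

/-- `Δ` is locally a matroid if the link of every vertex is a matroid. -/
def LocallyMatroid (Δ : SimComplex n) : Prop :=
  ∀ v ∈ Δ.vertexSet, (Δ.link {v}).IsMatroid

/-- Two vertices are adjacent if they span a 1-dimensional face (an edge). -/
def Adj (Δ : SimComplex n) (u v : Fin n) : Prop :=
  u ≠ v ∧ ({u, v} : Finset (Fin n)) ∈ Δ.faces

/-- Two vertices are joined by a path of edges. -/
def Reach (Δ : SimComplex n) : Fin n → Fin n → Prop := Relation.ReflTransGen Δ.Adj

/-- A complex is connected if any two vertices are joined by a path of edges. -/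
def Connected (Δ : SimComplex n) : Prop :=
  ∀ u ∈ Δ.vertexSet, ∀ v ∈ Δ.vertexSet, Δ.Reach u v

/-- The induced subcomplex on a set `W` of vertices. -/
def induced (Δ : SimComplex n) (W : Set (Fin n)) : SimComplex n where
  faces := {F | F ∈ Δ.faces ∧ ↑F ⊆ W}
  down_closed := by
    intro F F' hF hsub
    exact ⟨Δ.down_closed hF.1 hsub, subset_trans (Finset.coe_subset.2 hsub) hF.2⟩

/-- The connected component of a vertex `v`, as an induced subcomplex. -/
def component (Δ : SimComplex n) (v : Fin n) : SimComplex n :=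
  Δ.induced {u | Δ.Reach v u}

/-- A minimal nonface: a subset of the vertex set which is not a face, all of whose
proper subsets are faces. -/
def IsMinNonface (Δ : SimComplex n) (F : Finset (Fin n)) : Prop :=
  ↑F ⊆ Δ.vertexSet ∧ F ∉ Δ.faces ∧ ∀ G ⊂ F, G ∈ Δ.faces

/-- A complete intersection complex: the minimal nonfaces are pairwise disjoint. -/
def IsCompleteIntersection (Δ : SimComplex n) : Prop :=
  ∀ F G, Δ.IsMinNonface F → Δ.IsMinNonface G → F ≠ G → Disjoint F G

/-- `Δ` is locally a complete intersection if the link of every vertex is one. -/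
def LocallyCompleteIntersection (Δ : SimComplex n) : Prop :=
  ∀ v ∈ Δ.vertexSet, (Δ.link {v}).IsCompleteIntersection

/-- A path graph: vertices `f 0, …, f (k+1)` and edges exactly the consecutive pairs. -/
def IsPathGraph (Δ : SimComplex n) : Prop :=
  ∃ (k : ℕ) (f : Fin (k + 2) → Fin n), Function.Injective f ∧
    Δ.vertexSet = Set.range f ∧
    ∀ e : Finset (Fin n), (e ∈ Δ.faces ∧ e.card = 2) ↔
      ∃ i : Fin (k + 1), e = {f i.castSucc, f i.succ}

/-- A cycle graph: vertices `f 0, …, f (k+2)` and edges exactly the cyclically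
consecutive pairs. -/
def IsCycleGraph (Δ : SimComplex n) : Prop :=
  ∃ (k : ℕ) (f : Fin (k + 3) → Fin n), Function.Injective f ∧
    Δ.vertexSet = Set.range f ∧
    ∀ e : Finset (Fin n), (e ∈ Δ.faces ∧ e.card = 2) ↔
      ∃ i : Fin (k + 3), e = {f i, f (i + 1)}

end SimComplex

/-! ### Commutative-algebra notions -/

noncomputable section

/-- The `i`-th Ext group of two modules over a commutative ring. -/
def ExtGroup (A : Type) [CommRing A] (i : ℕ) (M N : Type) [AddCommGroup M] [Module A M]
    [AddCommGroup N] [Module A N] : Type :=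
  ((Ext A (ModuleCat A) i).obj (op (ModuleCat.of A M))).obj (ModuleCat.of A N)

/-- A local ring is Cohen–Macaulay if its depth equals its Krull dimension, i.e. if
`Ext^i(residue field, B)` vanishes for all `i < dim B`. -/
def IsCohenMacaulayLocalRing (B : Type) [CommRing B] [IsLocalRing B] : Prop :=
  ∀ i : ℕ, (i : WithBot ℕ∞) < ringKrullDim B →
    Subsingleton (ExtGroup B i (B ⧸ IsLocalRing.maximalIdeal B) B)

/-- A commutative ring is Cohen–Macaulay if all its localizations at primes are
Cohen–Macaulay local rings. -/
def IsCohenMacaulayRing (A : Type) [CommRing A] : Prop :=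
  ∀ (P : Ideal A) (hP : P.IsPrime),
    letI : P.IsPrime := hP
    IsCohenMacaulayLocalRing (Localization.AtPrime P)

/-- An ideal `I` of `A` is Cohen–Macaulay if `A ⧸ I` is a Cohen–Macaulay ring. -/
def IsCohenMacaulayIdeal {A : Type} [CommRing A] (I : Ideal A) : Prop :=
  IsCohenMacaulayRing (A ⧸ I)

/-- The ideal `I` satisfies Serre's condition `(S₂)`: for every prime `P` of `A`, the
depth of the localized module `(A⧸I)_P` over `A_P` is at least `min {2, height P}`,
where the height of `P` is the Krull dimension of `A_P` and depth is detected by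
vanishing of `Ext^i` from the residue field. -/
def SatisfiesS2 {A : Type} [CommRing A] (I : Ideal A) : Prop :=
  ∀ (P : Ideal A) (hP : P.IsPrime),
    letI : P.IsPrime := hP
    ∀ i : ℕ, (i : WithBot ℕ∞) < min 2 (ringKrullDim (Localization.AtPrime P)) →
      Subsingleton (ExtGroup (Localization.AtPrime P) i
        (Localization.AtPrime P ⧸ IsLocalRing.maximalIdeal (Localization.AtPrime P))
        (LocalizedModule P.primeCompl (A ⧸ I)))

/-- The `m`-th symbolic power of an ideal: the intersection of the `m`-th powers of
its minimal primes. -/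
def symbPowIdeal {A : Type} [CommRing A] (I : Ideal A) (m : ℕ) : Ideal A :=
  ⨅ P ∈ I.minimalPrimes, P ^ m

end

/-! ### Stanley–Reisner theory -/

noncomputable section

open MvPolynomial

/-- The squarefree monomial attached to a finite set of variables. -/
def faceMonomial (K : Type) [Field K] {n : ℕ} (F : Finset (Fin n)) : MvPolynomial (Fin n) K :=
  ∏ i ∈ F, X i

/-- The Stanley–Reisner ideal of a complex on `[n]`: generated by the squarefree
monomials corresponding to nonfaces. -/
def SRIdeal (K : Type) [Field K] {n : ℕ} (Δ : SimComplex n) : Ideal (MvPolynomial (Fin n) K) :=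
  Ideal.span {p | ∃ F : Finset (Fin n), F ∉ Δ.faces ∧ p = faceMonomial K F}

/-- The Stanley–Reisner ideal of a complex whose vertex set may be a proper subset of
`[n]`: generated by the squarefree monomials of nonfaces contained in the vertex set. -/
def SRIdealOn (K : Type) [Field K] {n : ℕ} (Δ : SimComplex n) : Ideal (MvPolynomial (Fin n) K) :=
  Ideal.span {p | ∃ F : Finset (Fin n), ↑F ⊆ Δ.vertexSet ∧ F ∉ Δ.faces ∧ p = faceMonomial K F}

/-- The prime ideal generated by the variables indexed by `F`. -/
def PF (K : Type) [Field K] {n : ℕ} (F : Finset (Fin n)) : Ideal (MvPolynomial (Fin n) K) :=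
  Ideal.span ((fun i => (X i : MvPolynomial (Fin n) K)) '' ↑F)

/-- The `m`-th symbolic power of the Stanley–Reisner ideal:
`I_Δ^{(m)} = ⋂_{F facet} P_{complement of F}^m`. -/
def SRSymbPow (K : Type) [Field K] {n : ℕ} (Δ : SimComplex n) (m : ℕ) :
    Ideal (MvPolynomial (Fin n) K) :=
  ⨅ (F : Finset (Fin n)) (_ : Δ.IsFacet F), (PF K Fᶜ) ^ m

/-- The cover ideal `J(Δ) = ⋂_{F facet} P_F` and its symbolic powers. -/
def coverSymbPow (K : Type) [Field K] {n : ℕ} (Δ : SimComplex n) (m : ℕ) :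
    Ideal (MvPolynomial (Fin n) K) :=
  ⨅ (F : Finset (Fin n)) (_ : Δ.IsFacet F), (PF K F) ^ m

/-- The graded maximal ideal `(x_1, …, x_n)`. -/
def maxIdeal (K : Type) [Field K] (n : ℕ) : Ideal (MvPolynomial (Fin n) K) :=
  Ideal.span (Set.range X)

/-- The `i`-th local cohomology module of `S ⧸ I` with support in the maximal
graded ideal. -/
def locCoh (K : Type) [Field K] {n : ℕ} (i : ℕ) (I : Ideal (MvPolynomial (Fin n) K)) :
    ModuleCat (MvPolynomial (Fin n) K) :=
  (localCohomology (maxIdeal K n) i).obj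
    (ModuleCat.of (MvPolynomial (Fin n) K) (MvPolynomial (Fin n) K ⧸ I))

/-- `I` is quasi-Buchsbaum: the maximal ideal annihilates all local cohomology modules
`H^i_m(S⧸I)` for `i < dim S⧸I`. -/
def IsQuasiBuchsbaum (K : Type) [Field K] {n : ℕ} (I : Ideal (MvPolynomial (Fin n) K)) : Prop :=
  ∀ i : ℕ, (i : WithBot ℕ∞) < ringKrullDim (MvPolynomial (Fin n) K ⧸ I) →
    ∀ x ∈ maxIdeal K n, ∀ y : (locCoh K i I), x • y = 0

/-- `I` is Buchsbaum: for `i < dim S⧸I` the natural map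
`Ext^i_S(S⧸m, S⧸I) → H^i_m(S⧸I)` (the structure map into the direct limit defining local
cohomology) is surjective. -/
def IsBuchsbaum (K : Type) [Field K] {n : ℕ} (I : Ideal (MvPolynomial (Fin n) K)) : Prop :=
  ∀ i : ℕ, (i : WithBot ℕ∞) < ringKrullDim (MvPolynomial (Fin n) K ⧸ I) →
    letI := localCohomology.hasColimitDiagram
      (localCohomology.idealPowersDiagram (maxIdeal K n)) i
    Function.Surjective
      ((CategoryTheory.Limits.colimit.ι
          (localCohomology.diagram (localCohomology.idealPowersDiagram (maxIdeal K n)) i)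
          (Opposite.op (Opposite.op (1 : ℕ)))).app
        (ModuleCat.of (MvPolynomial (Fin n) K) (MvPolynomial (Fin n) K ⧸ I)))

/-- `I` is generalized Cohen–Macaulay: the local cohomology modules `H^i_m(S⧸I)` are
finite-dimensional over `K` for `i < dim S⧸I`. -/
def IsGeneralizedCM (K : Type) [Field K] {n : ℕ} (I : Ideal (MvPolynomial (Fin n) K)) : Prop :=
  ∀ i : ℕ, (i : WithBot ℕ∞) < ringKrullDim (MvPolynomial (Fin n) K ⧸ I) →
    Module.Finite K (RestrictScalars K (MvPolynomial (Fin n) K) (locCoh K i I))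

end

/-! ### Monomial ideals -/

/-- A monomial ideal of `K[x_1,…,x_n]`. -/
def IsMonomialIdeal {K : Type} [Field K] {n : ℕ} (I : Ideal (MvPolynomial (Fin n) K)) : Prop :=
  ∃ S : Set (Fin n →₀ ℕ),
    I = Ideal.span {p | ∃ d ∈ S, p = MvPolynomial.monomial d (1 : K)}

/-- A squarefree monomial ideal of `K[x_1,…,x_n]`. -/
def IsSquarefreeMonomialIdeal {K : Type} [Field K] {n : ℕ}
    (I : Ideal (MvPolynomial (Fin n) K)) : Prop :=
  ∃ S : Set (Finset (Fin n)),
    I = Ideal.span {p | ∃ F ∈ S, p = ∏ i ∈ F, (MvPolynomial.X i : MvPolynomial (Fin n) K)}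


section
open CategoryTheory Opposite Limits

noncomputable section
namespace LC

variable {R : Type} [CommRing R]

/-- the functor being derived -/
abbrev YF (Y : ModuleCat.{0} R) : ModuleCat.{0} R ⥤ (ModuleCat.{0} R)ᵒᵖ :=
  ((linearYoneda R (ModuleCat.{0} R)).obj Y).rightOp

abbrev YK {X : ModuleCat.{0} R} (P : ProjectiveResolution X) (Y : ModuleCat.{0} R) :
    ChainComplex (ModuleCat.{0} R)ᵒᵖ ℕ :=
  ((YF Y).mapHomologicalComplex (ComplexShape.down ℕ)).obj P.complex

abbrev EX (n : ℕ) (X Y : ModuleCat.{0} R) : ModuleCat.{0} R :=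
  ((Ext R (ModuleCat.{0} R) n).obj (op X)).obj Y

def cvl {X : ModuleCat.{0} R} (P : ProjectiveResolution X) (n : ℕ) (Y : ModuleCat.{0} R) :
    ((YK P Y).opcycles n).unop ⟶ ModuleCat.of R (P.complex.X n ⟶ Y) :=
  ((YK P Y).pOpcycles n).unop

def isoE {X : ModuleCat.{0} R} (P : ProjectiveResolution X) (n : ℕ) (Y : ModuleCat.{0} R) :
    ((YF Y).leftDerived n).obj X ≅ (YK P Y).homology n :=
  P.isoLeftDerivedObj (YF Y) n

def ccl {X : ModuleCat.{0} R} (P : ProjectiveResolution X) (n : ℕ) (Y : ModuleCat.{0} R) :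
    ((YK P Y).opcycles n).unop ⟶ EX n X Y :=
  ((YK P Y).homologyι n).unop ≫ (isoE P n Y).hom.unop

def IsRep {X : ModuleCat.{0} R} (P : ProjectiveResolution X) (n : ℕ) {Y : ModuleCat.{0} R}
    (f : P.complex.X n ⟶ Y) (e : EX n X Y) : Prop :=
  ∃ z, cvl P n Y z = f ∧ ccl P n Y z = e

variable {X : ModuleCat.{0} R} (P : ProjectiveResolution X) (n : ℕ) {Y : ModuleCat.{0} R}

lemma cvl_inj : Function.Injective (cvl P n Y) := by
  have : Mono (cvl P n Y) := by exact unop_mono_of_epi _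
  exact (ModuleCat.mono_iff_injective _).1 this

lemma ccl_surj : Function.Surjective (ccl P n Y) := by
  have h1 : Epi ((YK P Y).homologyι n).unop := unop_epi_of_mono _
  have h2 : Epi (isoE P n Y).hom.unop := unop_epi_of_mono _
  have : Epi (ccl P n Y) := epi_comp' h1 h2
  exact (ModuleCat.epi_iff_surjective _).1 this

lemma rep_exists (e : EX n X Y) : ∃ f, IsRep P n f e := by
  obtain ⟨z, rfl⟩ := ccl_surj P n e
  exact ⟨_, z, rfl, rfl⟩

variable {P n}

lemma rep_unique {f : P.complex.X n ⟶ Y} {e e' : EX n X Y} (h : IsRep P n f e)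
    (h' : IsRep P n f e') : e = e' := by
  obtain ⟨z, hz, rfl⟩ := h
  obtain ⟨z', hz', rfl⟩ := h'
  rw [cvl_inj P n (hz.trans hz'.symm)]

lemma rep_add {f f' : P.complex.X n ⟶ Y} {e e' : EX n X Y} (h : IsRep P n f e)
    (h' : IsRep P n f' e') : IsRep P n (f + f') (e + e') := by
  obtain ⟨z, rfl, rfl⟩ := h
  obtain ⟨z', rfl, rfl⟩ := h'
  exact ⟨z + z', map_add _ _ _, map_add _ _ _⟩

lemma rep_smul {f : P.complex.X n ⟶ Y} {e : EX n X Y} (r : R) (h : IsRep P n f e) :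
    IsRep P n (r • f) (r • e) := by
  obtain ⟨z, rfl, rfl⟩ := h
  exact ⟨r • z, (cvl P n Y).hom.map_smul r z, (ccl P n Y).hom.map_smul r z⟩

lemma rep_zero : IsRep P n (0 : P.complex.X n ⟶ Y) (0 : EX n X Y) :=
  ⟨0, map_zero _, map_zero _⟩

lemma rep_cocycle {f : P.complex.X n ⟶ Y} {e : EX n X Y} (h : IsRep P n f e) :
    P.complex.d (n + 1) n ≫ f = 0 := by
  obtain ⟨z, rfl, rfl⟩ := h
  have := congrArg Quiver.Hom.unop ((YK P Y).d_pOpcycles (n+1) n)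
  have := congrArg (fun u => u.hom z) this
  exact this

lemma rep_of_cocycle {f : P.complex.X n ⟶ Y} (hf : P.complex.d (n + 1) n ≫ f = 0) :
    ∃ e : EX n X Y, IsRep P n f e := by
  let g : ModuleCat.of R R ⟶ ModuleCat.of R (P.complex.X n ⟶ Y) :=
    ModuleCat.ofHom (LinearMap.toSpanSingleton R _ f)
  let k : (YK P Y).X n ⟶ op (ModuleCat.of R R) := g.op
  have hk : (YK P Y).d (n+1) n ≫ k = 0 := by
    apply Quiver.Hom.unop_inj
    ext
    show P.complex.d (n + 1) n ≫ ((1:R) • f) = 0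
    rw [one_smul, hf]
  let l := (YK P Y).descOpcycles k (n+1) (by simp) hk
  have hl : (YK P Y).pOpcycles n ≫ l = k := (YK P Y).p_descOpcycles k (n+1) (by simp) hk
  refine ⟨_, l.unop (1:R), ?_, rfl⟩
  have := congrArg (fun u : (YK P Y).X n ⟶ op (ModuleCat.of R R) => u.unop.hom (1:R)) hl
  refine Eq.trans this ?_
  show (1:R) • f = f
  exact one_smul _ _

lemma rep_map {Y' : ModuleCat.{0} R} {f : P.complex.X n ⟶ Y} {e : EX n X Y} (h : IsRep P n f e)
    (u : Y ⟶ Y') : IsRep P n (f ≫ u) (((Ext R (ModuleCat.{0} R) n).obj (op X)).map u e) := by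
  obtain ⟨z, rfl, rfl⟩ := h
  let α : YF Y' ⟶ YF Y := NatTrans.rightOp ((linearYoneda R (ModuleCat.{0} R)).map u)
  let β : YK P Y' ⟶ YK P Y := (NatTrans.mapHomologicalComplex α (ComplexShape.down ℕ)).app P.complex
  refine ⟨(HomologicalComplex.opcyclesMap β n).unop z, ?_, ?_⟩
  · have := congrArg Quiver.Hom.unop (HomologicalComplex.p_opcyclesMap β n)
    exact congrArg (fun u => u.hom z) this
  · have h1 := P.leftDerived_app_eq α n
    have h0 : (NatTrans.leftDerived α n).app X = (isoE P n Y').hom ≫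
        HomologicalComplex.homologyMap β n ≫ (isoE P n Y).inv := h1
    have h2 : (NatTrans.leftDerived α n).app X ≫ (isoE P n Y).hom ≫
        (YK P Y).homologyι n = (isoE P n Y').hom ≫ (YK P Y').homologyι n ≫
          HomologicalComplex.opcyclesMap β n := by
      rw [h0]
      simp only [Category.assoc, Iso.inv_hom_id_assoc]
      rw [← HomologicalComplex.homologyι_naturality]
    have h3 := congrArg Quiver.Hom.unop h2
    exact (congrArg (fun u => u.hom z) h3).symm

lemma rep_comap {X' : ModuleCat.{0} R} {Q : ProjectiveResolution X'} (u : X' ⟶ X)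
    (φ : Q.complex ⟶ P.complex) (comm : φ.f 0 ≫ P.π.f 0 = Q.π.f 0 ≫ u)
    {f : P.complex.X n ⟶ Y} {e : EX n X Y} (h : IsRep P n f e) :
    IsRep Q n (φ.f n ≫ f) (((Ext R (ModuleCat.{0} R) n).map u.op).app Y e) := by
  obtain ⟨z, rfl, rfl⟩ := h
  let β : YK Q Y ⟶ YK P Y := ((YF Y).mapHomologicalComplex (ComplexShape.down ℕ)).map φ
  refine ⟨(HomologicalComplex.opcyclesMap β n).unop z, ?_, ?_⟩
  · have := congrArg Quiver.Hom.unop (HomologicalComplex.p_opcyclesMap β n)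
    exact congrArg (fun u => u.hom z) this
  · have h1 := ProjectiveResolution.isoLeftDerivedObj_hom_naturality u Q P φ comm (YF Y) n
    have h0 : ((YF Y).leftDerived n).map u ≫ (isoE P n Y).hom = (isoE Q n Y).hom ≫
        HomologicalComplex.homologyMap β n := h1
    have h2 : ((YF Y).leftDerived n).map u ≫ (isoE P n Y).hom ≫
        (YK P Y).homologyι n = (isoE Q n Y).hom ≫ (YK Q Y).homologyι n ≫
          HomologicalComplex.opcyclesMap β n := by
      rw [reassoc_of% h0, ← HomologicalComplex.homologyι_naturality]
    have h3 := congrArg Quiver.Hom.unop h2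
    exact (congrArg (fun u => u.hom z) h3).symm

lemma rep_zero_succ {f : P.complex.X (n+1) ⟶ Y} {e : EX (n+1) X Y} (h : IsRep P (n+1) f e) :
    e = 0 ↔ ∃ g : P.complex.X n ⟶ Y, f = P.complex.d (n+1) n ≫ g := by
  have hex : (ShortComplex.mk _ _ ((YK P Y).homologyι_comp_fromOpcycles (n+1) n)).Exact :=
    ShortComplex.exact_of_f_is_kernel _ ((YK P Y).homologyIsKernel (n+1) n (by simp))
  have hex2 := (ShortComplex.moduleCat_exact_iff _).1 hex.unop
  have hpd := congrArg Quiver.Hom.unop ((YK P Y).p_fromOpcycles (n+1) n)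
  obtain ⟨z, rfl, rfl⟩ := h
  have hinj : Function.Injective (isoE P (n+1) Y).hom.unop := by
    have : Mono (isoE P (n+1) Y).hom.unop := unop_mono_of_epi _
    exact (ModuleCat.mono_iff_injective _).1 this
  have h1 : ccl P (n+1) Y z = 0 ↔ ((YK P Y).homologyι (n+1)).unop z = 0 := by
    show (isoE P (n+1) Y).hom.unop (((YK P Y).homologyι (n+1)).unop z) = 0 ↔ _
    rw [map_eq_zero_iff _ hinj]
  rw [h1]
  constructor
  · intro hz
    obtain ⟨g, hg⟩ := hex2 z hz
    refine ⟨g, ?_⟩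
    rw [← hg]
    exact congrArg (fun u => u.hom g) hpd
  · rintro ⟨g, hg⟩
    have : z = ((YK P Y).fromOpcycles (n+1) n).unop g := by
      apply cvl_inj P (n+1)
      rw [hg]
      exact (congrArg (fun u => u.hom g) hpd).symm
    rw [this]
    have h5 := congrArg Quiver.Hom.unop ((YK P Y).homologyι_comp_fromOpcycles (n+1) n)
    exact congrArg (fun u => u.hom g) h5

lemma rep_zero_zero {f : P.complex.X 0 ⟶ Y} {e : EX 0 X Y} (h : IsRep P 0 f e) :
    e = 0 ↔ f = 0 := by
  obtain ⟨z, rfl, rfl⟩ := h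
  have h0 : Epi ((YK P Y).homologyι 0) := by
    have := ChainComplex.isIso_homologyι₀ (YK P Y)
    infer_instance
  have h1 : Mono ((YK P Y).homologyι 0).unop := unop_mono_of_epi _
  have h2 : Mono (isoE P 0 Y).hom.unop := unop_mono_of_epi _
  have : Mono (ccl P 0 Y) := mono_comp' h1 h2
  have h1 := (ModuleCat.mono_iff_injective _).1 this
  rw [map_eq_zero_iff _ h1, map_eq_zero_iff _ (cvl_inj P 0)]

end LC
end

end

section
open CategoryTheory Opposite Limits

noncomputable section
namespace LC

variable {R : Type} [CommRing R] (J : Ideal R)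

/-- quotient by power of J -/
abbrev QM (k : ℕ) : ModuleCat.{0} R := ModuleCat.of R (R ⧸ J ^ k)

def PR (k : ℕ) : ProjectiveResolution (QM J k) := projectiveResolution (QM J k)

abbrev CC (k i : ℕ) : ModuleCat.{0} R := (PR J k).complex.X i

def dd (k i : ℕ) : CC J k (i+1) →ₗ[R] CC J k i := ((PR J k).complex.d (i+1) i).hom

def eps (k : ℕ) : CC J k 0 →ₗ[R] (R ⧸ J ^ k) := ((PR J k).π.f 0 : CC J k 0 ⟶ QM J k).hom

def tr {k l : ℕ} (h : k ≤ l) : (R ⧸ J ^ l) →ₗ[R] (R ⧸ J ^ k) :=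
  Submodule.mapQ _ _ LinearMap.id (Ideal.pow_le_pow_right h)

def phc {k l : ℕ} (h : k ≤ l) : (PR J l).complex ⟶ (PR J k).complex :=
  ProjectiveResolution.lift (ModuleCat.ofHom (tr J h)) (PR J l) (PR J k)

def phi {k l : ℕ} (h : k ≤ l) (i : ℕ) : CC J l i →ₗ[R] CC J k i := ((phc J h).f i).hom

lemma phc_comm {k l : ℕ} (h : k ≤ l) :
    (phc J h).f 0 ≫ (PR J k).π.f 0 = (PR J l).π.f 0 ≫ ModuleCat.ofHom (tr J h) :=
  ProjectiveResolution.lift_commutes_zero _ _ _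

lemma eps_phi {k l : ℕ} (h : k ≤ l) (c : CC J l 0) : eps J k (phi J h 0 c) = tr J h (eps J l c) :=
  congrArg (fun u => u.hom c) (phc_comm J h)

lemma phi_dd {k l : ℕ} (h : k ≤ l) (i : ℕ) :
    phi J h i ∘ₗ dd J l i = dd J k i ∘ₗ phi J h (i+1) := by
  have := (phc J h).comm (i+1) i
  exact (congrArg ModuleCat.Hom.hom this).symm

lemma dd_dd (k i : ℕ) : dd J k i ∘ₗ dd J k (i+1) = 0 :=
  congrArg ModuleCat.Hom.hom ((PR J k).complex.d_comp_d (i+2) (i+1) i)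

lemma eps_dd (k : ℕ) : eps J k ∘ₗ dd J k 0 = 0 :=
  congrArg ModuleCat.Hom.hom ((PR J k).complex_d_comp_π_f_zero)

lemma eps_surj (k : ℕ) : Function.Surjective (eps J k) := by
  have : Epi ((PR J k).π.f 0) := inferInstance
  exact (ModuleCat.epi_iff_surjective _).1 this

lemma dd_exact (k i : ℕ) (c : CC J k (i+1)) (hc : dd J k i c = 0) : ∃ b, dd J k (i+1) b = c := by
  have h := (PR J k).exact_succ i
  exact (ShortComplex.moduleCat_exact_iff _).1 h c hc

lemma eps_exact (k : ℕ) (c : CC J k 0) (hc : eps J k c = 0) : ∃ b, dd J k 0 b = c := by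
  have h := (PR J k).exact₀
  exact (ShortComplex.moduleCat_exact_iff _).1 h c hc

instance proj_CC (k i : ℕ) : Module.Projective R (CC J k i) :=
  (IsProjective.iff_projective _).2 ((PR J k).projective i)

/-- local cohomology -/
abbrev HC (i : ℕ) (M : Type) [AddCommGroup M] [Module R M] : ModuleCat.{0} R :=
  (localCohomology J i).obj (ModuleCat.of R M)

def hmap (i : ℕ) {M N : Type} [AddCommGroup M] [Module R M] [AddCommGroup N] [Module R N]
    (f : M →ₗ[R] N) : HC J i M →ₗ[R] HC J i N :=
  ((localCohomology J i).map (ModuleCat.ofHom f)).hom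

abbrev DG (i : ℕ) := localCohomology.diagram (localCohomology.idealPowersDiagram J) i

lemma hasc (i : ℕ) : HasColimit (DG J i) := localCohomology.hasColimitDiagram _ i

def iot (i k : ℕ) (M : Type) [AddCommGroup M] [Module R M] :
    EX i (QM J k) (ModuleCat.of R M) →ₗ[R] HC J i M :=
  letI := hasc J i
  ((colimit.ι (DG J i) (op (op k))).app (ModuleCat.of R M)).hom

abbrev DGM (i : ℕ) (M : Type) [AddCommGroup M] [Module R M] : (ℕᵒᵖ)ᵒᵖ ⥤ ModuleCat.{0} R :=
  DG J i ⋙ (evaluation _ _).obj (ModuleCat.of R M)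

def isc (i : ℕ) (M : Type) [AddCommGroup M] [Module R M] :
    letI := hasc J i
    IsColimit (((evaluation _ _).obj (ModuleCat.of R M)).mapCocone (colimit.cocone (DG J i))) :=
  letI := hasc J i
  isColimitOfPreserves ((evaluation _ _).obj (ModuleCat.of R M)) (colimit.isColimit (DG J i))

variable {M : Type} [AddCommGroup M] [Module R M] {N : Type} [AddCommGroup N] [Module R N]

lemma iot_surj (i : ℕ) (ξ : HC J i M) : ∃ k e, iot J i k M e = ξ := by
  have := hasc J i
  obtain ⟨j, y, hy⟩ := Concrete.isColimit_exists_rep (DGM J i M) (isc J i M) ξ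
  exact ⟨j.unop.unop, y, hy⟩

def etr (i : ℕ) {k l : ℕ} (h : k ≤ l) (M : Type) [AddCommGroup M] [Module R M] :
    EX i (QM J k) (ModuleCat.of R M) →ₗ[R] EX i (QM J l) (ModuleCat.of R M) :=
  (((Ext R (ModuleCat.{0} R) i).map (ModuleCat.ofHom (tr J h)).op).app (ModuleCat.of R M)).hom

lemma iot_etr (i : ℕ) {k l : ℕ} (h : k ≤ l) (e : EX i (QM J k) (ModuleCat.of R M)) :
    iot J i l M (etr J i h M e) = iot J i k M e := by
  have := hasc J i
  have h1 := colimit.w (DG J i) (show (op (op k) : (ℕᵒᵖ)ᵒᵖ) ⟶ op (op l) from (homOfLE h).op.op)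
  have h2 := congrArg (fun u => (u.app (ModuleCat.of R M)).hom e) h1
  exact h2

lemma iot_eq_zero (i k : ℕ) (e : EX i (QM J k) (ModuleCat.of R M)) (he : iot J i k M e = 0) :
    ∃ l, ∃ h : k ≤ l, etr J i h M e = 0 := by
  have := hasc J i
  obtain ⟨j, f, g, hfg⟩ := Concrete.isColimit_exists_of_rep_eq (DGM J i M) (isc J i M)
    (i := op (op k)) (j := op (op k)) e 0 (by
      refine Eq.trans he ?_
      exact (map_zero (iot J i k M)).symm)
  refine ⟨j.unop.unop, leOfHom f.unop.unop, ?_⟩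
  refine Eq.trans hfg ?_
  exact map_zero _

lemma iot_map (i k : ℕ) (e : EX i (QM J k) (ModuleCat.of R M)) (f : M →ₗ[R] N) :
    hmap J i f (iot J i k M e) =
      iot J i k N (((Ext R (ModuleCat.{0} R) i).obj (op (QM J k))).map (ModuleCat.ofHom f) e) := by
  have := hasc J i
  have h1 := (colimit.ι (DG J i) (op (op k))).naturality (ModuleCat.ofHom f)
  exact (congrArg (fun u => u.hom e) h1).symm

/-- f is a cocycle representing ξ -/
def RH {i : ℕ} (k : ℕ) (f : CC J k i →ₗ[R] M) (ξ : HC J i M) : Prop :=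
  ∃ e, IsRep (PR J k) i (Y := ModuleCat.of R M) (ModuleCat.ofHom f) e ∧ iot J i k M e = ξ

def Cob {i : ℕ} (k : ℕ) (f : CC J k i →ₗ[R] M) : Prop :=
  match i, f with
  | 0, f => f = 0
  | (i+1), f => ∃ g : CC J k i →ₗ[R] M, f = g ∘ₗ dd J k i

variable {J}

lemma rh_exists {i : ℕ} (ξ : HC J i M) : ∃ k f, RH J k f ξ := by
  obtain ⟨k, e, rfl⟩ := iot_surj J i ξ
  obtain ⟨f, hf⟩ := rep_exists (PR J k) i e
  exact ⟨k, f.hom, e, hf, rfl⟩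

lemma rh_unique {i k : ℕ} {f : CC J k i →ₗ[R] M} {ξ ξ' : HC J i M} (h : RH J k f ξ)
    (h' : RH J k f ξ') : ξ = ξ' := by
  obtain ⟨e, h, rfl⟩ := h
  obtain ⟨e', h', rfl⟩ := h'
  rw [rep_unique h h']

lemma rh_cocycle {i k : ℕ} {f : CC J k i →ₗ[R] M} {ξ : HC J i M} (h : RH J k f ξ) :
    f ∘ₗ dd J k i = 0 := by
  obtain ⟨e, h, rfl⟩ := h
  exact congrArg ModuleCat.Hom.hom (rep_cocycle h)

lemma rh_of_cocycle {i k : ℕ} {f : CC J k i →ₗ[R] M} (h : f ∘ₗ dd J k i = 0) :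
    ∃ ξ, RH J k f ξ := by
  obtain ⟨e, he⟩ := rep_of_cocycle (P := PR J k) (n := i) (Y := ModuleCat.of R M)
    (f := ModuleCat.ofHom f) (ModuleCat.hom_ext h)
  exact ⟨_, e, he, rfl⟩

lemma rh_add {i k : ℕ} {f f' : CC J k i →ₗ[R] M} {ξ ξ' : HC J i M} (h : RH J k f ξ)
    (h' : RH J k f' ξ') : RH J k (f + f') (ξ + ξ') := by
  obtain ⟨e, h, rfl⟩ := h
  obtain ⟨e', h', rfl⟩ := h'
  exact ⟨e + e', rep_add h h', map_add _ _ _⟩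

lemma rh_smul {i k : ℕ} {f : CC J k i →ₗ[R] M} {ξ : HC J i M} (r : R) (h : RH J k f ξ) :
    RH J k (r • f) (r • ξ) := by
  obtain ⟨e, h, rfl⟩ := h
  exact ⟨r • e, rep_smul r h, map_smul _ _ _⟩

lemma rh_zero (i k : ℕ) : RH J k (0 : CC J k i →ₗ[R] M) 0 :=
  ⟨0, rep_zero, map_zero _⟩

lemma rh_sub {i k : ℕ} {f f' : CC J k i →ₗ[R] M} {ξ ξ' : HC J i M} (h : RH J k f ξ)
    (h' : RH J k f' ξ') : RH J k (f - f') (ξ - ξ') := by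
  have := rh_add h (rh_smul (-1 : R) h')
  simpa [sub_eq_add_neg] using this

lemma rh_phi {i k l : ℕ} (hkl : k ≤ l) {f : CC J k i →ₗ[R] M} {ξ : HC J i M} (h : RH J k f ξ) :
    RH J l (f ∘ₗ phi J hkl i) ξ := by
  obtain ⟨e, h, rfl⟩ := h
  exact ⟨etr J i hkl M e, rep_comap _ _ (phc_comm J hkl) h, iot_etr J i hkl e⟩

lemma rh_map {i k : ℕ} {f : CC J k i →ₗ[R] M} {ξ : HC J i M} (h : RH J k f ξ) (u : M →ₗ[R] N) :
    RH J k (u ∘ₗ f) (hmap J i u ξ) := by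
  obtain ⟨e, h, rfl⟩ := h
  exact ⟨_, rep_map h (ModuleCat.ofHom u), (iot_map J i k e u).symm⟩

lemma cob_iff {i k : ℕ} {f : CC J k i →ₗ[R] M} {e : EX i (QM J k) (ModuleCat.of R M)}
    (h : IsRep (PR J k) i (Y := ModuleCat.of R M) (ModuleCat.ofHom f) e) :
    e = 0 ↔ Cob J k f := by
  cases i with
  | zero =>
    rw [rep_zero_zero h]
    constructor
    · intro h; exact congrArg ModuleCat.Hom.hom h
    · intro h; exact ModuleCat.hom_ext h
  | succ i =>
    rw [rep_zero_succ h]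
    constructor
    · rintro ⟨g, hg⟩
      exact ⟨g.hom, congrArg ModuleCat.Hom.hom hg⟩
    · rintro ⟨g, hg⟩
      exact ⟨ModuleCat.ofHom g, ModuleCat.hom_ext hg⟩

lemma rh_cob {i k : ℕ} {f : CC J k i →ₗ[R] M} (h : Cob J k f) : RH J k f 0 := by
  have h0 : f ∘ₗ dd J k i = 0 := by
    cases i with
    | zero => rw [show f = 0 from h]; simp
    | succ i => obtain ⟨g, rfl⟩ := h; rw [LinearMap.comp_assoc, dd_dd]; simp
  obtain ⟨ξ, e, he, rfl⟩ := rh_of_cocycle h0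
  rw [(cob_iff he).2 h] at he
  exact ⟨0, he, map_zero _⟩

lemma rh_eq_zero {i k : ℕ} {f : CC J k i →ₗ[R] M} (h : RH J k f 0) :
    ∃ l, ∃ hkl : k ≤ l, Cob J l (f ∘ₗ phi J hkl i) := by
  obtain ⟨e, h, he⟩ := h
  obtain ⟨l, hkl, h0⟩ := iot_eq_zero J i k e he
  refine ⟨l, hkl, ?_⟩
  have h1 := rep_comap _ _ (phc_comm J hkl) h
  exact (cob_iff h1).1 h0

lemma rh_torsion {i k : ℕ} {f : CC J k i →ₗ[R] M} {ξ : HC J i M} (h : RH J k f ξ) {r : R}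
    (hr : r ∈ J ^ k) : r • ξ = 0 := by
  obtain ⟨e, h, rfl⟩ := h
  have h1 := rep_comap (Q := PR J k) (0 : QM J k ⟶ QM J k) 0 (by
    apply ModuleCat.hom_ext; apply LinearMap.ext; intro c
    exact map_zero (eps J k)) h
  have h2 := rep_comap (Q := PR J k) (0 : QM J k ⟶ QM J k) (r • 𝟙 _) (by
    apply ModuleCat.hom_ext; apply LinearMap.ext; intro c
    show eps J k (r • c) = 0
    rw [map_smul]
    obtain ⟨x, hx⟩ := Ideal.Quotient.mk_surjective (eps J k c)
    rw [← hx]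
    show Ideal.Quotient.mk _ (r * x) = 0
    rw [Ideal.Quotient.eq_zero_iff_mem]
    exact Ideal.mul_mem_right _ _ hr) h
  have h3 : ((Ext R (ModuleCat.{0} R) i).map (0 : QM J k ⟶ QM J k).op).app (ModuleCat.of R M) e = 0 := by
    refine rep_unique h1 ?_
    have : ((0 : (PR J k).complex ⟶ (PR J k).complex).f i ≫ (ModuleCat.ofHom f : CC J k i ⟶ ModuleCat.of R M)) = 0 := by simp
    rw [this]
    exact rep_zero
  rw [h3] at h2
  have h4 := rep_smul r h
  have h5 : ((r • 𝟙 (PR J k).complex : (PR J k).complex ⟶ (PR J k).complex).f i ≫ (ModuleCat.ofHom f : CC J k i ⟶ ModuleCat.of R M)) = r • (ModuleCat.ofHom f : CC J k i ⟶ ModuleCat.of R M) := by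
    simp
  rw [h5] at h2
  have := rep_unique h2 h4
  rw [← map_smul, ← this, map_zero]

end LC
end

end

section
open CategoryTheory Opposite Limits

noncomputable section
namespace LC

variable {R : Type} [CommRing R] {J : Ideal R}
variable {A : Type} [AddCommGroup A] [Module R A] {B : Type} [AddCommGroup B] [Module R B]
variable {C : Type} [AddCommGroup C] [Module R C]

lemma hmap_id (i : ℕ) (ξ : HC J i A) : hmap J i (LinearMap.id : A →ₗ[R] A) ξ = ξ := by
  have := (localCohomology J i).map_id (ModuleCat.of R A)
  exact congrArg (fun u => u.hom ξ) this

lemma hmap_comp (i : ℕ) (f : A →ₗ[R] B) (g : B →ₗ[R] C) (ξ : HC J i A) :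
    hmap J i (g ∘ₗ f) ξ = hmap J i g (hmap J i f ξ) := by
  have := (localCohomology J i).map_comp (ModuleCat.ofHom f) (ModuleCat.ofHom g)
  exact congrArg (fun u => u.hom ξ) this

lemma hmap_smul (i : ℕ) (r : R) (f : A →ₗ[R] B) (ξ : HC J i A) :
    hmap J i (r • f) ξ = r • hmap J i f ξ := by
  obtain ⟨k, c, hc⟩ := rh_exists ξ
  exact rh_unique (rh_map hc (r • f)) (rh_smul r (rh_map hc f))

lemma hmap_add (i : ℕ) (f g : A →ₗ[R] B) (ξ : HC J i A) :
    hmap J i (f + g) ξ = hmap J i f ξ + hmap J i g ξ := by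
  obtain ⟨k, c, hc⟩ := rh_exists ξ
  refine rh_unique (rh_map hc (f + g)) ?_
  rw [LinearMap.add_comp]
  exact rh_add (rh_map hc f) (rh_map hc g)

lemma hmap_zero (i : ℕ) (ξ : HC J i A) : hmap J i (0 : A →ₗ[R] B) ξ = 0 := by
  have := hmap_smul i (0:R) (0 : A →ₗ[R] B) ξ
  simpa using this

lemma hc_torsion {i : ℕ} (ξ : HC J i A) : ∃ k, ∀ r ∈ J ^ k, r • ξ = 0 := by
  obtain ⟨k, c, hc⟩ := rh_exists ξ
  exact ⟨k, fun r hr => rh_torsion hc hr⟩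

/-- factor a map landing in the range of an injective map -/
lemma factor_inj {P : Type} [AddCommGroup P] [Module R P] {f : A →ₗ[R] B}
    (hf : Function.Injective f) (b : P →ₗ[R] B) (hb : ∀ x, ∃ a, f a = b x) :
    ∃ a : P →ₗ[R] A, f ∘ₗ a = b := by
  have e := LinearEquiv.ofInjective f hf
  refine ⟨(LinearEquiv.ofInjective f hf).symm.toLinearMap ∘ₗ
    (LinearMap.codRestrict (LinearMap.range f) b (fun x => hb x)), ?_⟩
  ext x
  have := (LinearEquiv.ofInjective f hf).apply_symm_apply
    (LinearMap.codRestrict (LinearMap.range f) b (fun x => hb x) x)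
  exact congrArg Subtype.val this

section LES
variable {f : A →ₗ[R] B} {g : B →ₗ[R] C}

lemma les_mid (hf : Function.Injective f) (hg : Function.Surjective g)
    (hfg : Function.Exact f g) (i : ℕ) : Function.Exact (hmap J i f) (hmap J i g) := by
  intro ξ
  constructor
  · intro h
    obtain ⟨k, c, hc⟩ := rh_exists ξ
    have h1 := rh_map hc g
    rw [h] at h1
    obtain ⟨l, hkl, hcob⟩ := rh_eq_zero h1
    have key : ∃ b : CC J l i →ₗ[R] B, Cob J l b ∧ g ∘ₗ b = g ∘ₗ c ∘ₗ phi J hkl i := by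
      cases i with
      | zero => exact ⟨0, rfl, by rw [LinearMap.comp_zero]; exact hcob.symm⟩
      | succ i =>
        obtain ⟨u, hu⟩ := hcob
        obtain ⟨v, hv⟩ := Module.projective_lifting_property g u hg
        refine ⟨v ∘ₗ dd J l i, ⟨v, rfl⟩, ?_⟩
        rw [← LinearMap.comp_assoc, hv, ← hu, LinearMap.comp_assoc]
    obtain ⟨b, hb, hb2⟩ := key
    have h2 := rh_sub (rh_phi hkl hc) (rh_cob hb)
    rw [sub_zero] at h2
    obtain ⟨a, ha⟩ := factor_inj hf (c ∘ₗ phi J hkl i - b) (fun x => by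
      apply (hfg _).1
      have := congrArg (fun u => u x) hb2
      simp only [LinearMap.sub_apply, map_sub]
      exact sub_eq_zero.2 this.symm)
    have ha2 : a ∘ₗ dd J l i = 0 := by
      ext x
      apply hf
      have := rh_cocycle h2
      rw [← ha] at this
      simpa using congrArg (fun u => u x) this
    obtain ⟨α, hα⟩ := rh_of_cocycle ha2
    refine ⟨α, ?_⟩
    have h3 := rh_map hα f
    rw [ha] at h3
    exact rh_unique h3 h2
  · rintro ⟨α, rfl⟩
    rw [← hmap_comp]
    have : g ∘ₗ f = 0 := by ext x; exact hfg.apply_apply_eq_zero x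
    rw [this, hmap_zero]

/-- connecting relation -/
def CRel (f : A →ₗ[R] B) (g : B →ₗ[R] C) (i : ℕ) (γ : HC J i C) (α : HC J (i+1) A) : Prop :=
  ∃ k, ∃ b : CC J k i →ₗ[R] B, ∃ a : CC J k (i+1) →ₗ[R] A,
    f ∘ₗ a = b ∘ₗ dd J k i ∧ RH J k (g ∘ₗ b) γ ∧ RH J k a α

lemma crel_lift {i : ℕ} {k : ℕ} {b : CC J k i →ₗ[R] B} {a : CC J k (i+1) →ₗ[R] A}
    {γ : HC J i C} {α : HC J (i+1) A} (h1 : f ∘ₗ a = b ∘ₗ dd J k i) (h2 : RH J k (g ∘ₗ b) γ)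
    (h3 : RH J k a α) {l : ℕ} (hkl : k ≤ l) :
    f ∘ₗ (a ∘ₗ phi J hkl (i+1)) = (b ∘ₗ phi J hkl i) ∘ₗ dd J l i ∧
      RH J l (g ∘ₗ (b ∘ₗ phi J hkl i)) γ ∧ RH J l (a ∘ₗ phi J hkl (i+1)) α := by
  refine ⟨?_, ?_, rh_phi hkl h3⟩
  · rw [← LinearMap.comp_assoc, h1, LinearMap.comp_assoc, LinearMap.comp_assoc, phi_dd]
  · rw [← LinearMap.comp_assoc]; exact rh_phi hkl h2

lemma crel_add {i : ℕ} {γ γ' : HC J i C} {α α' : HC J (i+1) A} (h : CRel f g i γ α)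
    (h' : CRel f g i γ' α') : CRel f g i (γ + γ') (α + α') := by
  obtain ⟨k, b, a, h1, h2, h3⟩ := h
  obtain ⟨k', b', a', h1', h2', h3'⟩ := h'
  obtain ⟨h1, h2, h3⟩ := crel_lift h1 h2 h3 (le_max_left k k')
  obtain ⟨h1', h2', h3'⟩ := crel_lift h1' h2' h3' (le_max_right k k')
  refine ⟨max k k', b ∘ₗ phi J (le_max_left k k') i + b' ∘ₗ phi J (le_max_right k k') i,
    _, ?_, ?_, rh_add h3 h3'⟩
  · rw [LinearMap.comp_add, h1, h1', LinearMap.add_comp]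
  · rw [LinearMap.comp_add]; exact rh_add h2 h2'

lemma crel_smul {i : ℕ} {γ : HC J i C} {α : HC J (i+1) A} (r : R) (h : CRel f g i γ α) :
    CRel f g i (r • γ) (r • α) := by
  obtain ⟨k, b, a, h1, h2, h3⟩ := h
  refine ⟨k, r • b, r • a, ?_, ?_, rh_smul r h3⟩
  · rw [LinearMap.comp_smul, h1, LinearMap.smul_comp]
  · rw [LinearMap.comp_smul]; exact rh_smul r h2

lemma crel_total (hf : Function.Injective f) (hg : Function.Surjective g)
    (hfg : Function.Exact f g) {i : ℕ} (γ : HC J i C) : ∃ α, CRel (J := J) f g i γ α := by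
  obtain ⟨k, c, hc⟩ := rh_exists γ
  obtain ⟨b, rfl⟩ := Module.projective_lifting_property g c hg
  obtain ⟨a, ha⟩ := factor_inj hf (b ∘ₗ dd J k i) (fun x => by
    apply (hfg _).1
    have := rh_cocycle hc
    exact congrArg (fun u => u x) this)
  have ha2 : a ∘ₗ dd J k (i+1) = 0 := by
    ext x
    apply hf
    have : (f ∘ₗ a) ∘ₗ dd J k (i+1) = 0 := by
      rw [ha, LinearMap.comp_assoc, dd_dd, LinearMap.comp_zero]
    simpa using congrArg (fun u => u x) this
  obtain ⟨α, hα⟩ := rh_of_cocycle ha2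
  exact ⟨α, k, b, a, ha, hc, hα⟩

lemma crel_zero (hf : Function.Injective f) (hg : Function.Surjective g)
    (hfg : Function.Exact f g) {i : ℕ} {γ : HC J i C} (α : HC J (i+1) A)
    (h : CRel f g i γ α) : α = 0 ↔ ∃ β, hmap J i g β = γ := by
  obtain ⟨k, b, a, h1, h2, h3⟩ := h
  constructor
  · rintro rfl
    obtain ⟨l, hkl, u, hu⟩ := rh_eq_zero h3
    obtain ⟨h1, h2, h3⟩ := crel_lift h1 h2 h3 hkl
    have h4 : (b ∘ₗ phi J hkl i - f ∘ₗ u) ∘ₗ dd J l i = 0 := by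
      rw [LinearMap.sub_comp, ← h1, hu, LinearMap.comp_assoc, sub_self]
    obtain ⟨β, hβ⟩ := rh_of_cocycle h4
    refine ⟨β, ?_⟩
    have h5 := rh_map hβ g
    have : g ∘ₗ f = 0 := by ext x; exact hfg.apply_apply_eq_zero x
    rw [LinearMap.comp_sub, ← LinearMap.comp_assoc u f g, this, LinearMap.zero_comp, sub_zero] at h5
    exact rh_unique h5 h2
  · rintro ⟨β, rfl⟩
    obtain ⟨k', c, hc⟩ := rh_exists β
    obtain ⟨h1, h2, h3⟩ := crel_lift h1 h2 h3 (le_max_left k k')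
    have hc := rh_phi (le_max_right k k') hc
    have hc2 := rh_map hc g
    have h4 := rh_sub h2 hc2
    rw [sub_self, ← LinearMap.comp_sub] at h4
    obtain ⟨l, hkl, h5⟩ := rh_eq_zero h4
    obtain ⟨h1, h2, h3⟩ := crel_lift h1 h2 h3 hkl
    have hc3 := rh_phi hkl hc
    set b2 := (b ∘ₗ phi J (le_max_left k k') i) ∘ₗ phi J hkl i with hb2
    set c2 := (c ∘ₗ phi J (le_max_right k k') i) ∘ₗ phi J hkl i with hc2
    set a2 := (a ∘ₗ phi J (le_max_left k k') (i+1)) ∘ₗ phi J hkl (i+1)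
    have h6 : Cob J l (g ∘ₗ (b2 - c2)) := by
      rw [LinearMap.comp_assoc, LinearMap.sub_comp] at h5; exact h5
    have key : ∃ v : CC J l i →ₗ[R] B, Cob J l v ∧ g ∘ₗ v = g ∘ₗ (b2 - c2) := by
      clear_value b2 c2
      cases i with
      | zero => exact ⟨0, rfl, by rw [LinearMap.comp_zero]; exact h6.symm⟩
      | succ i =>
        obtain ⟨u, hu⟩ := h6
        obtain ⟨v, hv⟩ := Module.projective_lifting_property g u hg
        refine ⟨v ∘ₗ dd J l i, ⟨v, rfl⟩, ?_⟩
        rw [← LinearMap.comp_assoc, hv, ← hu]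
    obtain ⟨v, hv, hv2⟩ := key
    obtain ⟨w, hw⟩ := factor_inj hf (b2 - c2 - v) (fun x => by
      apply (hfg _).1
      have := congrArg (fun u => u x) hv2
      simp only [LinearMap.sub_apply, LinearMap.comp_apply, map_sub] at this ⊢
      rw [this, sub_self])
    have h7 : a2 = w ∘ₗ dd J l i := by
      ext x
      apply hf
      have e1 := rh_cocycle (rh_cob hv)
      have e2 := rh_cocycle hc3
      have : f ∘ₗ a2 = (f ∘ₗ w) ∘ₗ dd J l i := by
        rw [hw, h1, LinearMap.sub_comp, LinearMap.sub_comp, e1, e2, sub_zero, sub_zero]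
      exact congrArg (fun u => u x) this
    exact rh_unique h3 (rh_cob ⟨w, h7⟩)

lemma crel_exact (hgf : g ∘ₗ f = 0) {i : ℕ} (α : HC J (i+1) A) :
    hmap J (i+1) f α = 0 → ∃ γ, CRel (J := J) f g i γ α := by
  intro h
  obtain ⟨k, a, ha⟩ := rh_exists α
  have h1 := rh_map ha f
  rw [h] at h1
  obtain ⟨l, hkl, b, hb⟩ := rh_eq_zero h1
  have h2 : (g ∘ₗ b) ∘ₗ dd J l i = 0 := by
    rw [LinearMap.comp_assoc, ← hb, ← LinearMap.comp_assoc, ← LinearMap.comp_assoc, hgf]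
    simp
  obtain ⟨γ, hγ⟩ := rh_of_cocycle h2
  refine ⟨γ, l, b, a ∘ₗ phi J hkl (i+1), ?_, hγ, rh_phi hkl ha⟩
  rw [← hb, LinearMap.comp_assoc]

lemma crel_exact2 {i : ℕ} {γ : HC J i C} (α : HC J (i+1) A)
    (h : CRel f g i γ α) : hmap J (i+1) f α = 0 := by
  obtain ⟨k, b, a, h1, h2, h3⟩ := h
  have := rh_map h3 f
  rw [h1] at this
  exact rh_unique this (rh_cob ⟨b, rfl⟩)

/-- the connecting homomorphism -/
theorem les (hf : Function.Injective f) (hg : Function.Surjective g)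
    (hfg : Function.Exact f g) (i : ℕ) : ∃ δ : HC J i C →ₗ[R] HC J (i+1) A,
      Function.Exact (hmap J i g) δ ∧ Function.Exact δ (hmap J (i+1) f) := by
  have huniq : ∀ γ (α α' : HC J (i+1) A), CRel f g i γ α → CRel f g i γ α' → α = α' := by
    intro γ α α' h h'
    have := crel_add h (crel_smul (-1) h')
    have h2 := (crel_zero hf hg hfg _ this).2 ⟨0, by simp⟩
    rw [neg_one_smul, ← sub_eq_add_neg] at h2
    exact sub_eq_zero.1 h2
  choose d hd using fun γ => crel_total (J := J) hf hg hfg (i := i) γ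
  let δ : HC J i C →ₗ[R] HC J (i+1) A :=
    { toFun := d
      map_add' := fun x y => huniq _ _ _ (hd _) (crel_add (hd x) (hd y))
      map_smul' := fun r x => huniq _ _ _ (hd _) (crel_smul r (hd x)) }
  refine ⟨δ, ?_, ?_⟩
  · intro γ
    exact crel_zero hf hg hfg _ (hd γ)
  · intro α
    constructor
    · intro h
      obtain ⟨γ, hγ⟩ := crel_exact (g := g) hfg.linearMap_comp_eq_zero α h
      exact ⟨γ, huniq _ _ _ (hd γ) hγ⟩
    · rintro ⟨γ, rfl⟩
      exact crel_exact2 _ (hd γ)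

lemma hmap_zero_inj (hf : Function.Injective f) : Function.Injective (hmap J 0 f) := by
  rw [injective_iff_map_eq_zero]
  intro ξ h
  obtain ⟨k, a, ha⟩ := rh_exists ξ
  have h1 := rh_map ha f
  rw [h] at h1
  obtain ⟨l, hkl, hb⟩ := rh_eq_zero h1
  have : a ∘ₗ phi J hkl 0 = 0 := by
    ext x
    apply hf
    have := congrArg (fun u => u x) (show (f ∘ₗ a) ∘ₗ phi J hkl 0 = 0 from hb)
    simpa using this
  exact rh_unique (rh_phi hkl ha) (rh_cob (f := a ∘ₗ phi J hkl 0) this)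

end LES

lemma hc_injective [Module.Injective R A] (i : ℕ) (ξ : HC J (i+1) A) : ξ = 0 := by
  obtain ⟨k, a, ha⟩ := rh_exists ξ
  have h1 := rh_cocycle ha
  let q := LinearMap.ker (dd J k i)
  let a' : (CC J k (i+1) ⧸ q) →ₗ[R] A := q.liftQ a (by
    intro x hx
    obtain ⟨y, rfl⟩ := dd_exact J k i x hx
    exact congrArg (fun u => u y) h1)
  let d' : (CC J k (i+1) ⧸ q) →ₗ[R] CC J k i := q.liftQ (dd J k i) le_rfl
  have hd' : Function.Injective d' := by
    rw [← LinearMap.ker_eq_bot]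
    exact Submodule.ker_liftQ_eq_bot _ _ _ le_rfl
  obtain ⟨g, hg⟩ := Module.Injective.out d' hd' a'
  have : a = g ∘ₗ dd J k i := by
    ext x
    have := hg (q.mkQ x)
    exact this.symm
  exact rh_unique ha (rh_cob ⟨g, this⟩)

variable (J) in
/-- the torsion submodule -/
def Gam (M : Type) [AddCommGroup M] [Module R M] : Submodule R M where
  carrier := {x | ∃ k, ∀ r ∈ J ^ k, r • x = 0}
  add_mem' := by
    rintro x y ⟨k, hk⟩ ⟨l, hl⟩
    refine ⟨max k l, fun r hr => ?_⟩
    rw [smul_add, hk r (Ideal.pow_le_pow_right (le_max_left _ _) hr),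
      hl r (Ideal.pow_le_pow_right (le_max_right _ _) hr), add_zero]
  zero_mem' := ⟨0, by simp⟩
  smul_mem' := by
    rintro c x ⟨k, hk⟩
    refine ⟨k, fun r hr => ?_⟩
    rw [smul_comm, hk r hr, smul_zero]

lemma cy_exists {k : ℕ} {x : A} (hx : ∀ r ∈ J ^ k, r • x = 0) :
    ∃ c : CC J k 0 →ₗ[R] A, ∀ z r, eps J k z = Ideal.Quotient.mk _ r → c z = r • x := by
  let u : (R ⧸ J ^ k) →ₗ[R] A := Submodule.liftQ _ (LinearMap.toSpanSingleton R A x) (by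
    intro r hr
    simpa using hx r hr)
  refine ⟨u ∘ₗ eps J k, fun z r h => ?_⟩
  rw [LinearMap.comp_apply, h]
  rfl

/-- ξ in H^0 corresponds to x -/
def H0R (ξ : HC J 0 A) (x : A) : Prop :=
  ∃ k, ∃ c : CC J k 0 →ₗ[R] A, RH J k c ξ ∧ ∀ z r, eps J k z = Ideal.Quotient.mk _ r → c z = r • x

lemma h0r_exists {x : A} (hx : x ∈ Gam J A) : ∃ ξ, H0R (J := J) ξ x := by
  obtain ⟨k, hk⟩ := hx
  obtain ⟨c, hc⟩ := cy_exists hk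
  have : c ∘ₗ dd J k 0 = 0 := by
    ext y
    have h := hc (dd J k 0 y) 0 (by
      rw [map_zero]; exact congrArg (fun u => u y) (eps_dd J k))
    simpa using h
  obtain ⟨ξ, hξ⟩ := rh_of_cocycle this
  exact ⟨ξ, k, c, hξ, hc⟩

lemma h0r_exists2 (ξ : HC J 0 A) : ∃ x ∈ Gam J A, H0R (J := J) ξ x := by
  obtain ⟨k, c, hc⟩ := rh_exists ξ
  obtain ⟨e, he⟩ := eps_surj J k 1
  have key : ∀ z r, eps J k z = Ideal.Quotient.mk _ r → c z = r • c e := by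
    intro z r hz
    obtain ⟨y, hy⟩ := eps_exact J k (z - r • e) (by
      rw [map_sub, map_smul, he, hz, sub_eq_zero]
      show _ = Ideal.Quotient.mk _ (r * 1)
      rw [mul_one])
    have h := congrArg (fun u => u y) (rh_cocycle hc)
    simp only [LinearMap.comp_apply, hy, map_sub, map_smul, LinearMap.zero_apply] at h
    exact sub_eq_zero.1 h
  refine ⟨c e, ⟨k, fun r hr => ?_⟩, k, c, hc, key⟩
  rw [← key 0 r (by rw [map_zero]; exact (Ideal.Quotient.eq_zero_iff_mem.2 hr).symm), map_zero]

lemma h0r_lift {x : A} {k : ℕ} {c : CC J k 0 →ₗ[R] A}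
    (hc : ∀ z r, eps J k z = Ideal.Quotient.mk _ r → c z = r • x) {l : ℕ} (h : k ≤ l) :
    ∀ z r, eps J l z = Ideal.Quotient.mk _ r → (c ∘ₗ phi J h 0) z = r • x := by
  intro z r hz
  apply hc
  rw [eps_phi, hz]
  rfl

lemma h0r_add {ξ ξ' : HC J 0 A} {x x' : A} (h : H0R ξ x) (h' : H0R ξ' x') :
    H0R (ξ + ξ') (x + x') := by
  obtain ⟨k, c, h1, h2⟩ := h
  obtain ⟨k', c', h1', h2'⟩ := h'
  refine ⟨max k k', _, rh_add (rh_phi (le_max_left _ _) h1) (rh_phi (le_max_right _ _) h1'), ?_⟩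
  intro z r hz
  rw [LinearMap.add_apply, h0r_lift h2 _ z r hz, h0r_lift h2' _ z r hz, smul_add]

lemma h0r_smul {ξ : HC J 0 A} {x : A} (s : R) (h : H0R ξ x) : H0R (s • ξ) (s • x) := by
  obtain ⟨k, c, h1, h2⟩ := h
  refine ⟨k, _, rh_smul s h1, ?_⟩
  intro z r hz
  rw [LinearMap.smul_apply, h2 z r hz, smul_comm]

lemma h0r_map {ξ : HC J 0 A} {x : A} (g : A →ₗ[R] B) (h : H0R ξ x) : H0R (hmap J 0 g ξ) (g x) := by
  obtain ⟨k, c, h1, h2⟩ := h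
  refine ⟨k, _, rh_map h1 g, ?_⟩
  intro z r hz
  rw [LinearMap.comp_apply, h2 z r hz, map_smul]

lemma h0r_zero {ξ : HC J 0 A} {x : A} (h : H0R ξ x) : ξ = 0 ↔ x = 0 := by
  obtain ⟨k, c, h1, h2⟩ := h
  constructor
  · rintro rfl
    obtain ⟨l, hkl, h0⟩ := rh_eq_zero h1
    obtain ⟨e, he⟩ := eps_surj J l 1
    have h3 := h0r_lift h2 hkl e 1 (by rw [he]; rfl)
    rw [show c ∘ₗ phi J hkl 0 = 0 from h0] at h3
    simpa using h3.symm
  · rintro rfl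
    refine rh_unique h1 (rh_cob ?_)
    show c = 0
    ext z
    obtain ⟨r, hr⟩ := Ideal.Quotient.mk_surjective (eps J k z)
    simpa using h2 z r hr.symm

lemma h0r_unique {ξ ξ' : HC J 0 A} {x : A} (h : H0R ξ x) (h' : H0R ξ' x) : ξ = ξ' := by
  have := h0r_add h (h0r_smul (-1) h')
  rw [neg_one_smul, neg_one_smul, ← sub_eq_add_neg, ← sub_eq_add_neg, sub_self] at this
  exact sub_eq_zero.1 ((h0r_zero this).2 rfl)

variable (J) in
theorem h0_equiv (M : Type) [AddCommGroup M] [Module R M] : Nonempty (Gam J M ≃ₗ[R] HC J 0 M) := by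
  choose d hd using fun x : Gam J M => h0r_exists x.2
  let δ : Gam J M →ₗ[R] HC J 0 M :=
    { toFun := d
      map_add' := fun x y => h0r_unique (hd _) (h0r_add (hd x) (hd y))
      map_smul' := fun r x => h0r_unique (hd _) (h0r_smul r (hd x)) }
  refine ⟨LinearEquiv.ofBijective δ ⟨?_, ?_⟩⟩
  · rw [injective_iff_map_eq_zero]
    intro x hx
    exact Subtype.ext ((h0r_zero (hd x)).1 hx)
  · intro ξ
    obtain ⟨x, hx, h⟩ := h0r_exists2 ξ
    exact ⟨⟨x, hx⟩, h0r_unique (hd _) h⟩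

lemma h0_surj_of_torsion {g : A →ₗ[R] B} (hg : Function.Surjective g) (hA : Gam J A = ⊤) :
    Function.Surjective (hmap J 0 g) := by
  intro ξ
  obtain ⟨x, hx, h⟩ := h0r_exists2 ξ
  obtain ⟨y, rfl⟩ := hg x
  obtain ⟨η, hη⟩ := h0r_exists (J := J) (x := y) (by rw [hA]; trivial)
  exact ⟨η, h0r_unique (h0r_map g hη) h⟩

end LC
end

end

section
open CategoryTheory Opposite Limits

noncomputable section
namespace LC

variable {R : Type} [CommRing R] {J : Ideal R}
variable {A : Type} [AddCommGroup A] [Module R A] {B : Type} [AddCommGroup B] [Module R B]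
variable {C : Type} [AddCommGroup C] [Module R C]

lemma gam_torsion (M : Type) [AddCommGroup M] [Module R M] : Gam J (Gam J M) = ⊤ := by
  rw [eq_top_iff]
  rintro ⟨x, k, hk⟩ -
  exact ⟨k, fun r hr => Subtype.ext (hk r hr)⟩

lemma gam_injective [IsNoetherianRing R] (E : Type) [AddCommGroup E] [Module R E]
    [hE : Module.Injective R E] : Module.Injective R (Gam J E) := by
  apply Module.Baer.injective
  intro I f
  have hk : ∃ k, ∀ r ∈ J ^ k, ∀ x : I, r • f x = 0 := by
    obtain ⟨s, hs⟩ := (IsNoetherian.noetherian (⊤ : Submodule R I))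
    choose k hk using fun x : I => (f x).2
    refine ⟨s.sup k, fun r hr x => ?_⟩
    have hx : x ∈ Submodule.span R (s : Set I) := by rw [hs]; trivial
    induction hx using Submodule.span_induction with
    | mem x hx =>
      exact Subtype.ext (hk x r (Ideal.pow_le_pow_right (Finset.le_sup hx) hr))
    | zero => simp
    | add x y _ _ hx hy => rw [map_add, smul_add, hx, hy, add_zero]
    | smul a x _ hx => rw [map_smul, smul_comm, hx, smul_zero]
  obtain ⟨k, hk⟩ := hk
  obtain ⟨c, hc⟩ := Ideal.exists_pow_inf_eq_pow_smul J (M := R) I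
  have hl : ∀ x : I, (x : R) ∈ J ^ (k + c) → f x = 0 := by
    intro x hx
    have h1 : (x : R) ∈ J ^ k • (J ^ c • (⊤ : Submodule R R) ⊓ I) := by
      have := hc (k + c) (by omega)
      rw [Nat.add_sub_cancel] at this
      rw [← this]
      refine ⟨?_, x.2⟩
      simpa using hx
    have h2 : (x : R) ∈ J ^ k • I := (Submodule.smul_mono le_rfl inf_le_right : J ^ k • (J ^ c • (⊤ : Submodule R R) ⊓ I) ≤ J ^ k • I) h1
    have h3 : ∃ h : (x : R) ∈ I, f ⟨x, h⟩ = 0 := by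
      refine Submodule.smul_induction_on h2 (p := fun y => ∃ h : y ∈ I, f ⟨y, h⟩ = 0) ?_ ?_
      · intro r hr n hn
        refine ⟨I.smul_mem r hn, ?_⟩
        have : (⟨r • n, I.smul_mem r hn⟩ : I) = r • ⟨n, hn⟩ := rfl
        rw [this, map_smul]
        exact hk r hr _
      · rintro y z ⟨hy, hy2⟩ ⟨hz, hz2⟩
        refine ⟨I.add_mem hy hz, ?_⟩
        have : (⟨y + z, I.add_mem hy hz⟩ : I) = ⟨y, hy⟩ + ⟨z, hz⟩ := rfl
        rw [this, map_add, hy2, hz2, add_zero]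
    exact h3.2
  -- I / ker → R / J^l
  let q : Submodule R I := Submodule.comap I.subtype (J ^ (k + c))
  let f' : (I ⧸ q) →ₗ[R] E := q.liftQ ((Gam J E).subtype ∘ₗ f) (by
    intro x hx
    have := hl x hx
    simp [this])
  let j : (I ⧸ q) →ₗ[R] (R ⧸ J ^ (k + c)) := q.mapQ (J ^ (k + c)) I.subtype le_rfl
  have hj : Function.Injective j := by
    rw [← LinearMap.ker_eq_bot]
    apply Submodule.ker_liftQ_eq_bot
    intro x hx
    have : (Submodule.mkQ (J ^ (k+c))) (x : R) = 0 := hx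
    exact (Submodule.Quotient.mk_eq_zero (J ^ (k+c))).1 this
  obtain ⟨h, hh⟩ := hE.out j hj f'
  have hmem : ∀ y : R, h (Submodule.mkQ (J ^ (k+c)) y) ∈ Gam J E := by
    intro y
    refine ⟨k + c, fun r hr => ?_⟩
    rw [← map_smul, ← map_smul]
    have : Submodule.mkQ (J ^ (k+c)) (r • y) = 0 := by
      rw [Submodule.mkQ_apply, Submodule.Quotient.mk_eq_zero]
      exact Ideal.mul_mem_right _ _ hr
    rw [this, map_zero]
  refine ⟨LinearMap.codRestrict _ (h ∘ₗ Submodule.mkQ (J ^ (k+c))) hmem, ?_⟩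
  intro x hx
  apply Subtype.ext
  exact hh (q.mkQ ⟨x, hx⟩)

variable (J) in
/-- vanishing -/
def ZZ (i : ℕ) (M : Type) [AddCommGroup M] [Module R M] : Prop := ∀ ξ : HC J i M, ξ = 0

lemma exists_embed (M : Type) [AddCommGroup M] [Module R M] :
    ∃ (E : ModuleCat.{0} R) (f : M →ₗ[R] E), Module.Injective R E ∧ Function.Injective f := by
  have h : Mono (Injective.ι (ModuleCat.of R M)) := inferInstance
  refine ⟨Injective.under (ModuleCat.of R M), (Injective.ι (ModuleCat.of R M)).hom, ?_, ?_⟩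
  · have h2 : Injective (Injective.under (ModuleCat.of R M)) := inferInstance
    exact @Module.injective_module_of_injective_object R _ _ _ _ h2
  · exact (ModuleCat.mono_iff_injective _).1 h

section
variable {f : A →ₗ[R] B} {g : B →ₗ[R] C} (hf : Function.Injective f) (hg : Function.Surjective g)
    (hfg : Function.Exact f g)
include hf hg hfg

lemma z_mid {i : ℕ} (h1 : ZZ J i A) (h2 : ZZ J i C) : ZZ J i B := by
  intro ξ
  obtain ⟨a, rfl⟩ := (les_mid hf hg hfg i ξ).1 (h2 _)
  rw [h1 a, map_zero]

lemma z_left {i : ℕ} (h1 : ZZ J i C) (h2 : ZZ J (i+1) B) : ZZ J (i+1) A := by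
  intro ξ
  obtain ⟨δ, h3, h4⟩ := les (J := J) hf hg hfg i
  obtain ⟨a, rfl⟩ := (h4 ξ).1 (h2 _)
  rw [h1 a, map_zero]

lemma z_right {i : ℕ} (h1 : ZZ J i B) (h2 : ZZ J (i+1) A) : ZZ J i C := by
  intro ξ
  obtain ⟨δ, h3, h4⟩ := les (J := J) hf hg hfg i
  obtain ⟨a, rfl⟩ := (h3 ξ).1 (h2 _)
  rw [h1 a, map_zero]

lemma z_delta {i : ℕ} (h1 : ZZ J i B) :
    ∃ δ : HC J i C →ₗ[R] HC J (i+1) A, Function.Injective δ := by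
  obtain ⟨δ, h3, h4⟩ := les (J := J) hf hg hfg i
  refine ⟨δ, ?_⟩
  rw [injective_iff_map_eq_zero]
  intro x hx
  obtain ⟨a, rfl⟩ := (h3 x).1 hx
  rw [h1 a, map_zero]

end

lemma z_zero_inj {f : A →ₗ[R] B} (hf : Function.Injective f) (h : ZZ J 0 B) : ZZ J 0 A := by
  intro ξ
  apply hmap_zero_inj hf
  rw [h (hmap J 0 f ξ), map_zero]

theorem torsion_vanish [IsNoetherianRing R] (i : ℕ) (M : Type) [AddCommGroup M] [Module R M]
    (hM : Gam J M = ⊤) : ZZ J (i+1) M := by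
  induction i generalizing M with
  | zero =>
    obtain ⟨E, f, hE, hf⟩ := exists_embed (R := R) M
    let f' : M →ₗ[R] Gam J E := LinearMap.codRestrict _ f (by
      intro x
      have hx : x ∈ Gam J M := by rw [hM]; trivial
      obtain ⟨k, hk⟩ := hx
      exact ⟨k, fun r hr => by rw [← map_smul, hk r hr, map_zero]⟩)
    have hf' : Function.Injective f' := fun x y h => hf (congrArg Subtype.val h)
    have := gam_injective (J := J) E
    have hex : Function.Exact f' (LinearMap.range f').mkQ := LinearMap.exact_map_mkQ_range f'
    intro ξ
    obtain ⟨δ, h3, h4⟩ := les (J := J) hf' (Submodule.mkQ_surjective _) hex 0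
    obtain ⟨a, rfl⟩ := (h4 ξ).1 (hc_injective 0 _)
    obtain ⟨b, rfl⟩ := h0_surj_of_torsion (Submodule.mkQ_surjective (LinearMap.range f')) (gam_torsion (J := J) E) a
    exact h3.apply_apply_eq_zero b
  | succ i ih =>
    obtain ⟨E, f, hE, hf⟩ := exists_embed (R := R) M
    let f' : M →ₗ[R] Gam J E := LinearMap.codRestrict _ f (by
      intro x
      have hx : x ∈ Gam J M := by rw [hM]; trivial
      obtain ⟨k, hk⟩ := hx
      exact ⟨k, fun r hr => by rw [← map_smul, hk r hr, map_zero]⟩)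
    have hf' : Function.Injective f' := fun x y h => hf (congrArg Subtype.val h)
    have := gam_injective (J := J) E
    have hex : Function.Exact f' (LinearMap.range f').mkQ := LinearMap.exact_map_mkQ_range f'
    refine z_left hf' (Submodule.mkQ_surjective _) hex (ih _ ?_) (fun ξ => hc_injective _ ξ)
    rw [eq_top_iff]
    rintro x -
    obtain ⟨⟨y, k, hk⟩, rfl⟩ := Submodule.mkQ_surjective _ x
    refine ⟨k, fun r hr => ?_⟩
    rw [← map_smul]
    have : r • (⟨y, k, hk⟩ : Gam J E) = 0 := Subtype.ext (hk r hr)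
    rw [this, map_zero]

variable (J) in
def FL (M : Type) [AddCommGroup M] [Module R M] : Prop :=
  Module.Finite R M ∧ ∃ N, ∀ r ∈ J ^ N, ∀ x : M, r • x = 0

lemma fl_of_zero (h : ∀ x : A, x = 0) : FL J A := by
  have : Subsingleton A := ⟨fun x y => by rw [h x, h y]⟩
  exact ⟨inferInstance, 0, fun r _ x => h _⟩

lemma fl_mid [IsNoetherianRing R] {f : A →ₗ[R] B} {g : B →ₗ[R] C} (hfg : Function.Exact f g)
    (hA : FL J A) (hC : FL J C) : FL J B := by
  obtain ⟨hA1, N1, hA2⟩ := hA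
  obtain ⟨hC1, N2, hC2⟩ := hC
  constructor
  · have h1 : (LinearMap.ker g).FG := by
      rw [hfg.linearMap_ker_eq]
      exact (LinearMap.range_eq_map f) ▸ hA1.1.map f
    have h2 : (LinearMap.range g).FG := IsNoetherian.noetherian _
    refine ⟨Submodule.fg_of_fg_map_of_fg_inf_ker g ?_ ?_⟩
    · rwa [← LinearMap.range_eq_map]
    · rwa [top_inf_eq]
  · refine ⟨N1 + N2, fun r hr x => ?_⟩
    rw [pow_add] at hr
    refine Submodule.mul_induction_on hr ?_ ?_
    · intro a ha b hb
      have : g (b • x) = 0 := by rw [map_smul, hC2 b hb]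
      obtain ⟨y, hy⟩ := (hfg _).1 this
      rw [mul_smul, ← hy, ← map_smul, hA2 a ha, map_zero]
    · intro a b ha hb
      rw [add_smul, ha, hb, add_zero]

lemma kill_mid {f : A →ₗ[R] B} {g : B →ₗ[R] C} (hfg : Function.Exact f g) {r s : R}
    (hA : ∀ x : A, r • x = 0) (hC : ∀ x : C, s • x = 0) (x : B) : (r * s) • x = 0 := by
  have : g (s • x) = 0 := by rw [map_smul, hC]
  obtain ⟨y, hy⟩ := (hfg _).1 this
  rw [mul_smul, ← hy, ← map_smul, hA, map_zero]

lemma hc_kill {i : ℕ} {r : R} (h : ∀ x : A, r • x = 0) (ξ : HC J i A) : r • ξ = 0 := by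
  have h1 := hmap_smul (J := J) i r (LinearMap.id : A →ₗ[R] A) ξ
  rw [hmap_id] at h1
  rw [← h1]
  have : r • (LinearMap.id : A →ₗ[R] A) = 0 := by ext x; exact h x
  rw [this, hmap_zero]

lemma fl_gam [IsNoetherianRing R] [Module.Finite R A] : FL J (Gam J A) := by
  refine ⟨Module.Finite.iff_fg.2 (IsNoetherian.noetherian (Gam J A)), ?_⟩
  obtain ⟨s, hs⟩ := IsNoetherian.noetherian (⊤ : Submodule R (Gam J A))
  choose k hk using fun x : Gam J A => x.2
  refine ⟨s.sup k, fun r hr x => ?_⟩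
  have hx : x ∈ Submodule.span R (s : Set (Gam J A)) := by rw [hs]; trivial
  induction hx using Submodule.span_induction with
  | mem x hx => exact Subtype.ext (hk x r (Ideal.pow_le_pow_right (Finset.le_sup hx) hr))
  | zero => simp
  | add x y _ _ hx hy => rw [smul_add, hx, hy, add_zero]
  | smul a x _ hx => rw [smul_comm, hx, smul_zero]

lemma fl_h0 [IsNoetherianRing R] [Module.Finite R A] : FL J (HC J 0 A) := by
  obtain ⟨e⟩ := h0_equiv J A
  obtain ⟨h1, N, h2⟩ := fl_gam (J := J) (A := A)
  refine ⟨Module.Finite.equiv e, N, fun r hr x => ?_⟩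
  obtain ⟨y, rfl⟩ := e.surjective x
  rw [← map_smul, h2 r hr, map_zero]

lemma fl_torsion [IsNoetherianRing R] [Module.Finite R A] (h : Gam J A = ⊤) (i : ℕ) :
    FL J (HC J i A) := by
  cases i with
  | zero => exact fl_h0
  | succ i => exact fl_of_zero (torsion_vanish i A h)

lemma ker_exact (g : B →ₗ[R] C) : Function.Exact (LinearMap.ker g).subtype g :=
  LinearMap.exact_subtype_ker_map g

/-- kill through a surjection with killed kernel -/
lemma kill_surj {g : B →ₗ[R] C} (hg : Function.Surjective g) {r s : R}
    (hr : ∀ x, g x = 0 → r • x = 0) {i : ℕ} (hs : ∀ ξ : HC J i B, s • ξ = 0) (ξ : HC J i C) :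
    (s * r) • ξ = 0 := by
  obtain ⟨δ, h3, h4⟩ := les (J := J) (Submodule.subtype_injective (LinearMap.ker g)) hg (ker_exact g) i
  exact kill_mid h3 hs (hc_kill (fun x => Subtype.ext (hr x x.2))) ξ

lemma fl_surj [IsNoetherianRing R] [Module.Finite R B] {g : B →ₗ[R] C}
    (hg : Function.Surjective g) (hr : ∀ x, g x = 0 → x ∈ Gam J B) {i : ℕ}
    (hC : FL J (HC J i C)) : FL J (HC J i B) := by
  have : Module.Finite R (LinearMap.ker g) := Module.Finite.iff_fg.2 (IsNoetherian.noetherian _)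
  refine fl_mid (les_mid (Submodule.subtype_injective (LinearMap.ker g)) hg (ker_exact g) i)
    (fl_torsion ?_ i) hC
  rw [eq_top_iff]
  rintro ⟨x, hx⟩ -
  obtain ⟨k, hk⟩ := hr x hx
  exact ⟨k, fun r hr => Subtype.ext (hk r hr)⟩

lemma z_reg_zero {x : R} (hx : x ∈ J) (h : ∀ a : A, x • a = 0 → a = 0) : ZZ J 0 A := by
  intro ξ
  obtain ⟨e⟩ := h0_equiv J A
  obtain ⟨⟨y, k, hk⟩, rfl⟩ := e.surjective ξ
  have hy : y = 0 := by
    have h1 := hk (x ^ k) (Ideal.pow_mem_pow hx k)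
    clear hk
    induction k with
    | zero => simpa using h1
    | succ k ih =>
      apply ih
      apply h
      rw [← mul_smul, ← pow_succ', h1]
  subst hy
  exact map_zero e

/-- multiplication by x injective with zero lower cohomology of the cokernel -/
lemma z_reg_succ {x : R} (hx : x ∈ J) (h : ∀ a : A, x • a = 0 → a = 0) {g : A →ₗ[R] B}
    (hg : Function.Surjective g) (hker : ∀ a, g a = 0 ↔ ∃ b, x • b = a) {i : ℕ}
    (hz : ZZ J i B) : ZZ J (i+1) A := by
  let f : A →ₗ[R] A := x • LinearMap.id
  have hf : Function.Injective f := (injective_iff_map_eq_zero f).2 h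
  have hfg : Function.Exact f g := fun a => hker a
  obtain ⟨δ, h3, h4⟩ := les (J := J) hf hg hfg i
  have key : ∀ ξ : HC J (i+1) A, x • ξ = 0 → ξ = 0 := by
    intro ξ hξ
    have : hmap J (i+1) f ξ = 0 := by
      rw [hmap_smul, hmap_id, hξ]
    obtain ⟨η, rfl⟩ := (h4 ξ).1 this
    rw [hz η, map_zero]
  intro ξ
  obtain ⟨k, hk⟩ := hc_torsion ξ
  have h1 := hk (x ^ k) (Ideal.pow_mem_pow hx k)
  clear hk
  induction k with
  | zero => simpa using h1
  | succ k ih =>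
    apply ih
    apply key
    rw [← mul_smul, ← pow_succ', h1]

lemma z_equiv (e : A ≃ₗ[R] B) {i : ℕ} (h : ZZ J i A) : ZZ J i B := by
  intro ξ
  have : hmap J i e.toLinearMap (hmap J i e.symm.toLinearMap ξ) = ξ := by
    rw [← hmap_comp]
    simp [hmap_id]
  rw [← this, h (hmap J i e.symm.toLinearMap ξ), map_zero]

end LC
end

end

section
open CategoryTheory Opposite Limits

noncomputable section
namespace LC

variable {R : Type} [CommRing R] {J : Ideal R}

lemma mk_smul' (A : Ideal R) (x f : R) : x • (Submodule.Quotient.mk f : R ⧸ A) = Submodule.Quotient.mk (x * f) := rfl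

lemma factor_ker {A B : Ideal R} (h : A ≤ B) (f : R) :
    (Submodule.factor h : R ⧸ A →ₗ[R] R ⧸ B) (Submodule.Quotient.mk f) = 0 ↔ f ∈ B := by
  show (Submodule.Quotient.mk f : R ⧸ B) = 0 ↔ _
  exact Submodule.Quotient.mk_eq_zero _

lemma quot_ker_iff (A : Ideal R) (x : R) (a : R ⧸ A) :
    (Submodule.factor (le_sup_left : A ≤ A ⊔ Ideal.span {x}) : R ⧸ A →ₗ[R] _) a = 0 ↔
      ∃ b, x • b = a := by
  obtain ⟨f, rfl⟩ := Submodule.Quotient.mk_surjective _ a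
  rw [factor_ker]
  constructor
  · intro h
    obtain ⟨y, hy, z, hz, rfl⟩ := Submodule.mem_sup.1 h
    obtain ⟨c, rfl⟩ := Ideal.mem_span_singleton.1 hz
    refine ⟨Submodule.Quotient.mk c, ?_⟩
    rw [mk_smul', Submodule.Quotient.mk_add, (Submodule.Quotient.mk_eq_zero A).2 hy, zero_add]
  · rintro ⟨b, hb⟩
    obtain ⟨c, rfl⟩ := Submodule.Quotient.mk_surjective _ b
    rw [mk_smul', eq_comm, Submodule.Quotient.eq] at hb
    have : f = (f - x * c) + x * c := by ring
    rw [this]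
    exact Submodule.add_mem_sup hb (Ideal.mul_mem_right _ _ (Ideal.mem_span_singleton_self x))

lemma reg_quot {A : Ideal R} {x : R} (h : ∀ f, x * f ∈ A → f ∈ A) (a : R ⧸ A) (ha : x • a = 0) :
    a = 0 := by
  obtain ⟨f, rfl⟩ := Submodule.Quotient.mk_surjective _ a
  rw [mk_smul', Submodule.Quotient.mk_eq_zero] at ha
  exact (Submodule.Quotient.mk_eq_zero _).2 (h f ha)

lemma zq_zero {A : Ideal R} {x : R} (hx : x ∈ J) (h : ∀ f, x * f ∈ A → f ∈ A) : ZZ J 0 (R ⧸ A) :=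
  z_reg_zero hx (reg_quot h)

lemma zq_succ {A : Ideal R} {x : R} (hx : x ∈ J) (h : ∀ f, x * f ∈ A → f ∈ A) {i : ℕ}
    (hz : ZZ J i (R ⧸ (A ⊔ Ideal.span {x}))) : ZZ J (i+1) (R ⧸ A) :=
  z_reg_succ hx (reg_quot h) (Submodule.factor_surjective le_sup_left) (quot_ker_iff A x) hz

lemma zq_exact {A : Ideal R} {x : R} (h : ∀ f, x * f ∈ A → f ∈ A) :
    Function.Injective (x • LinearMap.id : R ⧸ A →ₗ[R] R ⧸ A) ∧
    Function.Exact (x • LinearMap.id : R ⧸ A →ₗ[R] R ⧸ A)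
      (Submodule.factor (le_sup_left : A ≤ A ⊔ Ideal.span {x})) :=
  ⟨(injective_iff_map_eq_zero _).2 (reg_quot h), fun a => quot_ker_iff A x a⟩

lemma zq_delta {A : Ideal R} {x : R} (h : ∀ f, x * f ∈ A → f ∈ A) {i : ℕ}
    (hz : ZZ J i (R ⧸ A)) :
    ∃ δ : HC J i (R ⧸ (A ⊔ Ideal.span {x})) →ₗ[R] HC J (i+1) (R ⧸ A), Function.Injective δ :=
  z_delta (zq_exact h).1 (Submodule.factor_surjective le_sup_left) (zq_exact h).2 hz

lemma zq_right {A : Ideal R} {x : R} (h : ∀ f, x * f ∈ A → f ∈ A) {i : ℕ}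
    (hz : ZZ J i (R ⧸ A)) (hz' : ZZ J (i+1) (R ⧸ A)) : ZZ J i (R ⧸ (A ⊔ Ideal.span {x})) :=
  z_right (zq_exact h).1 (Submodule.factor_surjective le_sup_left) (zq_exact h).2 hz hz'

/-- colon sequence -/
lemma zq_colon {A D : Ideal R} {x : R} (h : ∀ f, x * f ∈ A ↔ f ∈ D) {i : ℕ}
    (hz : ZZ J i (R ⧸ D)) (hz' : ZZ J i (R ⧸ (A ⊔ Ideal.span {x}))) : ZZ J i (R ⧸ A) := by
  let f : R ⧸ D →ₗ[R] R ⧸ A := Submodule.mapQ D A (x • LinearMap.id) (fun y hy => by rw [Submodule.mem_comap]; exact (h y).2 hy)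
  have hf : Function.Injective f := by
    rw [injective_iff_map_eq_zero]
    intro a ha
    obtain ⟨y, rfl⟩ := Submodule.Quotient.mk_surjective _ a
    have : (Submodule.Quotient.mk (x * y) : R ⧸ A) = 0 := ha
    rw [Submodule.Quotient.mk_eq_zero] at this
    exact (Submodule.Quotient.mk_eq_zero _).2 ((h y).1 this)
  have hfg : Function.Exact f (Submodule.factor (le_sup_left : A ≤ A ⊔ Ideal.span {x})) := by
    intro a
    rw [quot_ker_iff]
    constructor
    · rintro ⟨b, rfl⟩
      obtain ⟨y, rfl⟩ := Submodule.Quotient.mk_surjective _ b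
      exact ⟨Submodule.Quotient.mk y, rfl⟩
    · rintro ⟨b, rfl⟩
      obtain ⟨y, rfl⟩ := Submodule.Quotient.mk_surjective _ b
      exact ⟨Submodule.Quotient.mk y, rfl⟩
  exact z_mid hf (Submodule.factor_surjective le_sup_left) hfg hz hz'

lemma pow_sup_span (Q : Ideal R) (x : R) (m : ℕ) :
    (Q ⊔ Ideal.span {x}) ^ (m+1) = Q ^ (m+1) ⊔ Ideal.span {x} * (Q ⊔ Ideal.span {x}) ^ m := by
  induction m with
  | zero => simp
  | succ m ih =>
    apply le_antisymm
    · rw [pow_succ _ (m+1), mul_comm, Ideal.sup_mul]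
      apply sup_le
      · conv_lhs => rw [ih]
        rw [Ideal.mul_sup]
        apply sup_le
        · exact le_sup_of_le_left (by rw [← pow_succ'])
        · apply le_sup_of_le_right
          rw [mul_left_comm]
          apply Ideal.mul_mono le_rfl
          rw [pow_succ']
          exact Ideal.mul_mono le_sup_left le_rfl
      · exact le_sup_right
    · apply sup_le
      · exact Ideal.pow_right_mono le_sup_left _
      · rw [pow_succ' _ (m+1)]
        exact Ideal.mul_mono le_sup_right le_rfl

lemma z_top (i : ℕ) : ZZ J i (R ⧸ (⊤ : Ideal R)) := by
  intro ξ
  have := hmap_id (J := J) i ξ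
  rw [← this]
  have h : (LinearMap.id : (R ⧸ (⊤ : Ideal R)) →ₗ[R] _) = 0 := by
    ext; exact Subsingleton.elim _ _
  rw [h, hmap_zero]

theorem ci_pow {Q : Ideal R} {x : R} (hreg : ∀ m f, x * f ∈ Q ^ m → f ∈ Q ^ m) {N : ℕ}
    (hN : ∀ m i, i < N + 1 → ZZ J i (R ⧸ Q ^ m)) (m i : ℕ) (hi : i < N) :
    ZZ J i (R ⧸ (Q ⊔ Ideal.span {x}) ^ m) := by
  induction m with
  | zero => rw [pow_zero, Ideal.one_eq_top]; exact z_top i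
  | succ m ih =>
    have h1 : (Q ⊔ Ideal.span {x}) ^ (m+1) ⊔ Ideal.span {x} = Q ^ (m+1) ⊔ Ideal.span {x} := by
      rw [pow_sup_span, sup_assoc]
      congr 1
      exact sup_eq_right.2 Ideal.mul_le_left
    refine zq_colon (x := x) (D := (Q ⊔ Ideal.span {x}) ^ m) ?_ ih ?_
    · intro f
      constructor
      · intro hf
        rw [pow_sup_span] at hf
        obtain ⟨q, hq, h, hh, e⟩ := Submodule.mem_sup.1 hf
        obtain ⟨z, hz, rfl⟩ := Ideal.mem_span_singleton_mul.1 hh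
        have h2 : x * (f - z) ∈ Q ^ (m+1) := by rw [mul_sub, ← e, add_sub_cancel_right]; exact hq
        have h3 := hreg _ _ h2
        have h4 : f - z ∈ (Q ⊔ Ideal.span {x}) ^ m :=
          Ideal.pow_right_mono le_sup_left _ (Ideal.pow_le_pow_right (Nat.le_succ m) h3)
        have := Ideal.add_mem _ h4 hz
        rwa [sub_add_cancel] at this
      · intro hf
        rw [pow_succ']
        exact Ideal.mul_mem_mul (Ideal.mem_sup_right (Ideal.mem_span_singleton_self x)) hf
    · rw [h1]
      exact zq_right (hreg _) (hN _ _ (by omega)) (hN _ _ (by omega))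

section MV
variable (A B : Ideal R)

def mvf : R ⧸ (A ⊓ B) →ₗ[R] (R ⧸ A) × (R ⧸ B) :=
  (Submodule.factor inf_le_left).prod (Submodule.factor inf_le_right)

def mvg : (R ⧸ A) × (R ⧸ B) →ₗ[R] R ⧸ (A ⊔ B) :=
  (Submodule.factor (le_sup_left : A ≤ A ⊔ B)) ∘ₗ LinearMap.fst R _ _ -
    (Submodule.factor (le_sup_right : B ≤ A ⊔ B)) ∘ₗ LinearMap.snd R _ _

lemma mvf_inj : Function.Injective (mvf A B) := by
  rw [injective_iff_map_eq_zero]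
  intro a ha
  obtain ⟨y, rfl⟩ := Submodule.Quotient.mk_surjective _ a
  have h1 := (factor_ker (inf_le_left : A ⊓ B ≤ A) y).1 (congrArg Prod.fst ha)
  have h2 := (factor_ker (inf_le_right : A ⊓ B ≤ B) y).1 (congrArg Prod.snd ha)
  exact (Submodule.Quotient.mk_eq_zero _).2 ⟨h1, h2⟩

lemma mvg_surj : Function.Surjective (mvg A B) := by
  intro a
  obtain ⟨y, rfl⟩ := Submodule.Quotient.mk_surjective _ a
  refine ⟨(Submodule.Quotient.mk y, 0), ?_⟩
  simp only [mvg, LinearMap.sub_apply, LinearMap.comp_apply, LinearMap.fst_apply,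
    LinearMap.snd_apply, map_zero, sub_zero]
  rfl

lemma mv_exact : Function.Exact (mvf A B) (mvg A B) := by
  rintro ⟨a, b⟩
  obtain ⟨y, rfl⟩ := Submodule.Quotient.mk_surjective _ a
  obtain ⟨z, rfl⟩ := Submodule.Quotient.mk_surjective _ b
  have : mvg A B (Submodule.Quotient.mk y, Submodule.Quotient.mk z) =
    Submodule.Quotient.mk (y - z) := rfl
  rw [this, Submodule.Quotient.mk_eq_zero]
  constructor
  · intro h
    obtain ⟨p, hp, q, hq, e⟩ := Submodule.mem_sup.1 h
    refine ⟨Submodule.Quotient.mk (y - p), ?_⟩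
    apply Prod.ext
    · show (Submodule.Quotient.mk (y - p) : R ⧸ A) = Submodule.Quotient.mk y
      rw [Submodule.Quotient.eq]
      simpa using hp
    · show (Submodule.Quotient.mk (y - p) : R ⧸ B) = Submodule.Quotient.mk z
      rw [Submodule.Quotient.eq]
      have : y - p - z = q := by linear_combination -e
      rwa [this]
  · rintro ⟨c, hc⟩
    obtain ⟨w, rfl⟩ := Submodule.Quotient.mk_surjective _ c
    have h1 : (Submodule.Quotient.mk w : R ⧸ A) = Submodule.Quotient.mk y := congrArg Prod.fst hc
    have h2 : (Submodule.Quotient.mk w : R ⧸ B) = Submodule.Quotient.mk z := congrArg Prod.snd hc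
    rw [Submodule.Quotient.eq] at h1 h2
    have : y - z = -(w - y) + (w - z) := by ring
    rw [this]
    exact Submodule.add_mem_sup (neg_mem h1) h2

end MV

section prod
variable {A : Type} [AddCommGroup A] [Module R A] {B : Type} [AddCommGroup B] [Module R B]

lemma z_prod {i : ℕ} (h1 : ZZ J i A) (h2 : ZZ J i B) : ZZ J i (A × B) :=
  z_mid (f := LinearMap.inl R A B) (g := LinearMap.snd R A B) LinearMap.inl_injective
    LinearMap.snd_surjective Function.Exact.inl_snd h1 h2

lemma fl_prod [IsNoetherianRing R] {i : ℕ} (h1 : FL J (HC J i A)) (h2 : FL J (HC J i B)) :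
    FL J (HC J i (A × B)) :=
  fl_mid (les_mid (f := LinearMap.inl R A B) (g := LinearMap.snd R A B) LinearMap.inl_injective
    LinearMap.snd_surjective Function.Exact.inl_snd i) h1 h2
end prod

/-- finite length for intersections -/
lemma mv_fl [IsNoetherianRing R] {A B : Ideal R} {i : ℕ} (hA : FL J (HC J i (R ⧸ A)))
    (hB : FL J (HC J i (R ⧸ B))) (hAB : Gam J (R ⧸ (A ⊔ B)) = ⊤) :
    FL J (HC J i (R ⧸ (A ⊓ B))) := by
  cases i with
  | zero => exact fl_h0
  | succ i =>
    obtain ⟨δ, h3, h4⟩ := les (J := J) (mvf_inj A B) (mvg_surj A B) (mv_exact A B) i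
    exact fl_mid h4 (fl_torsion hAB i) (fl_prod hA hB)

lemma mv_delta {A B : Ideal R} {i : ℕ} (hA : ZZ J i (R ⧸ A)) (hB : ZZ J i (R ⧸ B)) :
    ∃ δ : HC J i (R ⧸ (A ⊔ B)) →ₗ[R] HC J (i+1) (R ⧸ (A ⊓ B)), Function.Injective δ :=
  z_delta (mvf_inj A B) (mvg_surj A B) (mv_exact A B) (z_prod hA hB)

end LC
end

end

section
open CategoryTheory Opposite Limits

noncomputable section
namespace LC
open MvPolynomial

variable {K : Type} [Field K] {n : ℕ}

/-- monomial membership -/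
def E (A : Ideal (MvPolynomial (Fin n) K)) (α : Fin n →₀ ℕ) : Prop := monomial α (1:K) ∈ A

def IsMon (A : Ideal (MvPolynomial (Fin n) K)) : Prop := ∀ f ∈ A, ∀ α ∈ f.support, E A α

lemma mon_mul (α β : Fin n →₀ ℕ) :
    (monomial (α + β) (1:K) : MvPolynomial (Fin n) K) = monomial α 1 * monomial β 1 := by
  rw [monomial_mul, one_mul]

lemma E_add_left {A : Ideal (MvPolynomial (Fin n) K)} {α : Fin n →₀ ℕ} (β) (h : E A α) : E A (β + α) := by
  unfold E; rw [mon_mul]; exact Ideal.mul_mem_left _ _ h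

lemma E_mono {A : Ideal (MvPolynomial (Fin n) K)} {α β : Fin n →₀ ℕ} (h : E A α) (hle : α ≤ β) : E A β := by
  obtain ⟨γ, rfl⟩ := exists_add_of_le hle
  rw [add_comm]; exact E_add_left γ h

lemma mem_of_E {A : Ideal (MvPolynomial (Fin n) K)} {f : MvPolynomial (Fin n) K}
    (h : ∀ α ∈ f.support, E A α) : f ∈ A := by
  rw [f.as_sum]
  refine Ideal.sum_mem _ fun α hα => ?_
  have : monomial α (coeff α f) = C (coeff α f) * monomial α (1:K) := by
    rw [C_mul_monomial, mul_one]
  rw [this]; exact Ideal.mul_mem_left _ _ (h α hα)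

lemma E_span (s : Set (Fin n →₀ ℕ)) (α : Fin n →₀ ℕ) :
    E (Ideal.span ((fun b => monomial b (1:K)) '' s)) α ↔ ∃ b ∈ s, b ≤ α := by
  unfold E
  rw [mem_ideal_span_monomial_image]
  constructor
  · intro h; exact h α (by simp [support_monomial])
  · intro h β hβ
    classical
    rw [support_monomial, if_neg one_ne_zero, Finset.mem_singleton] at hβ
    subst hβ; exact h

lemma isMon_span (s : Set (Fin n →₀ ℕ)) :
    IsMon (Ideal.span ((fun b => monomial b (1:K)) '' s)) := by
  intro f hf α hα
  rw [E_span]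
  exact mem_ideal_span_monomial_image.1 hf α hα

lemma IsMon.eq_span {A : Ideal (MvPolynomial (Fin n) K)} (h : IsMon A) :
    A = Ideal.span ((fun b => monomial b (1:K)) '' {α | E A α}) := by
  apply le_antisymm
  · intro f hf
    apply mem_of_E
    intro α hα
    rw [E_span]
    exact ⟨α, h f hf α hα, le_rfl⟩
  · rw [Ideal.span_le]
    rintro _ ⟨α, hα, rfl⟩
    exact hα

lemma IsMon.le_iff {A B : Ideal (MvPolynomial (Fin n) K)} (h : IsMon A) :
    A ≤ B ↔ ∀ α, E A α → E B α := by
  constructor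
  · intro hle α hα; exact hle hα
  · intro hh f hf; exact mem_of_E fun α hα => hh α (h f hf α hα)

lemma IsMon.ext {A B : Ideal (MvPolynomial (Fin n) K)} (hA : IsMon A) (hB : IsMon B)
    (h : ∀ α, E A α ↔ E B α) : A = B :=
  le_antisymm (hA.le_iff.2 fun α => (h α).1) (hB.le_iff.2 fun α => (h α).2)

lemma IsMon.inf {A B : Ideal (MvPolynomial (Fin n) K)} (hA : IsMon A) (hB : IsMon B) : IsMon (A ⊓ B) :=
  fun f hf α hα => ⟨hA f hf.1 α hα, hB f hf.2 α hα⟩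

lemma E_inf {A B : Ideal (MvPolynomial (Fin n) K)} (α) : E (A ⊓ B) α ↔ E A α ∧ E B α := Iff.rfl

lemma IsMon.iInf {ι : Sort*} {A : ι → Ideal (MvPolynomial (Fin n) K)} (hA : ∀ i, IsMon (A i)) : IsMon (⨅ i, A i) := by
  intro f hf α hα
  unfold E
  rw [Submodule.mem_iInf] at hf ⊢
  exact fun i => hA i f (hf i) α hα

lemma E_iInf {ι : Sort*} {A : ι → Ideal (MvPolynomial (Fin n) K)} (α) : E (⨅ i, A i) α ↔ ∀ i, E (A i) α :=
  Submodule.mem_iInf _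

lemma sup_eq_span {A B : Ideal (MvPolynomial (Fin n) K)} (hA : IsMon A) (hB : IsMon B) :
    A ⊔ B = Ideal.span ((fun b => monomial b (1:K)) '' ({α | E A α} ∪ {α | E B α})) := by
  rw [Set.image_union, Ideal.span_union, ← hA.eq_span, ← hB.eq_span]

lemma IsMon.sup {A B : Ideal (MvPolynomial (Fin n) K)} (hA : IsMon A) (hB : IsMon B) : IsMon (A ⊔ B) := by
  rw [sup_eq_span hA hB]; exact isMon_span _

lemma E_sup {A B : Ideal (MvPolynomial (Fin n) K)} (hA : IsMon A) (hB : IsMon B) (α) :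
    E (A ⊔ B) α ↔ E A α ∨ E B α := by
  constructor
  · rw [sup_eq_span hA hB, E_span]
    rintro ⟨b, hb | hb, hle⟩
    · exact Or.inl (E_mono hb hle)
    · exact Or.inr (E_mono hb hle)
  · rintro (h | h)
    · exact (le_sup_left : A ≤ A ⊔ B) h
    · exact (le_sup_right : B ≤ A ⊔ B) h

lemma mul_eq_span {A B : Ideal (MvPolynomial (Fin n) K)} (hA : IsMon A) (hB : IsMon B) :
    A * B = Ideal.span ((fun b => monomial b (1:K)) '' {γ | ∃ α β, E A α ∧ E B β ∧ γ = α + β}) := by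
  conv_lhs => rw [hA.eq_span, hB.eq_span]
  rw [Ideal.span_mul_span']
  congr 1
  ext f
  simp only [Set.mem_mul, Set.mem_image, Set.mem_setOf_eq]
  constructor
  · rintro ⟨_, ⟨α, hα, rfl⟩, _, ⟨β, hβ, rfl⟩, rfl⟩
    exact ⟨α + β, ⟨α, β, hα, hβ, rfl⟩, mon_mul α β⟩
  · rintro ⟨_, ⟨α, β, hα, hβ, rfl⟩, rfl⟩
    exact ⟨_, ⟨α, hα, rfl⟩, _, ⟨β, hβ, rfl⟩, (mon_mul α β).symm⟩

lemma IsMon.mul {A B : Ideal (MvPolynomial (Fin n) K)} (hA : IsMon A) (hB : IsMon B) : IsMon (A * B) := by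
  rw [mul_eq_span hA hB]; exact isMon_span _

lemma E_mul {A B : Ideal (MvPolynomial (Fin n) K)} (hA : IsMon A) (hB : IsMon B) (α) :
    E (A * B) α ↔ ∃ β γ, E A β ∧ E B γ ∧ α = β + γ := by
  constructor
  · rw [mul_eq_span hA hB, E_span]
    rintro ⟨_, ⟨β, γ, hβ, hγ, rfl⟩, hle⟩
    obtain ⟨δ, rfl⟩ := exists_add_of_le hle
    refine ⟨δ + β, γ, E_add_left δ hβ, hγ, by abel⟩
  · rintro ⟨β, γ, hβ, hγ, rfl⟩
    unfold E; rw [mon_mul]; exact Ideal.mul_mem_mul hβ hγ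

lemma isMon_top : IsMon (⊤ : Ideal (MvPolynomial (Fin n) K)) := fun _ _ _ _ => Submodule.mem_top

lemma isMon_bot : IsMon (⊥ : Ideal (MvPolynomial (Fin n) K)) := by
  intro f hf α hα
  rw [Submodule.mem_bot] at hf
  subst hf; simp at hα

lemma E_bot (α) : ¬ E (⊥ : Ideal (MvPolynomial (Fin n) K)) α := by
  unfold E
  rw [Submodule.mem_bot, monomial_eq_zero]; exact one_ne_zero

lemma E_top (α) : E (⊤ : Ideal (MvPolynomial (Fin n) K)) α := Submodule.mem_top

lemma IsMon.pow {A : Ideal (MvPolynomial (Fin n) K)} (hA : IsMon A) (m : ℕ) : IsMon (A ^ m) := by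
  induction m with
  | zero => rw [pow_zero, Ideal.one_eq_top]; exact isMon_top
  | succ m ih => rw [pow_succ]; exact ih.mul hA

lemma E_pow_zero (A : Ideal (MvPolynomial (Fin n) K)) (α) : E (A ^ 0) α := by
  rw [pow_zero, Ideal.one_eq_top]; exact E_top α

lemma E_pow_succ {A : Ideal (MvPolynomial (Fin n) K)} (hA : IsMon A) (m : ℕ) (α) :
    E (A ^ (m+1)) α ↔ ∃ β γ, E (A ^ m) β ∧ E A γ ∧ α = β + γ := by
  rw [pow_succ, E_mul (hA.pow m) hA]

lemma isMon_singleton (γ : Fin n →₀ ℕ) :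
    IsMon (Ideal.span {(monomial γ (1:K) : MvPolynomial (Fin n) K)}) := by
  have := isMon_span (K := K) {γ}
  rwa [Set.image_singleton] at this

lemma E_singleton (γ α : Fin n →₀ ℕ) :
    E (Ideal.span {(monomial γ (1:K) : MvPolynomial (Fin n) K)}) α ↔ γ ≤ α := by
  have := E_span (K := K) {γ} α
  rw [Set.image_singleton] at this
  simpa using this

/-- regularity of a monomial -/
lemma mon_reg {A : Ideal (MvPolynomial (Fin n) K)} (hA : IsMon A) {γ : Fin n →₀ ℕ}
    (h : ∀ α, E A (γ + α) → E A α) (f : MvPolynomial (Fin n) K) (hf : monomial γ (1:K) * f ∈ A) : f ∈ A := by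
  apply mem_of_E
  intro α hα
  apply h
  apply hA _ hf
  rw [mem_support_iff, coeff_monomial_mul, one_mul]
  exact mem_support_iff.1 hα

/-! free variables -/

def Free (A : Ideal (MvPolynomial (Fin n) K)) (F : Finset (Fin n)) : Prop :=
  ∀ i ∈ F, ∀ α, E A (Finsupp.single i 1 + α) → E A α

lemma Free.single {A : Ideal (MvPolynomial (Fin n) K)} {F} (h : Free A F) {i} (hi : i ∈ F) (k : ℕ) (α)
    (ha : E A (Finsupp.single i k + α)) : E A α := by
  induction k with
  | zero => simpa using ha
  | succ k ih =>
    apply ih; apply h i hi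
    rwa [← add_assoc, ← Finsupp.single_add, add_comm 1 k]

lemma Free.mono {A : Ideal (MvPolynomial (Fin n) K)} {F G} (h : Free A F) (hle : G ⊆ F) : Free A G :=
  fun i hi => h i (hle hi)

lemma Free.inf {A B : Ideal (MvPolynomial (Fin n) K)} {F} (hA : Free A F) (hB : Free B F) : Free (A ⊓ B) F :=
  fun i hi α h => ⟨hA i hi α h.1, hB i hi α h.2⟩

lemma Free.iInf {ι : Sort*} {A : ι → Ideal (MvPolynomial (Fin n) K)} {F} (hA : ∀ i, Free (A i) F) : Free (⨅ i, A i) F := by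
  intro j hj α h
  rw [E_iInf] at h ⊢
  exact fun i => hA i j hj α (h i)

lemma Free.sup {A B : Ideal (MvPolynomial (Fin n) K)} {F} (mA : IsMon A) (mB : IsMon B)
    (hA : Free A F) (hB : Free B F) : Free (A ⊔ B) F := by
  intro i hi α h
  rw [E_sup mA mB] at h ⊢
  exact h.imp (hA i hi α) (hB i hi α)

lemma split_single {i : Fin n} {α β γ : Fin n →₀ ℕ} (h : Finsupp.single i 1 + α = β + γ) :
    (∃ β', β = Finsupp.single i 1 + β' ∧ α = β' + γ) ∨ (∃ γ', γ = Finsupp.single i 1 + γ' ∧ α = β + γ') := by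
  have hi := DFunLike.congr_fun h i
  simp only [Finsupp.add_apply, Finsupp.single_eq_same] at hi
  by_cases hb : 1 ≤ β i
  · left
    obtain ⟨β', rfl⟩ := exists_add_of_le (Finsupp.single_le_iff.2 hb : Finsupp.single i 1 ≤ β)
    exact ⟨β', rfl, by rw [add_assoc] at h; exact add_left_cancel h⟩
  · right
    obtain ⟨γ', rfl⟩ := exists_add_of_le (Finsupp.single_le_iff.2 (by omega) : Finsupp.single i 1 ≤ γ)
    exact ⟨γ', rfl, by rw [add_left_comm] at h; exact add_left_cancel h⟩

lemma Free.mul {A B : Ideal (MvPolynomial (Fin n) K)} {F} (mA : IsMon A) (mB : IsMon B)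
    (hA : Free A F) (hB : Free B F) : Free (A * B) F := by
  intro i hi α h
  rw [E_mul mA mB] at h ⊢
  obtain ⟨β, γ, hβ, hγ, he⟩ := h
  obtain ⟨β', rfl, rfl⟩ | ⟨γ', rfl, rfl⟩ := split_single he
  · exact ⟨β', γ, hA i hi _ hβ, hγ, rfl⟩
  · exact ⟨β, γ', hβ, hB i hi _ hγ, rfl⟩

lemma Free.pow {A : Ideal (MvPolynomial (Fin n) K)} {F} (mA : IsMon A) (hA : Free A F) (m : ℕ) : Free (A ^ m) F := by
  induction m with
  | zero => intro _ _ _ _; exact E_pow_zero _ _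
  | succ m ih => rw [pow_succ]; exact Free.mul (mA.pow m) mA ih hA

/-- free for a monomial -/
lemma Free.monomial {A : Ideal (MvPolynomial (Fin n) K)} {F} (hA : Free A F) (γ : Fin n →₀ ℕ)
    (hγ : γ.support ⊆ F) (α) (h : E A (γ + α)) : E A α := by
  induction γ using Finsupp.induction with
  | zero => simpa using h
  | single_add i b f hi hb ih =>
    have hs : (Finsupp.single i b + f).support = insert i f.support := by
      rw [Finsupp.support_add_eq, Finsupp.support_single_ne_zero _ hb]; rfl
      rw [Finsupp.support_single_ne_zero _ hb]; simpa using hi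
    rw [hs] at hγ
    apply ih (fun x hx => hγ (Finset.mem_insert_of_mem hx))
    rw [add_assoc] at h
    exact hA.single (hγ (Finset.mem_insert_self _ _)) b _ h

/-- adding pure powers -/
def AE (A : Ideal (MvPolynomial (Fin n) K)) (k : ℕ) (s : Finset (Fin n)) : Ideal (MvPolynomial (Fin n) K) :=
  A ⊔ Ideal.span ((fun b => monomial b (1:K)) '' ((fun i => Finsupp.single i k) '' (s : Set (Fin n))))

lemma AE_empty (A : Ideal (MvPolynomial (Fin n) K)) (k) : AE A k ∅ = A := by simp [AE]

lemma AE_insert (A : Ideal (MvPolynomial (Fin n) K)) (k) (s : Finset (Fin n)) (i : Fin n) :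
    AE A k (insert i s) = AE A k s ⊔ Ideal.span {(monomial (Finsupp.single i k) (1:K) : MvPolynomial (Fin n) K)} := by
  unfold AE
  rw [Finset.coe_insert, Set.image_insert_eq, Set.image_insert_eq, Ideal.span_insert, sup_assoc,
    sup_comm (Ideal.span {_})]

lemma AE_mon {A : Ideal (MvPolynomial (Fin n) K)} (hA : IsMon A) (k s) : IsMon (AE A k s) :=
  hA.sup (isMon_span _)

lemma E_AE {A : Ideal (MvPolynomial (Fin n) K)} (hA : IsMon A) (k s) (α) :
    E (AE A k s) α ↔ E A α ∨ ∃ i ∈ s, k ≤ α i := by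
  unfold AE
  rw [E_sup hA (isMon_span _), E_span]
  simp

lemma AE_free {A : Ideal (MvPolynomial (Fin n) K)} (hA : IsMon A) {F : Finset (Fin n)} (h : Free A F) (k s) :
    Free (AE A k s) (F \ s) := by
  intro i hi α ha
  rw [Finset.mem_sdiff] at hi
  rw [E_AE hA] at ha ⊢
  refine ha.imp (h i hi.1 α) ?_
  rintro ⟨j, hj, hk⟩
  refine ⟨j, hj, ?_⟩
  have : i ≠ j := fun e => hi.2 (e ▸ hj)
  simpa [Finsupp.single_apply, this] using hk

lemma AE_reg {A : Ideal (MvPolynomial (Fin n) K)} (hA : IsMon A) {F : Finset (Fin n)} (h : Free A F) (k s)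
    {i} (hi : i ∈ F) (his : i ∉ s) (f : MvPolynomial (Fin n) K)
    (hf : monomial (Finsupp.single i k) (1:K) * f ∈ AE A k s) : f ∈ AE A k s :=
  mon_reg (AE_mon hA k s)
    (fun α => (AE_free hA h k s).single (Finset.mem_sdiff.2 ⟨hi, his⟩) k α) f hf

lemma X_mem_max (i : Fin n) : (X i : MvPolynomial (Fin n) K) ∈ maxIdeal K n := Ideal.subset_span ⟨i, rfl⟩

lemma single_mem_max (i : Fin n) {k : ℕ} (hk : 1 ≤ k) :
    (monomial (Finsupp.single i k) (1:K) : MvPolynomial (Fin n) K) ∈ maxIdeal K n := by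
  rw [← X_pow_eq_monomial]
  exact Ideal.pow_mem_of_mem _ (X_mem_max i) k hk

/-- M1 -/
lemma M1 {A : Ideal (MvPolynomial (Fin n) K)} (hA : IsMon A) {F : Finset (Fin n)} (h : Free A F) {k : ℕ} (hk : 1 ≤ k) :
    ∀ (c : ℕ) (s : Finset (Fin n)), s ⊆ F → (F \ s).card = c → ∀ j < c,
      ZZ (maxIdeal K n) j (MvPolynomial (Fin n) K ⧸ AE A k s) := by
  intro c
  induction c with
  | zero => intro s _ _ j hj; omega
  | succ c ih =>
    intro s hs hc j hj
    have hne : (F \ s).Nonempty := by rw [← Finset.card_pos]; omega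
    obtain ⟨i, hi⟩ := hne
    have hi' := Finset.mem_sdiff.1 hi
    cases j with
    | zero => exact zq_zero (single_mem_max i hk) (AE_reg hA h k s hi'.1 hi'.2)
    | succ j =>
      refine zq_succ (single_mem_max i hk) (AE_reg hA h k s hi'.1 hi'.2) ?_
      rw [← AE_insert]
      apply ih (insert i s)
      · exact Finset.insert_subset hi'.1 hs
      · rw [Finset.sdiff_insert, Finset.card_erase_of_mem hi, hc]; rfl
      · omega

lemma M1' {A : Ideal (MvPolynomial (Fin n) K)} (hA : IsMon A) {F : Finset (Fin n)} (h : Free A F) {j} (hj : j < F.card) :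
    ZZ (maxIdeal K n) j (MvPolynomial (Fin n) K ⧸ A) := by
  have := M1 hA h le_rfl F.card ∅ (Finset.empty_subset _) (by simp) j hj
  rwa [AE_empty] at this

/-- torsion criterion -/
lemma gam_of_vars {M : Type} [AddCommGroup M] [Module (MvPolynomial (Fin n) K) M] (x : M)
    (h : ∀ i, ∃ k, (X i : MvPolynomial (Fin n) K) ^ k • x = 0) : x ∈ Gam (maxIdeal K n) M := by
  have : maxIdeal K n ≤ Ideal.radical (LinearMap.ker (LinearMap.toSpanSingleton (MvPolynomial (Fin n) K) M x)) := by
    unfold maxIdeal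
    rw [Ideal.span_le]
    rintro _ ⟨i, rfl⟩
    obtain ⟨k, hk⟩ := h i
    exact ⟨k, hk⟩
  obtain ⟨k, hk⟩ := Ideal.exists_pow_le_of_le_radical_of_fg this (IsNoetherian.noetherian _)
  exact ⟨k, fun r hr => hk hr⟩

lemma gam_mk {A : Ideal (MvPolynomial (Fin n) K)} (f : MvPolynomial (Fin n) K)
    (h : ∀ i, ∃ k, (X i : MvPolynomial (Fin n) K) ^ k * f ∈ A) :
    (Submodule.Quotient.mk f : MvPolynomial (Fin n) K ⧸ A) ∈ Gam (maxIdeal K n) (MvPolynomial (Fin n) K ⧸ A) := by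
  apply gam_of_vars
  intro i
  obtain ⟨k, hk⟩ := h i
  refine ⟨k, ?_⟩
  rw [mk_smul']
  exact (Submodule.Quotient.mk_eq_zero _).2 hk

lemma gam_mon {A : Ideal (MvPolynomial (Fin n) K)} (α : Fin n →₀ ℕ)
    (h : ∀ i, ∃ k, E A (Finsupp.single i k + α)) :
    (Submodule.Quotient.mk (monomial α (1:K)) : MvPolynomial (Fin n) K ⧸ A) ∈ Gam (maxIdeal K n) (MvPolynomial (Fin n) K ⧸ A) := by
  apply gam_mk
  intro i
  obtain ⟨k, hk⟩ := h i
  refine ⟨k, ?_⟩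
  rw [X_pow_eq_monomial, ← mon_mul]; exact hk

lemma X_pow_mem_max_pow (i : Fin n) (k : ℕ) :
    (monomial (Finsupp.single i k) (1:K) : MvPolynomial (Fin n) K) ∈ maxIdeal K n ^ k := by
  rw [← X_pow_eq_monomial]
  exact Ideal.pow_mem_pow (X_mem_max i) k

def SatOff (A : Ideal (MvPolynomial (Fin n) K)) (F : Finset (Fin n)) : Prop :=
  ∀ α, (∀ z ∉ F, ∃ k, E A (Finsupp.single z k + α)) → E A α

lemma SatOff.inf {A B : Ideal (MvPolynomial (Fin n) K)} {F} (hA : SatOff A F) (hB : SatOff B F) : SatOff (A ⊓ B) F :=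
  fun α h => ⟨hA α fun z hz => (h z hz).imp fun _ hk => hk.1, hB α fun z hz => (h z hz).imp fun _ hk => hk.2⟩

lemma SatOff.iInf {ι : Sort*} {A : ι → Ideal (MvPolynomial (Fin n) K)} {F} (hA : ∀ i, SatOff (A i) F) : SatOff (⨅ i, A i) F := by
  intro α h
  rw [E_iInf]
  intro i
  exact hA i α fun z hz => (h z hz).imp fun _ hk => (E_iInf _).1 hk i

/-- M2 base -/
lemma M2_base {A : Ideal (MvPolynomial (Fin n) K)} (hA : IsMon A) {F : Finset (Fin n)}
    (hs : SatOff A F) : ZZ (maxIdeal K n) 0 (MvPolynomial (Fin n) K ⧸ AE A 1 F) := by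
  obtain ⟨e⟩ := h0_equiv (maxIdeal K n) (MvPolynomial (Fin n) K ⧸ AE A 1 F)
  intro ξ
  obtain ⟨⟨x, hx⟩, rfl⟩ := e.surjective ξ
  suffices x = 0 by subst this; exact map_zero e
  obtain ⟨f, rfl⟩ := Submodule.Quotient.mk_surjective _ x
  obtain ⟨k, hk⟩ := hx
  rw [Submodule.Quotient.mk_eq_zero]
  apply mem_of_E
  intro α hα
  rw [E_AE hA]
  by_contra hcon
  push Not at hcon
  obtain ⟨h1, h2⟩ := hcon
  apply h1
  apply hs
  intro z hz
  refine ⟨k, ?_⟩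
  have h3 := hk _ (X_pow_mem_max_pow z k)
  rw [mk_smul', Submodule.Quotient.mk_eq_zero] at h3
  have h4 := AE_mon hA 1 F _ h3 (Finsupp.single z k + α) (by
    rw [mem_support_iff, coeff_monomial_mul, one_mul]
    exact mem_support_iff.1 hα)
  rw [E_AE hA] at h4
  refine h4.resolve_right ?_
  rintro ⟨i, hi, hk1⟩
  have : z ≠ i := fun e => hz (e ▸ hi)
  have := h2 i hi
  simp [*] at hk1
  omega

lemma M2 {A : Ideal (MvPolynomial (Fin n) K)} (hA : IsMon A) {F : Finset (Fin n)} (h : Free A F)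
    (hs : SatOff A F) : ZZ (maxIdeal K n) F.card (MvPolynomial (Fin n) K ⧸ A) := by
  suffices H : ∀ (c : ℕ) (s : Finset (Fin n)), s ⊆ F → (F \ s).card = c →
      ZZ (maxIdeal K n) c (MvPolynomial (Fin n) K ⧸ AE A 1 s) by
    have := H F.card ∅ (Finset.empty_subset _) (by simp)
    rwa [AE_empty] at this
  intro c
  induction c with
  | zero =>
    intro s hs1 hc
    have : s = F := by
      apply Finset.Subset.antisymm hs1
      rwa [Finset.card_eq_zero, Finset.sdiff_eq_empty_iff_subset] at hc
    subst this
    exact M2_base hA hs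
  | succ c ih =>
    intro s hs1 hc
    have hne : (F \ s).Nonempty := by rw [← Finset.card_pos]; omega
    obtain ⟨i, hi⟩ := hne
    have hi' := Finset.mem_sdiff.1 hi
    refine zq_succ (single_mem_max i le_rfl) (AE_reg hA h 1 s hi'.1 hi'.2) ?_
    rw [← AE_insert]
    apply ih (insert i s)
    · exact Finset.insert_subset hi'.1 hs1
    · rw [Finset.sdiff_insert, Finset.card_erase_of_mem hi, hc]; rfl

/-- exponent `L` on F -/
def xF (F : Finset (Fin n)) (L : ℕ) : Fin n →₀ ℕ := Finsupp.equivFunOnFinite.symm fun i => if i ∈ F then L else 0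

lemma xF_apply (F : Finset (Fin n)) (L : ℕ) (i) : xF F L i = if i ∈ F then L else 0 := rfl

/-- M3 -/
lemma M3 {A : Ideal (MvPolynomial (Fin n) K)} (hA : IsMon A) {F : Finset (Fin n)} (h : Free A F)
    (α : Fin n →₀ ℕ) (hα : ¬ E A α) (ht : ∀ z ∉ F, ∃ k, E A (Finsupp.single z k + α)) (L : ℕ) :
    ¬ ∀ ξ : HC (maxIdeal K n) F.card (MvPolynomial (Fin n) K ⧸ A), monomial (xF F L) (1:K) • ξ = 0 := by
  intro hkill
  obtain ⟨k, hk1, hk⟩ : ∃ k, 1 ≤ k ∧ ∀ i, α i + L < k := by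
    refine ⟨(∑ i, α i) + L + 1, by omega, fun i => ?_⟩
    have := Finset.single_le_sum (f := fun i => α i) (fun _ _ => Nat.zero_le _) (Finset.mem_univ i)
    omega
  have H : ∀ (c : ℕ) (s : Finset (Fin n)), s ⊆ F → (F \ s).card = c →
      ∀ ξ : HC (maxIdeal K n) c (MvPolynomial (Fin n) K ⧸ AE A k s), monomial (xF F L) (1:K) • ξ = 0 := by
    intro c
    induction hc' : F.card - c generalizing c with
    | zero =>
      intro s hs hc
      have h1 := Finset.card_sdiff_add_card_eq_card hs
      have h2 : s = ∅ := by rw [← Finset.card_eq_zero]; omega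
      subst h2
      rw [AE_empty]
      have : c = F.card := by simpa using hc.symm
      rw [this]; exact hkill
    | succ d ih =>
      intro s hs hc ξ
      have h1 := Finset.card_sdiff_add_card_eq_card hs
      have hne : s.Nonempty := by rw [← Finset.card_pos]; omega
      obtain ⟨i, hi⟩ := hne
      have hsd : (F \ s.erase i).card = c + 1 := by
        have := Finset.card_sdiff_add_card_eq_card ((Finset.erase_subset i s).trans hs)
        rw [Finset.card_erase_of_mem hi] at this
        have := Finset.card_pos.2 ⟨i, hi⟩
        omega
      have hex := zq_delta (J := maxIdeal K n) (AE_reg hA h k (s.erase i) (hs hi) (Finset.notMem_erase i s)) (i := c)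
        (M1 hA h hk1 (c+1) (s.erase i) ((Finset.erase_subset i s).trans hs) hsd c (by omega))
      rw [← AE_insert, Finset.insert_erase hi] at hex
      obtain ⟨δ, hδ⟩ := hex
      apply hδ
      rw [map_smul, map_zero]
      exact ih (c+1) (by omega) (s.erase i) ((Finset.erase_subset i s).trans hs) hsd _
  have h0 := H 0 F subset_rfl (by simp)
  obtain ⟨e⟩ := h0_equiv (maxIdeal K n) (MvPolynomial (Fin n) K ⧸ AE A k F)
  have hg : (Submodule.Quotient.mk (monomial α (1:K)) : MvPolynomial (Fin n) K ⧸ AE A k F) ∈ Gam (maxIdeal K n) (MvPolynomial (Fin n) K ⧸ AE A k F) := by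
    apply gam_mon
    intro i
    by_cases hi : i ∈ F
    · refine ⟨k, (E_AE hA _ _ _).2 (Or.inr ⟨i, hi, by simp⟩)⟩
    · obtain ⟨l, hl⟩ := ht i hi
      exact ⟨l, (E_AE hA _ _ _).2 (Or.inl hl)⟩
  have h1 := h0 (e ⟨_, hg⟩)
  rw [← map_smul] at h1
  have h2 := (LinearEquiv.map_eq_zero_iff e).1 h1
  have h3 : monomial (xF F L) (1:K) • (Submodule.Quotient.mk (monomial α (1:K)) : MvPolynomial (Fin n) K ⧸ AE A k F) = 0 :=
    congrArg Subtype.val h2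
  rw [mk_smul', Submodule.Quotient.mk_eq_zero, ← mon_mul] at h3
  rcases (E_AE hA _ _ _).1 h3 with h4 | ⟨i, hi, h4⟩
  · apply hα
    refine h.monomial _ ?_ _ h4
    intro i hi
    by_contra hcon
    simp [xF_apply, hcon] at hi
  · have := hk i
    simp [xF_apply, hi] at h4
    omega

end LC
end

end

section
open CategoryTheory Opposite Limits

noncomputable section
namespace LC
open MvPolynomial

variable {K : Type} [Field K] {n : ℕ}

lemma fd_kill {M : Type} [AddCommGroup M] [Module (MvPolynomial (Fin n) K) M]
    (hM : ∀ x : M, ∃ k, ∀ r ∈ maxIdeal K n ^ k, r • x = 0)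
    (h : Module.Finite K (RestrictScalars K (MvPolynomial (Fin n) K) M)) :
    ∃ N, ∀ r ∈ maxIdeal K n ^ N, ∀ x : M, r • x = 0 := by
  let _ := RestrictScalars.moduleOrig K (MvPolynomial (Fin n) K) M
  have h2 : Module.Finite (MvPolynomial (Fin n) K) (RestrictScalars K (MvPolynomial (Fin n) K) M) :=
    Module.Finite.of_restrictScalars_finite K _ _
  have h3 : Module.Finite (MvPolynomial (Fin n) K) M := h2
  obtain ⟨s, hs⟩ := h3.fg_top
  choose k hk using hM
  refine ⟨∑ x ∈ s, k x, fun r hr x => ?_⟩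
  have : x ∈ Submodule.span (MvPolynomial (Fin n) K) (s : Set M) := hs ▸ Submodule.mem_top
  induction this using Submodule.span_induction with
  | mem x hx =>
    exact hk x r (Ideal.pow_le_pow_right (Finset.single_le_sum (f := k) (fun _ _ => Nat.zero_le _) hx) hr)
  | zero => exact smul_zero _
  | add x y _ _ hx hy => rw [smul_add, hx, hy, add_zero]
  | smul a x _ hx => rw [smul_comm, hx, smul_zero]

lemma span_monomials : Submodule.span K (Set.range fun α : Fin n →₀ ℕ => (monomial α (1:K) : MvPolynomial (Fin n) K)) = ⊤ := by
  rw [eq_top_iff]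
  intro f _
  rw [f.as_sum]
  refine Submodule.sum_mem _ fun α _ => ?_
  have : monomial α (coeff α f) = coeff α f • monomial α (1:K) := by
    rw [smul_monomial, smul_eq_mul, mul_one]
  rw [this]
  exact Submodule.smul_mem _ _ (Submodule.subset_span ⟨α, rfl⟩)

lemma mon_mem_max_pow {α : Fin n →₀ ℕ} {N : ℕ} {i} (h : N ≤ α i) :
    (monomial α (1:K) : MvPolynomial (Fin n) K) ∈ maxIdeal K n ^ N :=
  E_mono (X_pow_mem_max_pow i N) (Finsupp.single_le_iff.2 h)

lemma fl_fd' {M : Type} [AddCommGroup M] [Module (MvPolynomial (Fin n) K) M] [Module K M]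
    [IsScalarTower K (MvPolynomial (Fin n) K) M]
    (h : FL (maxIdeal K n) M) : Module.Finite K M := by
  obtain ⟨h1, N, hN⟩ := h
  obtain ⟨t, ht⟩ := h1.fg_top
  have h3 := Submodule.span_smul_of_span_eq_top (R := K) (span_monomials (K := K) (n := n)) (t : Set M)
  rw [ht, Submodule.restrictScalars_top] at h3
  let b : Set (Fin n →₀ ℕ) := Set.Iic (Finsupp.equivFunOnFinite.symm fun _ => N)
  have hb : b.Finite := Set.finite_Iic _
  refine ⟨Submodule.fg_def.2 ⟨(Set.image2 (fun α x => (monomial α (1:K) : MvPolynomial (Fin n) K) • x) b (t : Set M)),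
    hb.image2 _ t.finite_toSet, ?_⟩⟩
  rw [eq_top_iff, ← h3, Submodule.span_le]
  rintro _ ⟨_, ⟨α, rfl⟩, x, hx, rfl⟩
  by_cases hα : α ∈ b
  · exact Submodule.subset_span ⟨α, hα, x, hx, rfl⟩
  · have : ∃ i, N ≤ α i := by
      by_contra hcon
      push Not at hcon
      exact hα (fun i => (hcon i).le)
    obtain ⟨i, hi⟩ := this
    show monomial α (1:K) • x ∈ _
    rw [hN _ (mon_mem_max_pow hi)]
    exact Submodule.zero_mem _

lemma fl_fd {M : Type} [AddCommGroup M] [Module (MvPolynomial (Fin n) K) M]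
    (h : FL (maxIdeal K n) M) :
    Module.Finite K (RestrictScalars K (MvPolynomial (Fin n) K) M) := by
  exact @fl_fd' K _ n M _ _ (Module.restrictScalars K (MvPolynomial (Fin n) K) M)
    (IsScalarTower.restrictScalars K (MvPolynomial (Fin n) K) M) h

/-! Krull dimension -/

lemma dim_lower {A : Ideal (MvPolynomial (Fin n) K)} (F : Finset (Fin n)) (h : A ≤ PF K Fᶜ) :
    (F.card : WithBot ℕ∞) ≤ ringKrullDim (MvPolynomial (Fin n) K ⧸ A) := by
  let φ : MvPolynomial (Fin n) K →ₐ[K] MvPolynomial F K :=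
    aeval (fun i => if hi : i ∈ F then X ⟨i, hi⟩ else 0)
  have hφ : Function.Surjective φ := by
    intro f
    refine ⟨rename Subtype.val f, ?_⟩
    simp only [φ, aeval_rename]
    convert aeval_X_left_apply f using 2
    congr 1
    funext i
    simp
  have hk : ∀ a ∈ A, φ a = 0 := by
    intro a ha
    have h1 : PF K Fᶜ ≤ RingHom.ker φ := by
      unfold PF
      rw [Ideal.span_le]
      rintro _ ⟨i, hi, rfl⟩
      have hi' : i ∉ F := by simpa using hi
      show φ (X i) = 0
      simp [φ, hi']
    exact h1 (h ha)
  have := ringKrullDim_le_of_surjective (Ideal.Quotient.lift A φ.toRingHom hk) (Ideal.Quotient.lift_surjective_of_surjective _ _ hφ)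
  refine le_trans ?_ this
  rw [MvPolynomial.ringKrullDim_of_isNoetherianRing]
  simp

lemma dim_PF (F : Finset (Fin n)) : ringKrullDim (MvPolynomial (Fin n) K ⧸ PF K Fᶜ) ≤ (F.card : WithBot ℕ∞) := by
  let φ : MvPolynomial F K →+* (MvPolynomial (Fin n) K ⧸ PF K Fᶜ) :=
    (Ideal.Quotient.mk _).comp (rename Subtype.val : MvPolynomial F K →ₐ[K] MvPolynomial (Fin n) K).toRingHom
  have hφ : Function.Surjective φ := by
    intro x
    obtain ⟨f, rfl⟩ := Ideal.Quotient.mk_surjective x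
    induction f using MvPolynomial.induction_on with
    | C a => exact ⟨C a, by simp [φ]⟩
    | add p q hp hq =>
      obtain ⟨a, ha⟩ := hp; obtain ⟨b, hb⟩ := hq
      exact ⟨a + b, by rw [map_add, map_add, ha, hb]⟩
    | mul_X p i hp =>
      obtain ⟨a, ha⟩ := hp
      by_cases hi : i ∈ F
      · exact ⟨a * X ⟨i, hi⟩, by rw [map_mul, map_mul, ha]; simp [φ]⟩
      · refine ⟨0, ?_⟩
        rw [map_zero, eq_comm, Ideal.Quotient.eq_zero_iff_mem]
        exact Ideal.mul_mem_left _ _ (Ideal.subset_span ⟨i, by simpa using hi, rfl⟩)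
  refine (ringKrullDim_le_of_surjective φ hφ).trans ?_
  rw [MvPolynomial.ringKrullDim_of_isNoetherianRing]
  simp

lemma dim_upper (Δ : SimComplex n) (d : ℕ) (hd : ∀ F ∈ Δ.faces, F.card ≤ d) (m : ℕ) :
    ringKrullDim (MvPolynomial (Fin n) K ⧸ SRIdeal K Δ ^ m) ≤ d := by
  classical
  rw [ringKrullDim_quotient]
  unfold Order.krullDim
  refine iSup_le fun l => ?_
  let p0 := l.head.1.asIdeal
  have hp0 : p0.IsPrime := l.head.1.isPrime
  let F : Finset (Fin n) := Finset.univ.filter fun i => (X i : MvPolynomial (Fin n) K) ∉ p0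
  have hF : F ∈ Δ.faces := by
    by_contra hcon
    have h1 : faceMonomial K F ∈ SRIdeal K Δ := Ideal.subset_span ⟨F, hcon, rfl⟩
    have h2 : faceMonomial K F ^ m ∈ p0 := l.head.2 (Ideal.pow_mem_pow h1 m)
    have h3 := hp0.mem_of_pow_mem _ h2
    unfold faceMonomial at h3
    rw [hp0.prod_mem_iff] at h3
    obtain ⟨i, hi, h4⟩ := h3
    exact (Finset.mem_filter.1 hi).2 h4
  have hle : PF K Fᶜ ≤ p0 := by
    unfold PF
    rw [Ideal.span_le]
    rintro _ ⟨i, hi, rfl⟩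
    simpa [F] using hi
  have hall : ∀ k, PF K Fᶜ ≤ (l k).1.asIdeal := fun k =>
    hle.trans (show l.head ≤ l k from LTSeries.head_le l k)
  let l' : LTSeries (PrimeSpectrum.zeroLocus (R := MvPolynomial (Fin n) K) (PF K Fᶜ)) :=
    { length := l.length
      toFun := fun k => ⟨(l k).1, hall k⟩
      step := fun k => l.step k }
  have h5 : (l'.length : WithBot ℕ∞) ≤ _ := Order.LTSeries.length_le_krullDim l'
  rw [← ringKrullDim_quotient] at h5
  refine (h5.trans (dim_PF F)).trans ?_
  exact_mod_cast hd F hF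

lemma faceMonomial_eq (F : Finset (Fin n)) : faceMonomial K F = monomial (xF F 1) (1:K) := by
  rw [monomial_eq, C_1, one_mul]
  unfold faceMonomial Finsupp.prod
  have : (xF F 1).support = F := by ext i; simp [xF_apply]
  rw [this]
  refine Finset.prod_congr rfl fun i hi => ?_
  simp [xF_apply, hi]

/-- squarefree monomial ideal -/
def SQ (K : Type) [Field K] {n : ℕ} (N : Finset (Fin n) → Prop) : Ideal (MvPolynomial (Fin n) K) :=
  Ideal.span ((fun b => monomial b (1:K)) '' {b | ∃ G, N G ∧ b = xF G 1})

lemma SQ_mon (N : Finset (Fin n) → Prop) : IsMon (SQ K N) := isMon_span _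

lemma xF_le {G : Finset (Fin n)} {α : Fin n →₀ ℕ} : xF G 1 ≤ α ↔ G ⊆ α.support := by
  constructor
  · intro h i hi
    have := h i
    simp only [xF_apply, hi, if_true] at this
    rw [Finsupp.mem_support_iff]; omega
  · intro h i
    rw [xF_apply]
    split_ifs with hi
    · have := Finsupp.mem_support_iff.1 (h hi); omega
    · exact Nat.zero_le _

lemma E_SQ (N : Finset (Fin n) → Prop) (α) : E (SQ K N) α ↔ ∃ G, N G ∧ G ⊆ α.support := by
  unfold SQ
  rw [E_span]
  constructor
  · rintro ⟨_, ⟨G, hG, rfl⟩, hle⟩; exact ⟨G, hG, xF_le.1 hle⟩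
  · rintro ⟨G, hG, hle⟩; exact ⟨_, ⟨G, hG, rfl⟩, xF_le.2 hle⟩

lemma SRIdeal_eq (Δ : SimComplex n) : SRIdeal K Δ = SQ K (fun G => G ∉ Δ.faces) := by
  unfold SRIdeal SQ
  congr 1
  ext p
  constructor
  · rintro ⟨F, hF, rfl⟩; exact ⟨_, ⟨F, hF, rfl⟩, (faceMonomial_eq F).symm⟩
  · rintro ⟨_, ⟨F, hF, rfl⟩, rfl⟩; exact ⟨F, hF, (faceMonomial_eq F).symm⟩

lemma PF_eq (F : Finset (Fin n)) : PF K F = SQ K (fun G => ∃ i ∈ F, G = {i}) := by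
  unfold PF SQ
  congr 1
  have hx : ∀ i : Fin n, (X i : MvPolynomial (Fin n) K) = monomial (xF {i} 1) (1:K) := by
    intro i; rw [← faceMonomial_eq]; simp [faceMonomial]
  ext p
  constructor
  · rintro ⟨i, hi, rfl⟩; exact ⟨_, ⟨{i}, ⟨i, hi, rfl⟩, rfl⟩, (hx i).symm⟩
  · rintro ⟨_, ⟨_, ⟨i, hi, rfl⟩, rfl⟩, rfl⟩; exact ⟨i, hi, hx i⟩

lemma PF_mon (F : Finset (Fin n)) : IsMon (PF K F) := by rw [PF_eq]; exact SQ_mon _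

lemma E_PF (F : Finset (Fin n)) (α) : E (PF K F) α ↔ ∃ i ∈ F, α i ≠ 0 := by
  rw [PF_eq, E_SQ]
  constructor
  · rintro ⟨_, ⟨i, hi, rfl⟩, h⟩
    exact ⟨i, hi, Finsupp.mem_support_iff.1 (h (Finset.mem_singleton_self i))⟩
  · rintro ⟨i, hi, h⟩
    exact ⟨_, ⟨i, hi, rfl⟩, by simpa using h⟩

lemma E_PF_pow (F : Finset (Fin n)) (m : ℕ) (α) : E (PF K F ^ m) α ↔ m ≤ ∑ i ∈ F, α i := by
  induction m generalizing α with
  | zero => exact ⟨fun _ => Nat.zero_le _, fun _ => E_pow_zero _ _⟩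
  | succ m ih =>
    rw [E_pow_succ (PF_mon F)]
    constructor
    · rintro ⟨β, γ, hβ, hγ, rfl⟩
      rw [ih] at hβ
      rw [E_PF] at hγ
      obtain ⟨i, hi, h⟩ := hγ
      have := Finset.single_le_sum (f := fun i => γ i) (fun _ _ => Nat.zero_le _) hi
      simp only [Finsupp.add_apply, Finset.sum_add_distrib]
      omega
    · intro h
      have : ∃ i ∈ F, α i ≠ 0 := by
        by_contra hcon
        push Not at hcon
        rw [Finset.sum_eq_zero hcon] at h
        omega
      obtain ⟨i, hi, h1⟩ := this
      obtain ⟨β, rfl⟩ := exists_add_of_le (Finsupp.single_le_iff.2 (Nat.one_le_iff_ne_zero.2 h1) : Finsupp.single i 1 ≤ α)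
      refine ⟨β, Finsupp.single i 1, ?_, ?_, add_comm _ _⟩
      · rw [ih]
        simp only [Finsupp.add_apply, Finset.sum_add_distrib] at h
        have : ∑ j ∈ F, (Finsupp.single i 1 : Fin n →₀ ℕ) j = 1 := by
          rw [Finset.sum_eq_single i] <;> simp [hi, Finsupp.single_apply, eq_comm]
        omega
      · rw [E_PF]; exact ⟨i, hi, by simp⟩

lemma SR_le_PF (Δ : SimComplex n) {F} (hF : F ∈ Δ.faces) : SRIdeal K Δ ≤ PF K Fᶜ := by
  rw [SRIdeal_eq, (SQ_mon _).le_iff]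
  intro α h
  rw [E_SQ] at h
  obtain ⟨G, hG, hs⟩ := h
  rw [E_PF]
  by_contra hcon
  push Not at hcon
  apply hG
  refine Δ.down_closed hF fun i hi => ?_
  by_contra hiF
  exact Finsupp.mem_support_iff.1 (hs hi) (hcon i (by simpa using hiF))

lemma gcm_kill {Δ : SimComplex n} {m : ℕ} (hm : 1 ≤ m) (h : IsGeneralizedCM K (SRIdeal K Δ ^ m)) {F} (hF : F ∈ Δ.faces) {i : ℕ}
    (hi : i < F.card) : ∃ N, ∀ r ∈ maxIdeal K n ^ N,
      ∀ ξ : HC (maxIdeal K n) i (MvPolynomial (Fin n) K ⧸ SRIdeal K Δ ^ m), r • ξ = 0 := by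
  have h1 := h i (lt_of_lt_of_le (by exact_mod_cast hi)
    (dim_lower F ((Ideal.pow_le_self (by omega)).trans (SR_le_PF Δ hF))))
  exact fd_kill hc_torsion h1

lemma gcm_of_fl {Δ : SimComplex n} {m d : ℕ} (hd : ∀ F ∈ Δ.faces, F.card ≤ d)
    (h : ∀ i < d, FL (maxIdeal K n) (HC (maxIdeal K n) i (MvPolynomial (Fin n) K ⧸ SRIdeal K Δ ^ m))) :
    IsGeneralizedCM K (SRIdeal K Δ ^ m) := by
  intro i hi
  have := lt_of_lt_of_le hi (dim_upper Δ d hd m)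
  exact fl_fd (h i (by exact_mod_cast this))

lemma card_bdd (Δ : SimComplex n) : BddAbove (Finset.card '' Δ.faces) :=
  ⟨n, by rintro _ ⟨F, _, rfl⟩; simpa using Finset.card_le_univ F⟩

lemma card_le_sSup (Δ : SimComplex n) {F} (hF : F ∈ Δ.faces) : F.card ≤ sSup (Finset.card '' Δ.faces) :=
  le_csSup (card_bdd Δ) ⟨F, hF, rfl⟩

lemma exists_card_sSup (Δ : SimComplex n) (h : ∃ F, F ∈ Δ.faces) : ∃ F ∈ Δ.faces, F.card = sSup (Finset.card '' Δ.faces) := by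
  have : sSup (Finset.card '' Δ.faces) ∈ Finset.card '' Δ.faces := by
    obtain ⟨F, hF⟩ := h
    exact Nat.sSup_mem ⟨_, F, hF, rfl⟩ (card_bdd Δ)
  exact this

end LC
end

end

section
open CategoryTheory Opposite Limits

noncomputable section
namespace LC
open MvPolynomial

variable {K : Type} [Field K] {n : ℕ}

lemma ZZ_bot {j : ℕ} (hj : j < n) : ZZ (maxIdeal K n) j (MvPolynomial (Fin n) K ⧸ (⊥ : Ideal (MvPolynomial (Fin n) K))) := by
  refine M1' isMon_bot (F := Finset.univ) (fun i _ α h => (E_bot _ h).elim) ?_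
  simpa using hj

lemma ci_vanish (T : Finset (Finset (Fin n))) (hT : ∀ B ∈ T, ∀ C ∈ T, B ≠ C → Disjoint B C) :
    ∀ (m i : ℕ), i + T.card < n → ZZ (maxIdeal K n) i (MvPolynomial (Fin n) K ⧸ SQ K (fun G => G ∈ T) ^ m) := by
  classical
  induction T using Finset.induction_on with
  | empty =>
    intro m i hi
    have : SQ K (fun G : Finset (Fin n) => G ∈ (∅ : Finset (Finset (Fin n)))) = ⊥ := by
      simp [SQ]
    rw [this]
    cases m with
    | zero => rw [pow_zero, Ideal.one_eq_top]; exact z_top i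
    | succ m => rw [Ideal.bot_pow (Nat.succ_ne_zero m)]; exact ZZ_bot (by simpa using hi)
  | insert B T hB ih =>
    intro m i hi
    rw [Finset.card_insert_of_notMem hB] at hi
    have ih' := ih (fun B hB C hC => hT B (Finset.mem_insert_of_mem hB) C (Finset.mem_insert_of_mem hC))
    have he : SQ K (fun G => G ∈ insert B T) = SQ K (fun G => G ∈ T) ⊔ Ideal.span {monomial (xF B 1) (1:K)} := by
      apply IsMon.ext (SQ_mon _) ((SQ_mon _).sup (isMon_singleton _))
      intro α
      rw [E_sup (SQ_mon _) (isMon_singleton _), E_SQ, E_SQ, E_singleton, xF_le]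
      simp [or_comm]
    rw [he]
    have hfree : Free (SQ K (fun G => G ∈ T)) B := by
      intro j hj α h
      rw [E_SQ] at h ⊢
      obtain ⟨G, hG, hs⟩ := h
      refine ⟨G, hG, fun k hk => ?_⟩
      have h1 := hs hk
      have : j ≠ k := by
        rintro rfl
        exact Finset.disjoint_left.1 (hT B (Finset.mem_insert_self _ _) G (Finset.mem_insert_of_mem hG) (fun e => hB (e ▸ hG))) hj hk
      simpa [Finsupp.single_apply, this] using h1
    refine ci_pow (N := n - T.card - 1) ?_ ?_ m i (by omega)
    · intro m f hf
      refine mon_reg ((SQ_mon _).pow m) (fun α => (hfree.pow (SQ_mon _) m).monomial _ ?_ α) f hf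
      intro k hk
      by_contra hcon
      simp [xF_apply, hcon] at hk
    · intro m i hi
      exact ih' m i (by omega)

lemma adj_symm {Δ : SimComplex n} {u v} (h : Δ.Adj u v) : Δ.Adj v u :=
  ⟨h.1.symm, by rw [Finset.pair_comm]; exact h.2⟩

lemma reach_symm {Δ : SimComplex n} {u v} (h : Δ.Reach u v) : Δ.Reach v u := by
  induction h with
  | refl => exact Relation.ReflTransGen.refl
  | tail _ h2 ih => exact Relation.ReflTransGen.head (adj_symm h2) ih

lemma reach_trans {Δ : SimComplex n} {u v w} (h : Δ.Reach u v) (h' : Δ.Reach v w) : Δ.Reach u w :=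
  Relation.ReflTransGen.trans h h'

lemma reach_face {Δ : SimComplex n} {F} (hF : F ∈ Δ.faces) {u v} (hu : u ∈ F) (hv : v ∈ F) : Δ.Reach u v := by
  by_cases h : u = v
  · subst h; exact Relation.ReflTransGen.refl
  · exact Relation.ReflTransGen.single ⟨h, Δ.down_closed hF (by intro x hx; simp at hx; rcases hx with rfl | rfl <;> assumption)⟩

lemma component_eq {Δ : SimComplex n} {u v} (h : Δ.Reach u v) : Δ.component u = Δ.component v := by
  unfold SimComplex.component
  congr 1
  ext w
  exact ⟨fun h' => reach_trans (reach_symm h) h', fun h' => reach_trans h h'⟩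

lemma comp_vanish (Γ : SimComplex n) (hne : ∅ ∈ Γ.faces) (hCI : Γ.IsCompleteIntersection) (m i : ℕ) {H} (hH : H ∈ Γ.faces)
    (hi : i < H.card) : ZZ (maxIdeal K n) i (MvPolynomial (Fin n) K ⧸ SRIdeal K Γ ^ m) := by
  classical
  let T : Finset (Finset (Fin n)) := Finset.univ.filter fun G => G ∉ Γ.faces ∧ ∀ G' ⊂ G, G' ∈ Γ.faces
  have hmin : ∀ B ∈ T, (↑B ⊆ Γ.vertexSet) ∨ ∃ z, B = {z} := by
    intro B hB
    simp only [T, Finset.mem_filter, Finset.mem_univ, true_and] at hB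
    by_cases h : ↑B ⊆ Γ.vertexSet
    · exact Or.inl h
    · right
      rw [Set.not_subset] at h
      obtain ⟨z, hz, hz'⟩ := h
      refine ⟨z, ?_⟩
      by_contra hcon
      exact hz' (hB.2 {z} (Finset.ssubset_iff_subset_ne.2 ⟨by simpa using hz, fun e => hcon e.symm⟩))
  have hsing : ∀ z, ∀ B ∈ T, {z} ∈ T → z ∈ B → B = {z} := by
    intro z B hB hz hzB
    simp only [T, Finset.mem_filter, Finset.mem_univ, true_and] at hB hz
    by_contra hcon
    exact hz.1 (hB.2 {z} (Finset.ssubset_iff_subset_ne.2 ⟨by simpa using hzB, fun e => hcon e.symm⟩))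
  have hdisj : ∀ B ∈ T, ∀ C ∈ T, B ≠ C → Disjoint B C := by
    intro B hB C hC hne
    rcases hmin B hB with h1 | ⟨z, rfl⟩
    · rcases hmin C hC with h2 | ⟨z, rfl⟩
      · simp only [T, Finset.mem_filter, Finset.mem_univ, true_and] at hB hC
        exact hCI B C ⟨h1, hB⟩ ⟨h2, hC⟩ hne
      · rw [Finset.disjoint_singleton_right]
        exact fun h => hne (hsing z B hB hC h)
    · rw [Finset.disjoint_singleton_left]
      exact fun h => hne (hsing z C hC hB h).symm
  have hI : SRIdeal K Γ = SQ K (fun G => G ∈ T) := by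
    rw [SRIdeal_eq]
    apply IsMon.ext (SQ_mon _) (SQ_mon _)
    intro α
    rw [E_SQ, E_SQ]
    constructor
    · rintro ⟨G, hG, hs⟩
      obtain ⟨M, hM, hmm⟩ := exists_minimal_le_of_wellFoundedLT (fun G => G ∉ Γ.faces) G hG
      refine ⟨M, ?_, hM.trans hs⟩
      simp only [T, Finset.mem_filter, Finset.mem_univ, true_and]
      refine ⟨hmm.1, fun G' hG' => ?_⟩
      by_contra hcon
      exact hG'.2 (hmm.2 hcon hG'.1)
    · rintro ⟨G, hG, hs⟩
      exact ⟨G, (Finset.mem_filter.1 hG).2.1, hs⟩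
  rw [hI]
  apply ci_vanish T hdisj
  have hex : ∀ B ∈ T, ∃ x ∈ B, x ∉ H := by
    intro B hB
    by_contra hcon
    push Not at hcon
    exact (Finset.mem_filter.1 hB).2.1 (Γ.down_closed hH hcon)
  have : Nonempty (Fin n) := by
    obtain ⟨x, _⟩ : H.Nonempty := by rw [← Finset.card_pos]; omega
    exact ⟨x⟩
  choose! f hf using hex
  have hcard : T.card ≤ (Hᶜ).card := by
    apply Finset.card_le_card_of_injOn f
    · intro B hB; simpa using (hf B hB).2
    · intro B hB C hC hBC
      by_contra hne
      have := Finset.disjoint_left.1 (hdisj B hB C hC hne) (hf B hB).1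
      rw [hBC] at this
      exact this (hf C hC).1
  have h1 := Finset.card_compl_add_card H
  rw [Fintype.card_fin] at h1
  omega

lemma X_pow_mem {A : Ideal (MvPolynomial (Fin n) K)} {i} (h : (X i : MvPolynomial (Fin n) K) ∈ A) (m : ℕ) :
    (X i : MvPolynomial (Fin n) K) ^ m ∈ A ^ m := Ideal.pow_mem_pow h m

lemma gam_top_of {A : Ideal (MvPolynomial (Fin n) K)} (h : ∀ i, ∃ k, (X i : MvPolynomial (Fin n) K) ^ k ∈ A) :
    Gam (maxIdeal K n) (MvPolynomial (Fin n) K ⧸ A) = ⊤ := by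
  rw [eq_top_iff]
  intro x _
  obtain ⟨f, rfl⟩ := Submodule.Quotient.mk_surjective _ x
  apply gam_mk
  intro i
  obtain ⟨k, hk⟩ := h i
  exact ⟨k, Ideal.mul_mem_right _ _ hk⟩

theorem three_one (Δ : SimComplex n) (hV : ∀ i : Fin n, ({i}:Finset (Fin n)) ∈ Δ.faces) (hdim : 2 ≤ Δ.dim)
    (h1 : ∀ v ∈ Δ.vertexSet, (Δ.component v).IsCompleteIntersection)
    (h2 : ∀ u ∈ Δ.vertexSet, ∀ v ∈ Δ.vertexSet, (Δ.component u).dim = (Δ.component v).dim)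
    (m : ℕ) : IsGeneralizedCM K (SRIdeal K Δ ^ m) := by
  classical
  unfold SimComplex.dim at hdim
  set d := sSup (Finset.card '' Δ.faces) with hd
  have hd3 : 3 ≤ d := by
    have : (2:ℤ) ≤ (d:ℤ) - 1 := hdim
    omega
  have hne : ∃ F, F ∈ Δ.faces := by
    by_contra hcon
    push Not at hcon
    have : Δ.faces = ∅ := Set.eq_empty_of_forall_notMem hcon
    rw [this] at hd
    simp at hd
    omega
  have hempty : ∅ ∈ Δ.faces := by
    obtain ⟨F, hF⟩ := hne
    exact Δ.down_closed hF (Finset.empty_subset _)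
  have hcompE : ∀ v, ∅ ∈ (Δ.component v).faces := fun v => ⟨hempty, by simp⟩
  obtain ⟨F, hF, hFc⟩ := exists_card_sSup Δ hne
  rw [← hd] at hFc
  have hFne : F.Nonempty := by rw [← Finset.card_pos]; omega
  obtain ⟨v0, hv0⟩ := hFne
  have hcomp : ∀ v, ∃ H ∈ (Δ.component v).faces, H.card = d := by
    intro v
    obtain ⟨H, hH, hHc⟩ := exists_card_sSup (Δ.component v) ⟨∅, hcompE v⟩
    refine ⟨H, hH, ?_⟩
    have h3 := h2 v (hV v) v0 (hV v0)
    unfold SimComplex.dim at h3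
    rw [← hHc] at h3
    have h4 : F.card ≤ sSup (Finset.card '' (Δ.component v0).faces) :=
      card_le_sSup _ ⟨hF, fun x hx => reach_face hF hv0 hx⟩
    have h5 : H.card ≤ d := card_le_sSup Δ hH.1
    have h6 : ((H.card : ℕ) : ℤ) - 1 = ((sSup (Finset.card '' (Δ.component v0).faces) : ℕ) : ℤ) - 1 := h3
    omega
  refine gcm_of_fl (d := d) (fun F hF => card_le_sSup Δ hF) fun i hi => ?_
  let Q : Fin n → Ideal (MvPolynomial (Fin n) K) := fun v => SRIdeal K (Δ.component v)
  have hQ : ∀ v, ZZ (maxIdeal K n) i (MvPolynomial (Fin n) K ⧸ Q v ^ m) := by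
    intro v
    obtain ⟨H, hH, hHc⟩ := hcomp v
    exact comp_vanish _ (hcompE v) (h1 v (hV v)) m i hH (by omega)
  have hXQ : ∀ v z, ¬ Δ.Reach v z → (X z : MvPolynomial (Fin n) K) ∈ Q v := by
    intro v z hz
    refine Ideal.subset_span ⟨{z}, ?_, by simp [faceMonomial]⟩
    rintro ⟨_, h⟩
    exact hz (h (by simp))
  have hfl : ∀ s : Finset (Fin n), FL (maxIdeal K n) (HC (maxIdeal K n) i (MvPolynomial (Fin n) K ⧸ ⨅ v ∈ s, Q v ^ m)) := by
    intro s
    induction s using Finset.induction_on with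
    | empty =>
      have : (⨅ v ∈ (∅ : Finset (Fin n)), Q v ^ m) = ⊤ := by simp
      rw [this]; exact fl_of_zero (z_top i)
    | insert v s hv ih =>
      rw [Finset.iInf_insert]
      by_cases hr : ∃ u ∈ s, Δ.Reach u v
      · obtain ⟨u, hu, hr⟩ := hr
        have : (⨅ w ∈ s, Q w ^ m) ≤ Q v ^ m := by
          have h3 : Q u = Q v := by simp only [Q]; rw [component_eq hr]
          rw [← h3]
          exact iInf₂_le u hu
        rw [inf_eq_right.2 this]; exact ih
      · push Not at hr
        refine mv_fl (fl_of_zero (hQ v)) ih (gam_top_of fun z => ⟨m, ?_⟩)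
        by_cases hz : Δ.Reach v z
        · refine (le_sup_right : _ ≤ Q v ^ m ⊔ _) ?_
          rw [Submodule.mem_iInf]; intro u; rw [Submodule.mem_iInf]; intro hu
          exact X_pow_mem (hXQ u z fun h => hr u hu (reach_trans h (reach_symm hz))) m
        · exact (le_sup_left : Q v ^ m ≤ _) (X_pow_mem (hXQ v z hz) m)
  have hle : SRIdeal K Δ ^ m ≤ ⨅ v ∈ (Finset.univ : Finset (Fin n)), Q v ^ m := by
    refine le_iInf₂ fun v _ => Ideal.pow_right_mono ?_ m
    refine Ideal.span_mono ?_
    rintro _ ⟨F, hF, rfl⟩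
    exact ⟨F, fun h => hF h.1, rfl⟩
  refine fl_surj (g := Submodule.factor hle) (Submodule.factor_surjective hle) ?_ (hfl Finset.univ)
  intro x hx
  obtain ⟨f, rfl⟩ := Submodule.Quotient.mk_surjective _ x
  rw [factor_ker] at hx
  apply gam_mk
  intro z
  refine ⟨m, ?_⟩
  have hfz : f ∈ Q z ^ m := by
    rw [Submodule.mem_iInf] at hx
    have := hx z
    rw [Submodule.mem_iInf] at this
    exact this (Finset.mem_univ z)
  have hmul : Ideal.span {(X z : MvPolynomial (Fin n) K)} * Q z ≤ SRIdeal K Δ := by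
    simp only [Q, SRIdeal]
    rw [Ideal.span_mul_span', Ideal.span_le]
    rintro _ ⟨_, rfl, _, ⟨G, hG, rfl⟩, rfl⟩
    have hnf : insert z G ∉ Δ.faces := by
      intro h
      exact hG ⟨Δ.down_closed h (Finset.subset_insert _ _), fun x hx =>
        reach_face h (Finset.mem_insert_self _ _) (Finset.mem_insert_of_mem hx)⟩
    have h3 : faceMonomial K (insert z G) ∈ SRIdeal K Δ := Ideal.subset_span ⟨_, hnf, rfl⟩
    by_cases hzG : z ∈ G
    · rw [Finset.insert_eq_of_mem hzG] at h3
      exact Ideal.mul_mem_left _ _ h3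
    · unfold faceMonomial at h3 ⊢
      rwa [Finset.prod_insert hzG] at h3
  have := Ideal.pow_right_mono hmul m
  rw [mul_pow] at this
  exact this (Ideal.mul_mem_mul (Ideal.pow_mem_pow (Ideal.mem_span_singleton_self _) m) hfz)

end LC
end

end

section
open CategoryTheory Opposite Limits

noncomputable section
namespace LC
open MvPolynomial

variable {K : Type} [Field K] {n : ℕ}

/-- localized ideal -/
def IF (K : Type) [Field K] {n : ℕ} (Δ : SimComplex n) (F : Finset (Fin n)) : Ideal (MvPolynomial (Fin n) K) :=
  SQ K (fun G => G ∪ F ∉ Δ.faces)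

lemma IF_mon (Δ : SimComplex n) (F) : IsMon (IF K Δ F) := SQ_mon _

lemma E_IF (Δ : SimComplex n) (F) (α) : E (IF K Δ F) α ↔ α.support ∪ F ∉ Δ.faces := by
  unfold IF
  rw [E_SQ]
  constructor
  · rintro ⟨G, hG, hs⟩ h
    exact hG (Δ.down_closed h (Finset.union_subset_union_left hs))
  · intro h; exact ⟨_, h, subset_rfl⟩

lemma IF_free (Δ : SimComplex n) (F) : Free (IF K Δ F) F := by
  intro i hi α h
  rw [E_IF] at h ⊢
  intro hcon
  apply h
  refine Δ.down_closed hcon ?_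
  intro j hj
  rw [Finset.mem_union] at hj ⊢
  rcases hj with hj | hj
  · by_cases hij : i = j
    · subst hij; exact Or.inr hi
    · left; simpa [Finsupp.single_apply, hij] using hj
  · exact Or.inr hj

lemma SR_le_IF (Δ : SimComplex n) (F) : SRIdeal K Δ ≤ IF K Δ F := by
  rw [SRIdeal_eq, (SQ_mon _).le_iff]
  intro α h
  rw [E_SQ] at h
  rw [E_IF]
  obtain ⟨G, hG, hs⟩ := h
  exact fun hh => hG (Δ.down_closed hh (hs.trans Finset.subset_union_left))

lemma supp_xF (F : Finset (Fin n)) {k : ℕ} (hk : k ≠ 0) : (xF F k).support = F := by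
  ext i; simp [xF_apply, hk]

lemma supp_add (α β : Fin n →₀ ℕ) : (α + β).support = α.support ∪ β.support := by
  ext i; simp; tauto

lemma xF_mul_IF (Δ : SimComplex n) (F) : Ideal.span {monomial (xF F 1) (1:K)} * IF K Δ F ≤ SRIdeal K Δ := by
  rw [((isMon_singleton _).mul (IF_mon Δ F)).le_iff]
  intro α h
  rw [E_mul (isMon_singleton _) (IF_mon Δ F)] at h
  obtain ⟨β, γ, hβ, hγ, rfl⟩ := h
  rw [E_singleton, xF_le] at hβ
  rw [E_IF] at hγ
  rw [SRIdeal_eq, E_SQ]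
  refine ⟨(β + γ).support, fun h => hγ ?_, subset_rfl⟩
  refine Δ.down_closed h ?_
  rw [supp_add, Finset.union_comm]
  exact Finset.union_subset_union_left hβ

lemma mon_xF_pow (F : Finset (Fin n)) (m : ℕ) : (monomial (xF F 1) (1:K) : MvPolynomial (Fin n) K) ^ m = monomial (xF F m) 1 := by
  have h : m • xF F 1 = xF F m := by ext i; simp [xF_apply]
  rw [monomial_pow, one_pow, h]

lemma xF_add (F : Finset (Fin n)) (a b : ℕ) : xF F (a + b) = xF F a + xF F b := by
  ext i; simp only [xF_apply, Finsupp.add_apply]; split_ifs <;> rfl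

/-- bundle of hypotheses -/
structure Hyp (K : Type) [Field K] {n : ℕ} (Δ : SimComplex n) (m d : ℕ) : Prop where
  hm : 3 ≤ m
  hd : 3 ≤ d
  gcm : IsGeneralizedCM K (SRIdeal K Δ ^ m)
  le : ∀ F ∈ Δ.faces, F.card ≤ d
  ex : ∃ F ∈ Δ.faces, F.card = d

variable {Δ : SimComplex n} {m d : ℕ}

lemma Hyp.kill (H : Hyp K Δ m d) {F : Finset (Fin n)} (hF : F.Nonempty) {t : ℕ} (ht : t < d) :
    ∃ L, ∀ ξ : HC (maxIdeal K n) t (MvPolynomial (Fin n) K ⧸ IF K Δ F ^ m), monomial (xF F L) (1:K) • ξ = 0 := by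
  obtain ⟨G, hG, hGc⟩ := H.ex
  obtain ⟨N, hN⟩ := gcm_kill (K := K) (by have := H.hm; omega) H.gcm hG (i := t) (by omega)
  refine ⟨N + m, fun ξ => ?_⟩
  rw [xF_add, mon_mul]
  have hle : SRIdeal K Δ ^ m ≤ IF K Δ F ^ m := Ideal.pow_right_mono (SR_le_IF Δ F) m
  refine kill_surj (g := Submodule.factor hle) (Submodule.factor_surjective hle) ?_ ?_ ξ
  · intro x hx
    obtain ⟨f, rfl⟩ := Submodule.Quotient.mk_surjective _ x
    rw [factor_ker] at hx
    rw [mk_smul', Submodule.Quotient.mk_eq_zero]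
    have := Ideal.pow_right_mono (xF_mul_IF (K := K) Δ F) m
    rw [mul_pow] at this
    apply this
    refine Ideal.mul_mem_mul ?_ hx
    rw [← mon_xF_pow F m]
    exact Ideal.pow_mem_pow (Ideal.mem_span_singleton_self (monomial (xF F 1) (1:K))) m
  · obtain ⟨i, hi⟩ := hF
    refine hN _ (mon_mem_max_pow (i := i) ?_)
    simp [xF_apply, hi]

lemma Hyp.satOff (H : Hyp K Δ m d) {F : Finset (Fin n)} (hF : F.Nonempty) (hc : F.card < d) :
    SatOff (IF K Δ F ^ m) F := by
  intro α h
  by_contra hcon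
  obtain ⟨L, hL⟩ := H.kill hF hc
  exact M3 ((IF_mon Δ F).pow m) ((IF_free Δ F).pow (IF_mon Δ F) m) α hcon h L hL

lemma X_mul_IF (Δ : SimComplex n) (F) (z : Fin n) :
    Ideal.span {monomial (Finsupp.single z 1) (1:K)} * IF K Δ (insert z F) ≤ IF K Δ F := by
  rw [((isMon_singleton _).mul (IF_mon Δ _)).le_iff]
  intro α h
  rw [E_mul (isMon_singleton _) (IF_mon Δ _)] at h
  obtain ⟨β, γ, hβ, hγ, rfl⟩ := h
  rw [E_singleton, Finsupp.single_le_iff] at hβ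
  rw [E_IF] at hγ ⊢
  refine fun h => hγ (Δ.down_closed h ?_)
  rw [supp_add]
  intro j hj
  simp only [Finset.mem_union, Finset.mem_insert] at hj ⊢
  rcases hj with hj | rfl | hj
  · tauto
  · left; left; rw [Finsupp.mem_support_iff]; omega
  · tauto

lemma IF_le_PF {F G : Finset (Fin n)} (hG : G ∈ Δ.faces) (hFG : F ⊆ G) : IF K Δ F ≤ PF K Gᶜ := by
  rw [(IF_mon Δ F).le_iff]
  intro α h
  rw [E_IF] at h
  rw [E_PF]
  by_contra hcon
  push Not at hcon
  apply h
  refine Δ.down_closed hG (Finset.union_subset ?_ hFG)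
  intro i hi
  by_contra hiG
  exact Finsupp.mem_support_iff.1 hi (hcon i (by simpa using hiG))

lemma Hyp.EIF (H : Hyp K Δ m d) {F : Finset (Fin n)} (hF : F.Nonempty) (α : Fin n →₀ ℕ) :
    E (IF K Δ F ^ m) α ↔ ∀ G ∈ Δ.faces, G.card = d → F ⊆ G → m ≤ ∑ i ∈ Gᶜ, α i := by
  constructor
  · intro h G hG _ hFG
    rw [← E_PF_pow (K := K)]
    exact Ideal.pow_right_mono (IF_le_PF hG hFG) m h
  · induction hk : d - F.card generalizing F with
    | zero =>
      intro h
      by_cases hFf : F ∈ Δ.faces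
      · have h1 := H.le F hFf
        have h2 := h F hFf (by omega) subset_rfl
        rw [← E_PF_pow (K := K)] at h2
        refine Ideal.pow_right_mono ?_ m h2
        rw [(PF_mon _).le_iff]
        intro β hβ
        rw [E_PF] at hβ
        rw [E_IF]
        obtain ⟨i, hi, hβi⟩ := hβ
        intro hcon
        have h3 := H.le _ hcon
        have h4 : F ⊂ β.support ∪ F := by
          refine Finset.ssubset_iff_subset_ne.2 ⟨Finset.subset_union_right, fun e => ?_⟩
          have : i ∈ β.support ∪ F := Finset.mem_union_left _ (Finsupp.mem_support_iff.2 hβi)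
          rw [← e] at this
          simp at hi
          exact hi this
        have := Finset.card_lt_card h4
        omega
      · have : IF K Δ F = ⊤ := by
          apply IsMon.ext (IF_mon Δ F) isMon_top
          intro β
          rw [E_IF]
          exact ⟨fun _ => E_top _, fun _ h => hFf (Δ.down_closed h Finset.subset_union_right)⟩
        rw [this, Ideal.top_pow]; exact E_top _
    | succ k ih =>
      intro h
      apply H.satOff hF (by omega)
      intro z hz
      refine ⟨m, ?_⟩
      have h1 := ih (F := insert z F) (Finset.insert_nonempty _ _) (by rw [Finset.card_insert_of_notMem hz]; omega)
        (fun G hG hGc hs => h G hG hGc ((Finset.subset_insert _ _).trans hs))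
      have := Ideal.pow_right_mono (X_mul_IF (K := K) Δ F z) m
      rw [mul_pow] at this
      apply this
      rw [mon_mul]
      refine Ideal.mul_mem_mul ?_ h1
      have h2 : (monomial (Finsupp.single z m) (1:K) : MvPolynomial (Fin n) K) = (monomial (Finsupp.single z 1) (1:K)) ^ m := by
        rw [monomial_pow, one_pow]; simp
      rw [h2]
      exact Ideal.pow_mem_pow (Ideal.mem_span_singleton_self (monomial (Finsupp.single z 1) (1:K))) m

lemma Hyp.pure (H : Hyp K Δ m d) {F : Finset (Fin n)} (hF : F.Nonempty) (hFf : F ∈ Δ.faces) :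
    ∃ G ∈ Δ.faces, G.card = d ∧ F ⊆ G := by
  by_contra hcon
  push Not at hcon
  have h1 : E (IF K Δ F ^ m) 0 := by
    rw [H.EIF hF]
    intro G hG hc hs
    exact (hcon G hG hc hs).elim
  have h2 : E (IF K Δ F) 0 := Ideal.pow_le_self (by have := H.hm; omega) h1
  rw [E_IF] at h2
  simp at h2
  exact h2 hFf

lemma deg_pow {A : Ideal (MvPolynomial (Fin n) K)} (hA : IsMon A) (W : Finset (Fin n))
    (h : ∀ γ, E A γ → γ.support ⊆ W → 2 ≤ ∑ i, γ i) (m : ℕ) (α) (hα : E (A ^ m) α) (hW : α.support ⊆ W) :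
    2 * m ≤ ∑ i, α i := by
  induction m generalizing α with
  | zero => simp
  | succ m ih =>
    rw [E_pow_succ hA] at hα
    obtain ⟨β, γ, hβ, hγ, rfl⟩ := hα
    rw [supp_add] at hW
    have h1 := ih β hβ (Finset.union_subset_left hW)
    have h2 := h γ hγ (Finset.union_subset_right hW)
    simp only [Finsupp.add_apply, Finset.sum_add_distrib]
    omega

lemma sum_single' (S : Finset (Fin n)) (i : Fin n) (k : ℕ) : ∑ j ∈ S, (Finsupp.single i k : Fin n →₀ ℕ) j = if i ∈ S then k else 0 := by
  simp only [Finsupp.single_apply, Finset.sum_ite_eq]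

lemma facet_insert {F G : Finset (Fin n)} (hs : F ⊆ G) (hc : G.card = F.card + 1) : ∃ x ∉ F, G = insert x F := by
  have : (G \ F).card = 1 := by rw [Finset.card_sdiff_of_subset hs]; omega
  obtain ⟨x, hx⟩ := Finset.card_eq_one.1 this
  have hx' : x ∈ G \ F := by rw [hx]; simp
  refine ⟨x, (Finset.mem_sdiff.1 hx').2, ?_⟩
  rw [← Finset.union_sdiff_of_subset hs, hx, Finset.union_comm]; rfl

lemma Hyp.ridge (H : Hyp K Δ m d) {F : Finset (Fin n)} (hc : F.card + 1 = d) {a b c : Fin n}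
    (hab : a ≠ b) (hac : a ≠ c) (hbc : b ≠ c) (ha : a ∉ F) (hb : b ∉ F) (hcF : c ∉ F)
    (ha' : insert a F ∈ Δ.faces) (hb' : insert b F ∈ Δ.faces) (hc' : insert c F ∈ Δ.faces) : False := by
  have hm := H.hm
  have hd := H.hd
  have hF : F.Nonempty := by rw [← Finset.card_pos]; omega
  let α : Fin n →₀ ℕ := Finsupp.single a (m-1) + Finsupp.single b (m-1) + Finsupp.single c 1
  have h1 : E (IF K Δ F ^ m) α := by
    rw [H.EIF hF]
    intro G hG hGc hs
    obtain ⟨x, hx, rfl⟩ := facet_insert hs (by omega)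
    simp only [α, Finsupp.add_apply, Finset.sum_add_distrib, sum_single']
    simp only [Finset.mem_compl, Finset.mem_insert, ha, hb, hcF, or_false]
    by_cases e1 : a = x
    · subst e1
      simp [hab.symm, hac.symm]; omega
    · by_cases e2 : b = x
      · subst e2; simp [hab, hbc.symm]; omega
      · simp [e1, e2]; omega
  have h2 := deg_pow (IF_mon Δ F) {a, b, c} ?_ m α h1 ?_
  · simp only [α, Finsupp.add_apply, Finset.sum_add_distrib, sum_single'] at h2
    simp at h2
    omega
  · intro γ hγ hs
    rw [E_IF] at hγ
    by_contra hcon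
    push Not at hcon
    apply hγ
    have hx : ∃ x ∈ ({a, b, c} : Finset (Fin n)), γ.support ⊆ {x} := by
      by_cases h0 : γ.support = ∅
      · exact ⟨a, by simp, by simp [h0]⟩
      · obtain ⟨x, hx⟩ := Finset.nonempty_iff_ne_empty.2 h0
        refine ⟨x, hs hx, fun y hy => ?_⟩
        rw [Finset.mem_singleton]
        by_contra hyx
        have : γ x + γ y ≤ ∑ i, γ i := by
          rw [← Finset.sum_pair (f := γ) (Ne.symm hyx)]
          exact Finset.sum_le_sum_of_subset (Finset.subset_univ _)
        have h3 := Finsupp.mem_support_iff.1 hx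
        have h4 := Finsupp.mem_support_iff.1 hy
        omega
    obtain ⟨x, hx, hs2⟩ := hx
    have h3 : insert x F ∈ Δ.faces := by
      simp only [Finset.mem_insert, Finset.mem_singleton] at hx
      rcases hx with rfl | rfl | rfl <;> assumption
    refine Δ.down_closed h3 ?_
    rw [Finset.insert_eq]
    exact Finset.union_subset_union_left hs2
  · intro i hi
    simp only [α, supp_add] at hi
    simp only [Finset.mem_union] at hi
    simp only [Finset.mem_insert, Finset.mem_singleton]
    rcases hi with (hi | hi) | hi
    · left; simpa using Finsupp.support_single_subset hi
    · right; left; simpa using Finsupp.support_single_subset hi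
    · right; right; simpa using Finsupp.support_single_subset hi

/-- intersection of prime powers over a set of facets -/
def PI (K : Type) [Field K] {n : ℕ} (m : ℕ) (P : Finset (Fin n) → Prop) : Ideal (MvPolynomial (Fin n) K) :=
  ⨅ (G : Finset (Fin n)) (_ : P G), PF K Gᶜ ^ m

lemma PI_mon (P : Finset (Fin n) → Prop) : IsMon (PI K m P) :=
  IsMon.iInf fun _ => IsMon.iInf fun _ => (PF_mon _).pow m

lemma E_PI (P : Finset (Fin n) → Prop) (α) : E (PI K m P) α ↔ ∀ G, P G → m ≤ ∑ i ∈ Gᶜ, α i := by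
  unfold PI
  simp only [E_iInf, E_PF_pow]

lemma PI_free (P : Finset (Fin n) → Prop) (F) (h : ∀ G, P G → F ⊆ G) : Free (PI K m P) F := by
  intro i hi α hα
  rw [E_PI] at hα ⊢
  intro G hG
  have := hα G hG
  simp only [Finsupp.add_apply, Finset.sum_add_distrib, sum_single'] at this
  simpa [h G hG hi] using this

lemma PI_sat (P : Finset (Fin n) → Prop) (F) (h : ∀ G, P G → ∃ z ∈ G, z ∉ F) : SatOff (PI K m P) F := by
  intro α hα
  rw [E_PI]
  intro G hG
  obtain ⟨z, hz, hzF⟩ := h G hG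
  obtain ⟨k, hk⟩ := hα z hzF
  rw [E_PI] at hk
  have := hk G hG
  simp only [Finsupp.add_apply, Finset.sum_add_distrib, sum_single'] at this
  simpa [hz] using this

lemma Hyp.c1 (H : Hyp K Δ m d) {F : Finset (Fin n)} (hF : F.Nonempty) (hc : F.card + 2 ≤ d) (α : Fin n →₀ ℕ)
    (C1 C2 : Finset (Fin n) → Prop)
    (h12 : ∀ G, C1 G ∨ C2 G ↔ (G ∈ Δ.faces ∧ G.card = d ∧ F ⊆ G ∧ ∑ i ∈ Gᶜ, α i < m))
    (n1 : ∃ G, C1 G) (n2 : ∃ G, C2 G) (hint : ∀ G1 G2, C1 G1 → C2 G2 → G1 ∩ G2 ⊆ F) : False := by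
  let P1 : Finset (Fin n) → Prop := fun G => (G ∈ Δ.faces ∧ G.card = d ∧ F ⊆ G) ∧ ¬ C2 G
  let P2 : Finset (Fin n) → Prop := fun G => (G ∈ Δ.faces ∧ G.card = d ∧ F ⊆ G) ∧ ¬ C1 G
  have hz : ∀ G : Finset (Fin n), G.card = d → ∃ z ∈ G, z ∉ F := by
    intro G hG
    by_contra hcon
    push Not at hcon
    have := Finset.card_le_card (show G ⊆ F from hcon)
    omega
  have hno : ∀ G, C1 G → C2 G → False := by
    intro G hG1 hG2
    have h1 := (h12 G).1 (Or.inl hG1)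
    have h2 := hint G G hG1 hG2
    rw [Finset.inter_self] at h2
    have := Finset.card_le_card h2
    omega
  have z1 : ZZ (maxIdeal K n) F.card (MvPolynomial (Fin n) K ⧸ PI K m P1) :=
    M2 (PI_mon _) (PI_free _ _ fun G hG => hG.1.2.2) (PI_sat _ _ fun G hG => hz G hG.1.2.1)
  have z2 : ZZ (maxIdeal K n) F.card (MvPolynomial (Fin n) K ⧸ PI K m P2) :=
    M2 (PI_mon _) (PI_free _ _ fun G hG => hG.1.2.2) (PI_sat _ _ fun G hG => hz G hG.1.2.1)
  have hinf : PI K m P1 ⊓ PI K m P2 = IF K Δ F ^ m := by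
    apply IsMon.ext ((PI_mon _).inf (PI_mon _)) ((IF_mon _ _).pow m)
    intro β
    rw [E_inf, E_PI, E_PI, H.EIF hF]
    constructor
    · rintro ⟨h1, h2⟩ G hG hGc hs
      by_cases hC : C2 G
      · exact h2 G ⟨⟨hG, hGc, hs⟩, fun h => hno G h hC⟩
      · exact h1 G ⟨⟨hG, hGc, hs⟩, hC⟩
    · intro h
      exact ⟨fun G hG => h G hG.1.1 hG.1.2.1 hG.1.2.2, fun G hG => h G hG.1.1 hG.1.2.1 hG.1.2.2⟩
  have hex := mv_delta (J := maxIdeal K n) z1 z2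
  rw [hinf] at hex
  obtain ⟨δ, hδ⟩ := hex
  obtain ⟨L, hL⟩ := H.kill hF (t := F.card + 1) (by omega)
  refine M3 ((PI_mon (K := K) (m := m) P1).sup (PI_mon (m := m) P2)) (Free.sup (PI_mon _) (PI_mon _) (PI_free _ _ fun G hG => hG.1.2.2)
    (PI_free _ _ fun G hG => hG.1.2.2)) α ?_ ?_ L ?_
  · rw [E_sup (PI_mon _) (PI_mon _), E_PI, E_PI]
    rintro (h | h)
    · obtain ⟨G, hG⟩ := n1
      have h1 := (h12 G).1 (Or.inl hG)
      have := h G ⟨⟨h1.1, h1.2.1, h1.2.2.1⟩, fun h => hno G hG h⟩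
      omega
    · obtain ⟨G, hG⟩ := n2
      have h1 := (h12 G).1 (Or.inr hG)
      have := h G ⟨⟨h1.1, h1.2.1, h1.2.2.1⟩, fun h => hno G h hG⟩
      omega
  · intro z hzF
    refine ⟨m, ?_⟩
    rw [E_sup (PI_mon _) (PI_mon _), E_PI, E_PI]
    have key : ∀ C C' : Finset (Fin n) → Prop, (∀ G, C G ∨ C' G ↔ (G ∈ Δ.faces ∧ G.card = d ∧ F ⊆ G ∧ ∑ i ∈ Gᶜ, α i < m)) →
        (∀ G, C G → z ∉ G) → ∀ G, ((G ∈ Δ.faces ∧ G.card = d ∧ F ⊆ G) ∧ ¬ C' G) → m ≤ ∑ i ∈ Gᶜ, (Finsupp.single z m + α) i := by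
      intro C C' hCC hzC G hG
      simp only [Finsupp.add_apply, Finset.sum_add_distrib, sum_single']
      by_cases hCG : C G
      · simp [hzC G hCG]
      · have : ¬ (C G ∨ C' G) := not_or.2 ⟨hCG, hG.2⟩
        rw [hCC] at this
        have : ¬ (∑ i ∈ Gᶜ, α i < m) := fun h => this ⟨hG.1.1, hG.1.2.1, hG.1.2.2, h⟩
        omega
    by_cases hzz : ∀ G, C1 G → z ∉ G
    · left; exact key C1 C2 h12 hzz
    · right
      push Not at hzz
      obtain ⟨G1, hG1, hz1⟩ := hzz
      refine key C2 C1 (fun G => by rw [or_comm]; exact h12 G) ?_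
      intro G2 hG2 hz2
      exact hzF (hint G1 G2 hG1 hG2 (Finset.mem_inter.2 ⟨hz1, hz2⟩))
  · intro ξ
    apply hδ
    rw [map_smul, map_zero]
    exact hL _

lemma Hyp.conn (H : Hyp K Δ m d) {F : Finset (Fin n)} (hF : F.Nonempty) (hc : F.card + 2 ≤ d)
    (C1 : Finset (Fin n) → Prop)
    (n1 : ∃ G ∈ Δ.faces, G.card = d ∧ F ⊆ G ∧ C1 G) (n2 : ∃ G ∈ Δ.faces, G.card = d ∧ F ⊆ G ∧ ¬ C1 G) :
    ∃ G1 ∈ Δ.faces, ∃ G2 ∈ Δ.faces, G1.card = d ∧ G2.card = d ∧ F ⊆ G1 ∧ F ⊆ G2 ∧ C1 G1 ∧ ¬ C1 G2 ∧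
      ∃ z ∉ F, z ∈ G1 ∧ z ∈ G2 := by
  by_contra hcon
  push Not at hcon
  have hm := H.hm
  refine H.c1 hF hc 0 (fun G => (G ∈ Δ.faces ∧ G.card = d ∧ F ⊆ G) ∧ C1 G) (fun G => (G ∈ Δ.faces ∧ G.card = d ∧ F ⊆ G) ∧ ¬ C1 G) ?_ ?_ ?_ ?_
  · intro G
    rw [← and_or_left, and_iff_left (em _)]
    simp
    omega
  · obtain ⟨G, h1, h2, h3, h4⟩ := n1; exact ⟨G, ⟨h1, h2, h3⟩, h4⟩
  · obtain ⟨G, h1, h2, h3, h4⟩ := n2; exact ⟨G, ⟨h1, h2, h3⟩, h4⟩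
  · rintro G1 G2 ⟨⟨a1, a2, a3⟩, a4⟩ ⟨⟨b1, b2, b3⟩, b4⟩ z hz
    by_contra hzF
    rw [Finset.mem_inter] at hz
    exact hcon G1 a1 G2 b1 a2 b2 a3 b3 a4 b4 z hzF hz.1 hz.2

lemma Hyp.path (H : Hyp K Δ m d) {F : Finset (Fin n)} (hc : F.card + 2 = d) {a b c e : Fin n}
    (hab : a ≠ b) (hac : a ≠ c) (hae : a ≠ e) (hbc : b ≠ c) (hbe : b ≠ e) (hce : c ≠ e)
    (ha : a ∉ F) (hb : b ∉ F) (hcF : c ∉ F) (he : e ∉ F)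
    (h1 : insert a (insert b F) ∈ Δ.faces) (h2 : insert b (insert c F) ∈ Δ.faces)
    (h3 : insert c (insert e F) ∈ Δ.faces) : insert a (insert e F) ∈ Δ.faces := by
  by_contra hcon
  have hm := H.hm
  have hd := H.hd
  have hF : F.Nonempty := by rw [← Finset.card_pos]; omega
  have hbeF : insert b (insert e F) ∉ Δ.faces := by
    intro h
    refine H.ridge (F := insert b F) (by rw [Finset.card_insert_of_notMem hb]; omega) hac hae hce
      ?_ ?_ ?_ h1 ?_ ?_
    · simp [hab, ha]
    · simp [hbc.symm, hcF]
    · simp [hbe.symm, he]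
    · rw [Finset.insert_comm]; exact h2
    · rw [Finset.insert_comm]; exact h
  let α : Fin n →₀ ℕ := Finsupp.single a (m-2) + Finsupp.single b 1 + Finsupp.single e (m-1)
  refine H.c1 hF hc.le α (fun G => G = insert a (insert b F)) (fun G => (G ∈ Δ.faces ∧ G.card = d ∧ F ⊆ G) ∧ e ∈ G) ?_ ?_ ?_ ?_
  · intro G
    constructor
    · rintro (rfl | ⟨⟨g1, g2, g3⟩, g4⟩)
      · refine ⟨h1, ?_, ?_, ?_⟩
        · rw [Finset.card_insert_of_notMem (by simp [hab, ha]), Finset.card_insert_of_notMem hb]; omega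
        · exact (Finset.subset_insert _ _).trans (Finset.subset_insert _ _)
        · simp only [α, Finsupp.add_apply, Finset.sum_add_distrib, sum_single']
          simp [hae.symm, hbe.symm, he]
          omega
      · refine ⟨g1, g2, g3, ?_⟩
        simp only [α, Finsupp.add_apply, Finset.sum_add_distrib, sum_single']
        simp only [Finset.mem_compl, g4, not_true, if_false]
        split_ifs <;> omega
    · rintro ⟨g1, g2, g3, g4⟩
      by_cases hg : e ∈ G
      · exact Or.inr ⟨⟨g1, g2, g3⟩, hg⟩
      · left
        simp only [α, Finsupp.add_apply, Finset.sum_add_distrib, sum_single'] at g4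
        simp only [Finset.mem_compl, hg, not_false_eq_true, if_true] at g4
        have ha' : a ∈ G := by by_contra h; simp only [h, not_false_eq_true, if_true] at g4; omega
        have hb' : b ∈ G := by by_contra h; simp only [h, not_false_eq_true, if_true] at g4; omega
        symm
        apply Finset.eq_of_subset_of_card_le
        · exact Finset.insert_subset ha' (Finset.insert_subset hb' g3)
        · rw [Finset.card_insert_of_notMem (by simp [hab, ha]), Finset.card_insert_of_notMem hb]; omega
  · exact ⟨_, rfl⟩
  · refine ⟨_, ⟨h3, ?_, ?_⟩, ?_⟩
    · rw [Finset.card_insert_of_notMem (by simp [hce, hcF]), Finset.card_insert_of_notMem he]; omega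
    · exact (Finset.subset_insert _ _).trans (Finset.subset_insert _ _)
    · simp
  · rintro G1 G2 rfl ⟨⟨g1, g2, g3⟩, g4⟩ z hz
    simp only [Finset.mem_inter, Finset.mem_insert] at hz
    obtain ⟨rfl | rfl | hz, hz2⟩ := hz
    · exact (hcon (Δ.down_closed g1 (Finset.insert_subset hz2 (Finset.insert_subset g4 g3)))).elim
    · exact (hbeF (Δ.down_closed g1 (Finset.insert_subset hz2 (Finset.insert_subset g4 g3)))).elim
    · exact hz

end LC
end

end

section
open CategoryTheory Opposite Limits
noncomputable section
namespace LC
open MvPolynomial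
variable {K : Type} [Field K] {n : ℕ} {Δ : SimComplex n} {m d : ℕ}

structure Good (Δ : SimComplex n) (d : ℕ) (B : Set (Finset (Fin n))) (G H : Finset (Fin n)) : Prop where
  face : H ∈ Δ.faces
  card : H.card = d
  flip : ∀ v ∈ H, ∀ w, w ∉ H → (insert w (H.erase v) ∈ Δ.faces ↔ ∃ b ∈ B, v ∈ b ∧ w ∈ b)
  ex : ∀ b ∈ B, ∃ w ∈ b, w ∉ H
  uniq : ∀ b ∈ B, ∀ x ∈ b, ∀ y ∈ b, x ∉ H → y ∉ H → x = y
  out : ∀ x, (∀ b ∈ B, x ∉ b) → (x ∈ G ↔ x ∈ H)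

lemma card_flip {H : Finset (Fin n)} {v w : Fin n} (hv : v ∈ H) (hw : w ∉ H) :
    (insert w (H.erase v)).card = H.card := by
  rw [Finset.card_insert_of_notMem (fun h => hw (Finset.mem_of_mem_erase h)), Finset.card_erase_of_mem hv]
  have := Finset.card_pos.2 ⟨v, hv⟩
  omega

lemma Hyp.uniq_flip (Hy : Hyp K Δ m d) {H : Finset (Fin n)} (hH : H ∈ Δ.faces) (hc : H.card = d)
    {v w z : Fin n} (hv : v ∈ H) (hw : w ∉ H) (hz : z ∉ H) (h1 : insert w (H.erase v) ∈ Δ.faces)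
    (h2 : insert z (H.erase v) ∈ Δ.faces) : w = z := by
  by_contra hwz
  have hvw : v ≠ w := fun h => hw (h ▸ hv)
  have hvz : v ≠ z := fun h => hz (h ▸ hv)
  refine Hy.ridge (F := H.erase v) (a := v) (b := w) (c := z) ?_ hvw hvz hwz (by simp) (by simp [hw]) (by simp [hz]) ?_ h1 h2
  · rw [Finset.card_erase_of_mem hv, hc]; have := Hy.hd; omega
  · rwa [Finset.insert_erase hv]

lemma Hyp.flip_step (Hy : Hyp K Δ m d) {H : Finset (Fin n)} (hH : H ∈ Δ.faces) (hc : H.card = d)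
    {v w u z : Fin n} (hv : v ∈ H) (hw : w ∉ H) (hu : u ∈ H) (huv : u ≠ v) (hz : z ∉ H) (hzw : z ≠ w)
    (h1 : insert w (H.erase v) ∈ Δ.faces) (h2 : insert z (H.erase u) ∈ Δ.faces) :
    insert z ((insert w (H.erase v)).erase u) ∈ Δ.faces := by
  have hwu : w ≠ u := fun h => hw (h ▸ hu)
  have hwv : w ≠ v := fun h => hw (h ▸ hv)
  have hzu : z ≠ u := fun h => hz (h ▸ hu)
  have hzv : z ≠ v := fun h => hz (h ▸ hv)
  have := Hy.path (F := (H.erase u).erase v) (a := w) (b := u) (c := v) (e := z) ?_ hwu hwv hzw.symm huv hzu.symm hzv.symm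
    (by simp [hw]) (by simp) (by simp) (by simp [hz]) ?_ ?_ ?_
  · convert this using 1
    ext x; simp only [Finset.mem_insert, Finset.mem_erase]; grind
  · rw [Finset.card_erase_of_mem (by simp [hv, huv.symm]), Finset.card_erase_of_mem hu, hc]
    have := Hy.hd; omega
  · convert h1 using 1
    ext x; simp only [Finset.mem_insert, Finset.mem_erase]; grind
  · convert hH using 1
    ext x; simp only [Finset.mem_insert, Finset.mem_erase]; grind
  · convert h2 using 1
    ext x; simp only [Finset.mem_insert, Finset.mem_erase]; grind

lemma Good.step (Hy : Hyp K Δ m d) {B : Set (Finset (Fin n))} {G H : Finset (Fin n)}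
    (hB : ∀ b ∈ B, ∀ b' ∈ B, b ≠ b' → Disjoint b b')
    (g : Good Δ d B G H) {v w : Fin n} (hv : v ∈ H) (hw : w ∉ H) (h : insert w (H.erase v) ∈ Δ.faces) :
    Good Δ d B G (insert w (H.erase v)) := by
  have hwv : w ≠ v := fun h => hw (h ▸ hv)
  obtain ⟨b0, hb0, hvb, hwb⟩ := (g.flip v hv w hw).1 h
  have hB' : ∀ b ∈ B, ∀ x, x ∈ b → x ∈ b0 → b = b0 := by
    intro b hb x h1 h2
    by_contra hne
    exact Finset.disjoint_left.1 (hB b hb b0 hb0 hne) h1 h2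
  have hc : (insert w (H.erase v)).card = d := (card_flip hv hw).trans g.card
  have hmem : ∀ x, x ∈ insert w (H.erase v) ↔ x = w ∨ (x ≠ v ∧ x ∈ H) := by
    intro x; simp
  have hback : insert v ((insert w (H.erase v)).erase w) = H := by
    ext x; simp only [Finset.mem_insert, Finset.mem_erase]; grind
  refine ⟨h, hc, ?_, ?_, ?_, ?_⟩
  · intro a ha b hb
    rw [hmem] at ha hb
    push Not at hb
    by_cases haw : a = w
    · subst haw
      by_cases hbv : b = v
      · subst hbv
        rw [hback]
        exact ⟨fun _ => ⟨b0, hb0, hwb, hvb⟩, fun _ => g.face⟩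
      · have hbH : b ∉ H := hb.2 hbv
        constructor
        · intro h2
          exact absurd (Hy.uniq_flip h hc (v := a) (w := v) (z := b) (by simp) (by simp [hwv.symm]) (by simp [hbH, hb.1])
            (by rw [hback]; exact g.face) h2).symm hbv
        · rintro ⟨c, hcB, h1, h2⟩
          exact absurd (g.uniq c hcB b h2 a h1 hbH hw) hb.1
    · obtain ⟨hav, haH⟩ := ha.resolve_left haw
      by_cases hbv : b = v
      · subst hbv
        have : insert b ((insert w (H.erase b)).erase a) = insert w (H.erase a) := by
          ext x; simp only [Finset.mem_insert, Finset.mem_erase]; grind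
        rw [this, g.flip a haH w hw]
        constructor
        · rintro ⟨c, hcB, h1, h2⟩
          obtain rfl := hB' c hcB w h2 hwb
          exact ⟨c, hcB, h1, hvb⟩
        · rintro ⟨c, hcB, h1, h2⟩
          obtain rfl := hB' c hcB b h2 hvb
          exact ⟨c, hcB, h1, hwb⟩
      · have hbH : b ∉ H := hb.2 hbv
        rw [← g.flip a haH b hbH]
        constructor
        · intro h2
          have := Hy.flip_step h hc (v := w) (w := v) (u := a) (z := b) (by simp) (by simp [hwv.symm])
            (by simp [haH, hav]) haw (by simp [hbH, hb.1]) hbv (by rw [hback]; exact g.face) h2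
          rwa [hback] at this
        · intro h2
          exact Hy.flip_step g.face g.card hv hw haH hav hbH hb.1 h h2
  · intro b hb
    by_cases hbb : b = b0
    · subst hbb
      exact ⟨v, hvb, by simp [hwv.symm]⟩
    · obtain ⟨x, hx, hxH⟩ := g.ex b hb
      refine ⟨x, hx, ?_⟩
      rw [hmem]
      rintro (rfl | h2)
      · exact hbb (hB' b hb _ hx hwb)
      · exact hxH h2.2
  · intro b hb x hx y hy hxH hyH
    rw [hmem] at hxH hyH
    push Not at hxH hyH
    by_cases hxv : x = v
    · by_cases hyv : y = v
      · rw [hxv, hyv]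
      · obtain rfl := hB' b hb v (hxv ▸ hx) hvb
        exact absurd (g.uniq b hb y hy w hwb (hyH.2 hyv) hw) hyH.1
    · by_cases hyv : y = v
      · obtain rfl := hB' b hb v (hyv ▸ hy) hvb
        exact absurd (g.uniq b hb x hx w hwb (hxH.2 hxv) hw) hxH.1
      · exact g.uniq b hb x hx y hy (hxH.2 hxv) (hyH.2 hyv)
  · intro x hx
    rw [g.out x hx, hmem]
    have h1 : x ≠ w := fun h => hx b0 hb0 (h ▸ hwb)
    have h2 : x ≠ v := fun h => hx b0 hb0 (h ▸ hvb)
    tauto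

lemma Good.share (Hy : Hyp K Δ m d) {B : Set (Finset (Fin n))} {G : Finset (Fin n)}
    (hB : ∀ b ∈ B, ∀ b' ∈ B, b ≠ b' → Disjoint b b') (k : ℕ) : ∀ {F H1 H2 : Finset (Fin n)}, F.Nonempty → d = F.card + k →
    F ⊆ H1 → F ⊆ H2 → Good Δ d B G H1 → H2 ∈ Δ.faces → H2.card = d → Good Δ d B G H2 := by
  induction k with
  | zero =>
    intro F H1 H2 hF hk h1 h2 g hf hc
    rw [← Finset.eq_of_subset_of_card_le h2 (by omega), Finset.eq_of_subset_of_card_le h1 (by have := g.card; omega)]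
    exact g
  | succ k ih =>
    intro F H1 H2 hF hk h1 h2 g hf hc
    rcases Nat.eq_zero_or_pos k with rfl | hk0
    · obtain ⟨x, hx, rfl⟩ := facet_insert h1 (by have := g.card; omega)
      obtain ⟨y, hy, rfl⟩ := facet_insert h2 (by omega)
      by_cases hxy : x = y
      · subst hxy; exact g
      have e : insert y ((insert x F).erase x) = insert y F := by rw [Finset.erase_insert hx]
      have := Good.step Hy hB g (v := x) (w := y) (by simp) (by simp [hy, Ne.symm hxy]) (by rw [e]; exact hf)
      rwa [e] at this
    · by_contra hcon
      obtain ⟨G1, f1, G2, f2, c1, c2, s1, s2, g1, g2, z, hz, z1, z2⟩ := Hy.conn hF (by omega) (Good Δ d B G)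
        ⟨H1, g.face, g.card, h1, g⟩ ⟨H2, hf, hc, h2, hcon⟩
      exact g2 (ih (F := insert z F) (by simp) (by rw [Finset.card_insert_of_notMem hz]; omega)
        (Finset.insert_subset z1 s1) (Finset.insert_subset z2 s2) g1 f2 c2)

lemma Good.share' (Hy : Hyp K Δ m d) {B : Set (Finset (Fin n))} {G : Finset (Fin n)}
    (hB : ∀ b ∈ B, ∀ b' ∈ B, b ≠ b' → Disjoint b b') {H1 H2 : Finset (Fin n)} {x : Fin n} (h1 : x ∈ H1) (h2 : x ∈ H2)
    (g : Good Δ d B G H1) (hf : H2 ∈ Δ.faces) (hc : H2.card = d) : Good Δ d B G H2 :=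
  Good.share Hy hB (d - 1) (F := {x}) (by simp) (by have := Hy.hd; simp; omega) (by simpa) (by simpa) g hf hc

lemma Good.reach (Hy : Hyp K Δ m d) {B : Set (Finset (Fin n))} {G : Finset (Fin n)}
    (hB : ∀ b ∈ B, ∀ b' ∈ B, b ≠ b' → Disjoint b b') (g : Good Δ d B G G) {v x : Fin n} (hv : v ∈ G)
    (hr : Δ.Reach v x) : ∃ H, x ∈ H ∧ Good Δ d B G H := by
  induction hr with
  | refl => exact ⟨G, hv, g⟩
  | tail _ hadj ih =>
    rename_i y z _
    obtain ⟨H, hy, gH⟩ := ih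
    obtain ⟨H', f', c', s'⟩ := Hy.pure (F := {y, z}) (by simp) hadj.2
    exact ⟨H', s' (by simp), Good.share' Hy hB hy (s' (by simp)) gH f' c'⟩

lemma exists_blocks (Hy : Hyp K Δ m d) {G : Finset (Fin n)} (hG : G ∈ Δ.faces) (hc : G.card = d) :
    ∃ B : Set (Finset (Fin n)), (∀ b ∈ B, ∀ b' ∈ B, b ≠ b' → Disjoint b b') ∧ Good Δ d B G G := by
  classical
  let bl : Fin n → Finset (Fin n) := fun w => insert w (G.filter fun v => insert w (G.erase v) ∈ Δ.faces)
  have hbl : ∀ w x, x ∈ bl w ↔ x = w ∨ (x ∈ G ∧ insert w (G.erase x) ∈ Δ.faces) := by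
    intro w x; simp [bl]
  have hbo : ∀ w x, x ∉ G → x ∈ bl w → x = w := by
    intro w x hx h
    rw [hbl] at h
    tauto
  refine ⟨{b | ∃ w, w ∉ G ∧ b = bl w}, ?_, hG, hc, ?_, ?_, ?_, ?_⟩
  · rintro _ ⟨w, hw, rfl⟩ _ ⟨w', hw', rfl⟩ hne
    rw [Finset.disjoint_left]
    intro x h1 h2
    by_cases hx : x ∈ G
    · rw [hbl] at h1 h2
      have e1 := h1.resolve_left (fun h => hw (h ▸ hx))
      have e2 := h2.resolve_left (fun h => hw' (h ▸ hx))
      exact hne (by rw [Hy.uniq_flip hG hc hx hw hw' e1.2 e2.2])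
    · exact hne (by rw [← hbo w x hx h1, ← hbo w' x hx h2])
  · intro v hv w hw
    constructor
    · intro h
      exact ⟨bl w, ⟨w, hw, rfl⟩, (hbl _ _).2 (Or.inr ⟨hv, h⟩), (hbl _ _).2 (Or.inl rfl)⟩
    · rintro ⟨_, ⟨w', hw', rfl⟩, h1, h2⟩
      obtain rfl := hbo w' w hw h2
      rw [hbl] at h1
      exact (h1.resolve_left (fun h => hw (h ▸ hv))).2
  · rintro _ ⟨w, hw, rfl⟩
    exact ⟨w, (hbl _ _).2 (Or.inl rfl), hw⟩
  · rintro _ ⟨w, hw, rfl⟩ x hx y hy hxG hyG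
    rw [hbo w x hxG hx, hbo w y hyG hy]
  · exact fun x _ => Iff.rfl

lemma Good.face_of (Hy : Hyp K Δ m d) {B : Set (Finset (Fin n))} {G F : Finset (Fin n)}
    (hB : ∀ b ∈ B, ∀ b' ∈ B, b ≠ b' → Disjoint b b')
    (hF : ∀ x ∈ F, ∃ H, x ∈ H ∧ Good Δ d B G H) (hFB : ∀ b ∈ B, ¬ b ⊆ F) (k : ℕ) :
    ∀ H, Good Δ d B G H → (F \ H).card = k → F ∈ Δ.faces := by
  induction k using Nat.strong_induction_on with
  | _ k ih =>
    intro H g hk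
    by_cases hs : F ⊆ H
    · exact Δ.down_closed g.face hs
    obtain ⟨z, hzF, hzH⟩ := Finset.not_subset.1 hs
    obtain ⟨H', hz', g'⟩ := hF z hzF
    have : ∃ b ∈ B, z ∈ b := by
      by_contra hcon
      push Not at hcon
      exact hzH ((g.out z hcon).1 ((g'.out z hcon).2 hz'))
    obtain ⟨b, hb, hzb⟩ := this
    obtain ⟨v, hvb, hvF⟩ := Finset.not_subset.1 (hFB b hb)
    have hvz : v ≠ z := fun h => hvF (h ▸ hzF)
    have hvH : v ∈ H := by
      by_contra hcon
      exact hvz (g.uniq b hb v hvb z hzb hcon hzH)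
    have hfl := (g.flip v hvH z hzH).2 ⟨b, hb, hvb, hzb⟩
    refine ih _ ?_ _ (Good.step Hy hB g hvH hzH hfl) rfl
    rw [← hk]
    apply Finset.card_lt_card
    rw [Finset.ssubset_iff_of_subset]
    · exact ⟨z, by simp [hzF, hzH], by simp⟩
    · intro x hx
      simp only [Finset.mem_sdiff, Finset.mem_insert, Finset.mem_erase] at hx ⊢
      refine ⟨hx.1, fun h => hx.2 (Or.inr ⟨fun e => hvF (e ▸ hx.1), h⟩)⟩

theorem Hyp.ci (Hy : Hyp K Δ m d) {v : Fin n} (hv : v ∈ Δ.vertexSet) : (Δ.component v).IsCompleteIntersection := by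
  obtain ⟨G, hG, hc, hs⟩ := Hy.pure (F := {v}) (by simp) hv
  have hvG : v ∈ G := hs (by simp)
  obtain ⟨B, hB, g⟩ := exists_blocks Hy hG hc
  have key : ∀ F, (Δ.component v).IsMinNonface F → F ∈ B := by
    rintro F ⟨hFv, hFn, hFm⟩
    have hW : ∀ x ∈ F, Δ.Reach v x := by
      intro x hx
      have := (hFv hx : ({x} : Finset (Fin n)) ∈ (Δ.component v).faces)
      have h2 := this.2
      exact h2 (by simp)
    have hW' : ↑F ⊆ {u | Δ.Reach v u} := fun x hx => hW x hx
    have hFΔ : F ∉ Δ.faces := fun h => hFn ⟨h, hW'⟩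
    have : ∃ b ∈ B, b ⊆ F := by
      by_contra hcon
      push Not at hcon
      exact hFΔ (Good.face_of Hy hB (fun x hx => Good.reach Hy hB g hvG (hW x hx)) hcon _ G g rfl)
    obtain ⟨b, hb, hbF⟩ := this
    by_cases hbe : b = F
    · exact hbe ▸ hb
    have hbf := (hFm b (hbF.ssubset_of_ne hbe)).1
    obtain ⟨x, hx, -⟩ := g.ex b hb
    obtain ⟨H', f', c', s'⟩ := Hy.pure ⟨x, hx⟩ hbf
    obtain ⟨H, hxH, gH⟩ := Good.reach Hy hB g hvG (hW x (hbF hx))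
    obtain ⟨w, hw, hwH⟩ := (Good.share' Hy hB hxH (s' hx) gH f' c').ex b hb
    exact absurd (s' hw) hwH
  intro F1 F2 h1 h2 hne
  exact hB _ (key _ h1) _ (key _ h2) hne

theorem Hyp.comp_dim (Hy : Hyp K Δ m d) {v : Fin n} (hv : v ∈ Δ.vertexSet) : (Δ.component v).dim = Int.ofNat d - 1 := by
  obtain ⟨G, hG, hc, hs⟩ := Hy.pure (F := {v}) (by simp) hv
  have hGc : G ∈ (Δ.component v).faces := ⟨hG, fun x hx => reach_face hG (hs (by simp)) hx⟩
  have h1 := card_le_sSup (Δ.component v) hGc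
  obtain ⟨F, hF, hFc⟩ := exists_card_sSup (Δ.component v) ⟨G, hGc⟩
  have h2 := Hy.le F hF.1
  have : sSup (Finset.card '' (Δ.component v).faces) = d := by omega
  unfold SimComplex.dim
  rw [this]

theorem two_three (hdim : 2 ≤ Δ.dim) (hm : 3 ≤ m) (hg : IsGeneralizedCM K (SRIdeal K Δ ^ m)) :
    (∀ v ∈ Δ.vertexSet, (Δ.component v).IsCompleteIntersection) ∧
    (∀ u ∈ Δ.vertexSet, ∀ v ∈ Δ.vertexSet, (Δ.component u).dim = (Δ.component v).dim) := by
  have hd : 3 ≤ sSup (Finset.card '' Δ.faces) := by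
    unfold SimComplex.dim at hdim
    have : (2:ℤ) ≤ (sSup (Finset.card '' Δ.faces) : ℕ) - 1 := hdim
    omega
  have hne : ∃ F, F ∈ Δ.faces := by
    by_contra hcon
    push Not at hcon
    rw [Set.eq_empty_of_forall_notMem hcon] at hd
    simp at hd
  have Hy : Hyp K Δ m (sSup (Finset.card '' Δ.faces)) :=
    ⟨hm, hd, hg, fun F hF => card_le_sSup Δ hF, exists_card_sSup Δ hne⟩
  exact ⟨fun v hv => Hy.ci hv, fun u hu v hv => by rw [Hy.comp_dim hu, Hy.comp_dim hv]⟩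

end LC
end

end

/-- **Theorem.** For `dim Δ ≥ 2`: all ordinary powers of `I_Δ` are generalized
Cohen–Macaulay iff some `I_Δ^m`, `m ≥ 3`, is generalized Cohen–Macaulay iff `Δ` is a
union of disjoint complete intersections of the same dimension. -/
theorem ordinary_powers_genCM_iff_union_of_CIs (K : Type) [Field K] {n : ℕ}
    (Δ : SimComplex n)
    (hV : ∀ i : Fin n, ({i} : Finset (Fin n)) ∈ Δ.faces) (hdim : 2 ≤ Δ.dim) :
    List.TFAE
      [∀ m : ℕ, 1 ≤ m → IsGeneralizedCM K (SRIdeal K Δ ^ m),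
       ∃ m : ℕ, 3 ≤ m ∧ IsGeneralizedCM K (SRIdeal K Δ ^ m),
       (∀ v ∈ Δ.vertexSet, (Δ.component v).IsCompleteIntersection) ∧
         (∀ u ∈ Δ.vertexSet, ∀ v ∈ Δ.vertexSet, (Δ.component u).dim = (Δ.component v).dim)] := by
  tfae_have 1 → 2 := fun h => ⟨3, le_rfl, h 3 (by norm_num)⟩
  tfae_have 2 → 3 := fun ⟨m, hm, hg⟩ => LC.two_three hdim hm hg
  tfae_have 3 → 1 := fun h m _ => LC.three_one Δ hV hdim h.1 h.2 m
  tfae_finish
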